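/- arXiv:1602.07387 — 12 statements merged into one kernel-verified Lean document; each statement's English description precedes it below -/
import Mathlib

section
/- For every integer k ≥ 1 and every ε ≥ 0, the k-RAPPOR mechanism with privacy parameter ε is ε-locally differentially private; that is, for all inputs x, x' ∈ {1,…,k} and every output vector y ∈ {0,1}^k, the probability that k-RAPPOR applied to x outputs y is at most e^ε times the probability that k-RAPPOR applied to x' outputs y. -/
/-- The `k`-RAPPOR mechanism with privacy parameter `ε`: the input `x ∈ {1,…,k}` is
mapped to the standard basis bit vector `e_x ∈ {0,1}^k`, and each of the `k` bits is
independently kept with probability `e^{ε/2}/(1+e^{ε/2})` and flipped with probability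
`1/(1+e^{ε/2})`.  `kRappor k ε x y` is the probability that the output is `y`. -/
noncomputable def kRappor (k : ℕ) (ε : ℝ) (x : Fin k) (y : Fin k → Bool) : ℝ :=
  ∏ j : Fin k,
    if y j = decide (j = x) then Real.exp (ε / 2) / (1 + Real.exp (ε / 2))
    else 1 / (1 + Real.exp (ε / 2))

/-- For every integer `k ≥ 1` and every `ε ≥ 0`, the `k`-RAPPOR mechanism is
`ε`-locally differentially private: for all inputs `x, x'` and every output vector
`y ∈ {0,1}^k`, `P(y|x) ≤ e^ε · P(y|x')`. -/
theorem kRappor_locally_differentially_private (k : ℕ) (hk : 1 ≤ k) (ε : ℝ) (hε : 0 ≤ ε) :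
    ∀ (x x' : Fin k) (y : Fin k → Bool),
      kRappor k ε x y ≤ Real.exp ε * kRappor k ε x' y := by
  intro x x' y
  have he : 1 ≤ Real.exp (ε / 2) := Real.one_le_exp (by linarith)
  have hg : Real.exp ε = ∏ j : Fin k, ((if j = x then Real.exp (ε / 2) else 1) *
      (if j = x' then Real.exp (ε / 2) else 1)) := by
    rw [Finset.prod_mul_distrib]
    simp only [Finset.prod_ite_eq', Finset.mem_univ, if_true]
    rw [← Real.exp_add]
    congr 1
    ring
  unfold kRappor
  rw [hg, ← Finset.prod_mul_distrib]
  generalize Real.exp (ε / 2) = e at he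
  have hp : 0 < 1 + e := by linarith
  apply Finset.prod_le_prod
  · intro j _
    split_ifs <;> positivity
  · intro j _
    have h1 : e / (1 + e) = e * (1 / (1 + e)) := by ring
    have h2 : 0 < 1 / (1 + e) := by positivity
    rw [h1]
    generalize 1 / (1 + e) = c at h2
    have h3 : c ≤ e * c := by nlinarith
    have h4 : e * c ≤ e * (e * c) := by nlinarith
    by_cases hx : j = x <;> by_cases hx' : j = x' <;> cases hy : y j <;>
      simp [hx, hx'] <;> (try split_ifs) <;> nlinarith
end

section
/- Let k = 2, let ε ≥ 0, let n ≥ 1, and let ℓ : S² × S² → [0,∞) be any loss function. For every ε-locally differentially private mechanism Q from {1,2} to a finite output alphabet, the minimax risk of Warner's randomized response mechanism Q_WRR is at most the minimax risk of Q: r_{ℓ,ε,2,n}(Q_WRR) ≤ r_{ℓ,ε,2,n}(Q). In particular Q_WRR attains the infimum of the minimax risk over all ε-locally differentially private mechanisms on binary alphabets. -/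
open scoped ENNReal

/-- The probability simplex `S^k`. -/
abbrev ProbSimplex (k : ℕ) : Type := {p : Fin k → ℝ // (∀ i, 0 ≤ p i) ∧ ∑ i, p i = 1}

/-- A `k × l` mechanism is row-stochastic. -/
def RowStochastic {k l : ℕ} (Q : Fin k → Fin l → ℝ) : Prop :=
  (∀ x y, 0 ≤ Q x y) ∧ ∀ x, ∑ y, Q x y = 1

/-- `ε`-local differential privacy: `Q(y|x) ≤ e^ε Q(y|x')` for all `x, x', y`. -/
def LDP {k l : ℕ} (ε : ℝ) (Q : Fin k → Fin l → ℝ) : Prop :=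
  ∀ x x' y, Q x y ≤ Real.exp ε * Q x' y

/-- Expected loss of a (possibly randomized) estimator `est` (a probability kernel
from the `n` privatized observations to the simplex) when the true distribution is `p`,
the samples `X_1, …, X_n` are i.i.d. from `p` and each `Y_i` is obtained by applying
the mechanism `Q` independently to `X_i`. -/
noncomputable def expLoss {k l n : ℕ} (ℓ : ProbSimplex k → ProbSimplex k → ℝ)
    (Q : Fin k → Fin l → ℝ) (est : (Fin n → Fin l) → PMF (ProbSimplex k))
    (p : ProbSimplex k) : ℝ≥0∞ :=
  ∑ y : Fin n → Fin l,
    ENNReal.ofReal (∏ i, ∑ x, p.1 x * Q x (y i)) *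
      ∑' a : ProbSimplex k, est y a * ENNReal.ofReal (ℓ p a)

/-- The minimax risk `r_{ℓ,ε,k,n}(Q)`: infimum over randomized estimators of the
supremum over `p ∈ S^k` of the expected loss. -/
noncomputable def minimaxRisk (k l n : ℕ) (ℓ : ProbSimplex k → ProbSimplex k → ℝ)
    (Q : Fin k → Fin l → ℝ) : ℝ≥0∞ :=
  ⨅ est : (Fin n → Fin l) → PMF (ProbSimplex k), ⨆ p : ProbSimplex k, expLoss ℓ Q est p

/-- Warner's randomized response mechanism with parameter `ε`. -/
noncomputable def QWRR (ε : ℝ) (x y : Fin 2) : ℝ :=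
  if y = x then Real.exp ε / (Real.exp ε + 1) else 1 / (Real.exp ε + 1)

lemma aux_qwrr_stoch (ε : ℝ) : RowStochastic (QWRR ε) := by
  have he := Real.exp_pos ε
  refine ⟨fun x y => ?_, fun x => ?_⟩
  · unfold QWRR; split_ifs <;> positivity
  · fin_cases x <;> simp [QWRR, Fin.sum_univ_two] <;> field_simp <;> ring

lemma aux_qwrr_ldp (ε : ℝ) (hε : 0 ≤ ε) : LDP ε (QWRR ε) := by
  have he : 1 ≤ Real.exp ε := Real.one_le_exp hε
  intro x x' y
  unfold QWRR
  generalize Real.exp ε = e at *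
  have h1 : 0 < e + 1 := by linarith
  split_ifs
  · rw [← mul_div_assoc]; gcongr; nlinarith
  · rw [← mul_div_assoc]; gcongr; linarith
  · rw [← mul_div_assoc]; gcongr; nlinarith
  · rw [← mul_div_assoc]; gcongr; linarith

lemma aux_factor (ε : ℝ) (hε : 0 ≤ ε) {l : ℕ} (Q : Fin 2 → Fin l → ℝ)
    (hQ : RowStochastic Q) (hL : LDP ε Q) :
    ∃ W : Fin 2 → Fin l → ℝ, RowStochastic W ∧
      ∀ x y, Q x y = ∑ z, QWRR ε x z * W z y := by
  rcases hε.eq_or_lt with h0 | h0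
  · subst h0
    refine ⟨Q, hQ, fun x y => ?_⟩
    have h1 := hL 0 1 y
    have h2 := hL 1 0 y
    simp only [Real.exp_zero, one_mul] at h1 h2
    fin_cases x <;> simp [QWRR, Fin.sum_univ_two] <;> linarith
  · have he : 1 < Real.exp ε := Real.one_lt_exp_iff.mpr h0
    have hd : 0 < Real.exp ε - 1 := by linarith
    refine ⟨fun z y => (Real.exp ε * Q z y - Q (1 - z) y) / (Real.exp ε - 1),
      ⟨fun z y => ?_, fun z => ?_⟩, fun x y => ?_⟩
    · have := hL (1 - z) z y
      apply div_nonneg <;> linarith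
    · rw [← Finset.sum_div, Finset.sum_sub_distrib, ← Finset.mul_sum, hQ.2, hQ.2]
      field_simp
    · have h1 : Real.exp ε + 1 ≠ 0 := by linarith
      have h2 := hd.ne'
      fin_cases x <;> simp [QWRR, Fin.sum_univ_two] <;> field_simp <;> ring

/-- Product channel as a PMF. -/
noncomputable def auxW {l n : ℕ} (W : Fin 2 → Fin l → ℝ) (hW : RowStochastic W)
    (z : Fin n → Fin 2) : PMF (Fin n → Fin l) :=
  PMF.ofFintype (fun y => ENNReal.ofReal (∏ i, W (z i) (y i))) (by
    rw [← ENNReal.ofReal_sum_of_nonneg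
      (fun y _ => Finset.prod_nonneg fun i _ => hW.1 _ _)]
    rw [← Fintype.prod_sum (fun i y => W (z i) y)]
    simp [hW.2])

lemma aux_le (n : ℕ) (ε : ℝ) (hε : 0 ≤ ε)
    (ℓ : ProbSimplex 2 → ProbSimplex 2 → ℝ) (l : ℕ) (Q : Fin 2 → Fin l → ℝ)
    (hQ : RowStochastic Q) (hL : LDP ε Q) :
    minimaxRisk 2 2 n ℓ (QWRR ε) ≤ minimaxRisk 2 l n ℓ Q := by
  obtain ⟨W, hW, hf⟩ := aux_factor ε hε Q hQ hL
  refine le_iInf fun est => ?_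
  refine iInf_le_of_le (fun z => (auxW W hW z).bind est) ?_
  refine iSup_mono fun p => le_of_eq ?_
  have hA : ∀ z : Fin 2, 0 ≤ ∑ x, p.1 x * QWRR ε x z := fun z =>
    Finset.sum_nonneg fun x _ => mul_nonneg (p.2.1 x) ((aux_qwrr_stoch ε).1 x z)
  have key : ∀ y : Fin n → Fin l,
      ENNReal.ofReal (∏ i, ∑ x, p.1 x * Q x (y i)) =
      ∑ z : Fin n → Fin 2, ENNReal.ofReal (∏ i, ∑ x, p.1 x * QWRR ε x (z i)) *
        auxW W hW z y := by
    intro y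
    simp only [auxW, PMF.ofFintype_apply]
    have : ∀ i, ∑ x, p.1 x * Q x (y i)
        = ∑ z, (∑ x, p.1 x * QWRR ε x z) * W z (y i) := by
      intro i
      simp only [hf, Finset.mul_sum, Finset.sum_mul]
      rw [Finset.sum_comm]
      simp only [mul_assoc]
    simp only [this]
    rw [Fintype.prod_sum (fun i z => (∑ x, p.1 x * QWRR ε x z) * W z (y i))]
    rw [ENNReal.ofReal_sum_of_nonneg]
    · refine Finset.sum_congr rfl fun z _ => ?_
      rw [Finset.prod_mul_distrib, ENNReal.ofReal_mul]
      exact Finset.prod_nonneg fun i _ => hA _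
    · exact fun z _ => Finset.prod_nonneg fun i _ => mul_nonneg (hA _) (hW.1 _ _)
  unfold expLoss
  have h2 : ∀ z : Fin n → Fin 2,
      ∑' a, (auxW W hW z).bind est a * ENNReal.ofReal (ℓ p a) =
      ∑ y, auxW W hW z y * ∑' a, est y a * ENNReal.ofReal (ℓ p a) := by
    intro z
    simp only [PMF.bind_apply, ← ENNReal.tsum_mul_right]
    rw [ENNReal.tsum_comm, tsum_fintype]
    refine Finset.sum_congr rfl fun y _ => ?_
    rw [← ENNReal.tsum_mul_left]
    simp only [mul_assoc]
  simp only [h2, key, Finset.mul_sum, Finset.sum_mul]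
  rw [Finset.sum_comm]
  simp only [mul_assoc]

/-- For `k = 2`, any `ε ≥ 0`, any `n ≥ 1` and any nonnegative loss function `ℓ`,
Warner's randomized response has minimax risk at most that of any
`ε`-locally differentially private mechanism `Q` on `{1,2}` (with any finite output
alphabet); in particular `Q_WRR` attains the infimum of the minimax risk over all
`ε`-locally differentially private mechanisms on binary alphabets. -/
theorem wrr_optimal_binary (ε : ℝ) (hε : 0 ≤ ε) (n : ℕ) (hn : 1 ≤ n)
    (ℓ : ProbSimplex 2 → ProbSimplex 2 → ℝ) (hℓ : ∀ p q, 0 ≤ ℓ p q) :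
    (∀ (l : ℕ) (Q : Fin 2 → Fin l → ℝ), RowStochastic Q → LDP ε Q →
        minimaxRisk 2 2 n ℓ (QWRR ε) ≤ minimaxRisk 2 l n ℓ Q) ∧
      minimaxRisk 2 2 n ℓ (QWRR ε) =
        ⨅ (l : ℕ) (Q : Fin 2 → Fin l → ℝ) (_ : RowStochastic Q) (_ : LDP ε Q),
          minimaxRisk 2 l n ℓ Q := by
  have h := aux_le n ε hε ℓ
  refine ⟨h, le_antisymm ?_ ?_⟩
  · exact le_iInf fun l => le_iInf fun Q => le_iInf fun hQ => le_iInf fun hL => h l Q hQ hL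
  · exact iInf_le_of_le 2 (iInf_le_of_le (QWRR ε) (iInf_le_of_le (aux_qwrr_stoch ε)
      (iInf_le_of_le (aux_qwrr_ldp ε hε) le_rfl)))
end

section
/- There exist universal constants 0 < c_l ≤ c_u < 5 such that for all integers k ≥ 2, all n ≥ 1, and all ε ∈ [0,1], the optimal private minimax risk under squared ℓ2 loss satisfies c_l · min{1, 1/√(nε²), k/(nε²)} ≤ r_{ℓ2²,ε,k,n} ≤ c_u · min{1, k/(nε²)}. -/
open scoped ENNReal

/-- The optimal private minimax risk `r_{ℓ,ε,k,n}`: infimum over all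
`ε`-locally differentially private mechanisms (with any finite output alphabet). -/
noncomputable def optMinimaxRisk (k n : ℕ) (ε : ℝ)
    (ℓ : ProbSimplex k → ProbSimplex k → ℝ) : ℝ≥0∞ :=
  ⨅ (l : ℕ) (Q : Fin k → Fin l → ℝ) (_ : RowStochastic Q) (_ : LDP ε Q),
    minimaxRisk k l n ℓ Q

/-- The squared `ℓ2` loss `ℓ2²(p, p̂) = ∑ i, (p_i − p̂_i)²`. -/
noncomputable def l2sqLoss (k : ℕ) (p q : ProbSimplex k) : ℝ :=
  ∑ i, (p.1 i - q.1 i) ^ 2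


namespace Aux

lemma proj_exists {k : ℕ} (hk : 1 ≤ k) (z : Fin k → ℝ) :
    ∃ a : ProbSimplex k, ∀ p : ProbSimplex k,
      ∑ j, (p.1 j - a.1 j) ^ 2 ≤ ∑ j, (p.1 j - z j) ^ 2 := by
  have hne : (stdSimplex ℝ (Fin k)).Nonempty :=
    ⟨_, single_mem_stdSimplex ℝ (⟨0, hk⟩ : Fin k)⟩
  obtain ⟨a, ha, hmin⟩ := (isCompact_stdSimplex ℝ (Fin k)).exists_isMinOn hne
    (f := fun a : Fin k → ℝ => ∑ j, (a j - z j) ^ 2) (by fun_prop)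
  refine ⟨⟨a, ha⟩, fun p => ?_⟩
  have hin : 0 ≤ ∑ j, (p.1 j - a j) * (a j - z j) := by
    by_contra hneg
    push Not at hneg
    set I := ∑ j, (p.1 j - a j) * (a j - z j) with hI
    set D := ∑ j, (p.1 j - a j) ^ 2 with hD
    have hD0 : 0 ≤ D := Finset.sum_nonneg fun j _ => sq_nonneg _
    have key : ∀ t : ℝ, 0 ≤ t → t ≤ 1 → 0 ≤ 2 * t * I + t ^ 2 * D := by
      intro t h0 h1
      have hm : (fun j => (1 - t) * a j + t * p.1 j) ∈ stdSimplex ℝ (Fin k) := by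
        refine ⟨fun j => ?_, ?_⟩
        · have := ha.1 j
          have := p.2.1 j
          have : 0 ≤ 1 - t := by linarith
          positivity
        · rw [Finset.sum_add_distrib, ← Finset.mul_sum, ← Finset.mul_sum, ha.2, p.2.2]
          ring
      have h := hmin hm
      simp only [Set.mem_ofPred_eq] at h
      have e : ∑ j, ((1 - t) * a j + t * p.1 j - z j) ^ 2
          = ∑ j, (a j - z j) ^ 2 + (2 * t * I + t ^ 2 * D) := by
        rw [hI, hD, Finset.mul_sum, Finset.mul_sum, ← Finset.sum_add_distrib,
          ← Finset.sum_add_distrib]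
        exact Finset.sum_congr rfl fun j _ => by ring
      linarith
    have hpos : 0 < D - I := by linarith
    have h := key (-I / (D - I)) (div_nonneg (by linarith) hpos.le)
      ((div_le_one hpos).2 (by linarith))
    have e : 2 * (-I / (D - I)) * I + (-I / (D - I)) ^ 2 * D
        = (I ^ 2 / (D - I) ^ 2) * (2 * I - D) := by
      field_simp
      ring
    rw [e] at h
    have : 0 < I ^ 2 / (D - I) ^ 2 := div_pos (by nlinarith) (by positivity)
    nlinarith
  have e : ∑ j, (p.1 j - z j) ^ 2 = ∑ j, (p.1 j - a j) ^ 2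
      + 2 * ∑ j, (p.1 j - a j) * (a j - z j) + ∑ j, (a j - z j) ^ 2 := by
    rw [Finset.mul_sum, ← Finset.sum_add_distrib, ← Finset.sum_add_distrib]
    exact Finset.sum_congr rfl fun j _ => by ring
  have : 0 ≤ ∑ j, (a j - z j) ^ 2 := Finset.sum_nonneg fun j _ => sq_nonneg _
  simp only
  linarith

lemma moments {l : ℕ} (q h : Fin l → ℝ) (hq : ∑ y, q y = 1) (hh : ∑ y, q y * h y = 0)
    (n : ℕ) :
    (∑ y : Fin n → Fin l, (∏ i, q (y i)) * ∑ i, h (y i) = 0) ∧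
    (∑ y : Fin n → Fin l, (∏ i, q (y i)) * (∑ i, h (y i)) ^ 2
      = n * ∑ y, q y * h y ^ 2) := by
  have h1 : ∀ n : ℕ, ∑ y : Fin n → Fin l, (∏ i, q (y i)) = 1 := fun n => by
    rw [← Fintype.sum_pow, hq, one_pow]
  induction n with
  | zero => simp
  | succ n ih =>
    have hs : ∀ F : (Fin (n+1) → Fin l) → ℝ,
        ∑ y, F y = ∑ a : Fin l, ∑ y : Fin n → Fin l, F (Fin.cons a y) := by
      intro F
      rw [← Fintype.sum_prod_type']
      exact (Equiv.sum_comp (Fin.consEquiv (fun _ => Fin l)) F).symm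
    constructor
    · rw [hs]
      simp only [Fin.prod_univ_succ, Fin.sum_univ_succ, Fin.cons_zero, Fin.cons_succ]
      calc _ = ∑ a, (q a * h a * (∑ y : Fin n → Fin l, (∏ i, q (y i)))
              + q a * ∑ y : Fin n → Fin l, (∏ i, q (y i)) * ∑ i, h (y i)) := by
            refine Finset.sum_congr rfl fun a _ => ?_
            rw [Finset.mul_sum, Finset.mul_sum, ← Finset.sum_add_distrib]
            exact Finset.sum_congr rfl fun y _ => by ring
        _ = 0 := by rw [h1, ih.1]; simpa using hh
    · rw [hs]
      simp only [Fin.prod_univ_succ, Fin.sum_univ_succ, Fin.cons_zero, Fin.cons_succ]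
      calc _ = ∑ a, (q a * h a ^ 2 * (∑ y : Fin n → Fin l, (∏ i, q (y i)))
              + 2 * (q a * h a) * (∑ y : Fin n → Fin l, (∏ i, q (y i)) * ∑ i, h (y i))
              + q a * ∑ y : Fin n → Fin l, (∏ i, q (y i)) * (∑ i, h (y i)) ^ 2) := by
            refine Finset.sum_congr rfl fun a _ => ?_
            rw [Finset.mul_sum, Finset.mul_sum, Finset.mul_sum, ← Finset.sum_add_distrib,
              ← Finset.sum_add_distrib]
            exact Finset.sum_congr rfl fun y _ => by ring
        _ = _ := by
          rw [h1, ih.1, ih.2]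
          simp only [mul_one, mul_zero, add_zero]
          rw [Finset.sum_add_distrib, ← Finset.sum_mul, hq]
          push_cast
          ring

lemma upper_gen {k l n : ℕ} (hk : 1 ≤ k) (hn : 1 ≤ n) (Q : Fin k → Fin l → ℝ)
    (hQ : RowStochastic Q) (g : Fin l → Fin k → ℝ)
    (hunb : ∀ x j, ∑ y, Q x y * g y j = if x = j then 1 else 0) (V : ℝ)
    (hV : ∀ y, ∑ j, g y j ^ 2 ≤ V) :
    minimaxRisk k l n (l2sqLoss k) Q ≤ ENNReal.ofReal (V / n) := by
  choose A hA using proj_exists (k := k) hk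
  have hn' : (0:ℝ) < n := by exact_mod_cast hn
  refine iInf_le_of_le
    (fun y => PMF.pure (A (fun j => (1 / (n:ℝ)) * ∑ i, g (y i) j))) ?_
  refine iSup_le fun p => ?_
  set q : Fin l → ℝ := fun y => ∑ x, p.1 x * Q x y with hqdef
  have hq0 : ∀ y, 0 ≤ q y := fun y =>
    Finset.sum_nonneg fun x _ => mul_nonneg (p.2.1 x) (hQ.1 x y)
  have hq1 : ∑ y, q y = 1 := by
    simp only [hqdef]
    rw [Finset.sum_comm]
    simp only [← Finset.mul_sum, hQ.2, mul_one, p.2.2]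
  have hmean : ∀ j, ∑ y, q y * g y j = p.1 j := by
    intro j
    simp only [hqdef, Finset.sum_mul]
    rw [Finset.sum_comm]
    simp only [mul_assoc, ← Finset.mul_sum, hunb]
    simp
  have hP : ∀ y : Fin n → Fin l, 0 ≤ ∏ i, q (y i) := fun y =>
    Finset.prod_nonneg fun i _ => hq0 _
  have e1 : ∀ y : Fin n → Fin l, ∑' a : ProbSimplex k,
      (PMF.pure (A (fun j => (1 / (n:ℝ)) * ∑ i, g (y i) j))) a
        * ENNReal.ofReal (l2sqLoss k p a)
      = ENNReal.ofReal (l2sqLoss k p (A (fun j => (1 / (n:ℝ)) * ∑ i, g (y i) j))) := by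
    intro y
    rw [tsum_eq_single (A (fun j => (1 / (n:ℝ)) * ∑ i, g (y i) j))]
    · simp
    · intro b hb
      rw [PMF.pure_apply, if_neg hb, zero_mul]
  unfold expLoss
  simp only [e1]
  calc _ = ENNReal.ofReal (∑ y : Fin n → Fin l, (∏ i, q (y i)) *
        l2sqLoss k p (A (fun j => (1 / (n:ℝ)) * ∑ i, g (y i) j))) := by
        rw [ENNReal.ofReal_sum_of_nonneg]
        · exact Finset.sum_congr rfl fun y _ => (ENNReal.ofReal_mul (hP y)).symm
        · exact fun y _ => mul_nonneg (hP y) (Finset.sum_nonneg fun j _ => sq_nonneg _)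
    _ ≤ _ := by
      apply ENNReal.ofReal_le_ofReal
      have hvar : ∀ j, ∑ y : Fin n → Fin l, (∏ i, q (y i)) *
          (p.1 j - (1 / (n:ℝ)) * ∑ i, g (y i) j) ^ 2 ≤ (1 / n) * ∑ y, q y * g y j ^ 2 := by
        intro j
        have hm := (moments q (fun y => g y j - p.1 j) hq1 (by
          simp only [mul_sub, Finset.sum_sub_distrib, ← Finset.sum_mul, hmean, hq1]
          ring) n).2
        have e : ∑ y, q y * (g y j - p.1 j) ^ 2 = ∑ y, q y * g y j ^ 2 - p.1 j ^ 2 := by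
          have : ∀ y, q y * (g y j - p.1 j) ^ 2
            = q y * g y j ^ 2 - 2 * p.1 j * (q y * g y j) + q y * p.1 j ^ 2 := fun y => by ring
          simp only [this, Finset.sum_sub_distrib, Finset.sum_add_distrib, ← Finset.mul_sum,
            ← Finset.sum_mul, hmean, hq1]
          ring
        have e2 : ∑ y : Fin n → Fin l, (∏ i, q (y i)) *
          (p.1 j - (1 / (n:ℝ)) * ∑ i, g (y i) j) ^ 2 = (1 / n) ^ 2 *
          ∑ y : Fin n → Fin l, (∏ i, q (y i)) * (∑ i, (g (y i) j - p.1 j)) ^ 2 := by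
          rw [Finset.mul_sum]
          refine Finset.sum_congr rfl fun y _ => ?_
          rw [Finset.sum_sub_distrib]
          simp only [Finset.sum_const, Finset.card_univ, Fintype.card_fin, nsmul_eq_mul]
          field_simp
          ring
        rw [e2, hm, e]
        have : (1 / (n:ℝ)) ^ 2 * (n * (∑ y, q y * g y j ^ 2 - p.1 j ^ 2))
          = (1 / n) * (∑ y, q y * g y j ^ 2 - p.1 j ^ 2) := by field_simp
        rw [this]
        have : 0 ≤ 1 / (n:ℝ) := by positivity
        exact mul_le_mul_of_nonneg_left (by nlinarith [sq_nonneg (p.1 j)]) this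
      calc _ ≤ ∑ y : Fin n → Fin l, (∏ i, q (y i)) *
            ∑ j, (p.1 j - (1 / (n:ℝ)) * ∑ i, g (y i) j) ^ 2 :=
            Finset.sum_le_sum fun y _ => mul_le_mul_of_nonneg_left (hA _ p) (hP y)
        _ = ∑ j, ∑ y : Fin n → Fin l, (∏ i, q (y i)) *
            (p.1 j - (1 / (n:ℝ)) * ∑ i, g (y i) j) ^ 2 := by
            simp only [Finset.mul_sum]; rw [Finset.sum_comm]
        _ ≤ ∑ j, (1 / n) * ∑ y, q y * g y j ^ 2 := Finset.sum_le_sum fun j _ => hvar j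
        _ = (1 / n) * ∑ y, q y * ∑ j, g y j ^ 2 := by
            rw [← Finset.mul_sum, Finset.sum_comm]; simp only [Finset.mul_sum]
        _ ≤ (1 / n) * ∑ y, q y * V := by
            gcongr with y
            · exact hq0 y
            · exact hV y
        _ = V / n := by rw [← Finset.sum_mul, hq1]; ring

def sg (b : Bool) : ℝ := if b then 1 else -1

lemma sg_sq (b : Bool) : sg b ^ 2 = 1 := by cases b <;> simp [sg]
lemma sg_not (b : Bool) : sg (!b) = - sg b := by cases b <;> simp [sg]

def flip {d : ℕ} (j : Fin d) (v : Fin d → Bool) : Fin d → Bool := Function.update v j (!v j)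

lemma flip_inv {d : ℕ} (j : Fin d) : Function.Involutive (flip j) := by
  intro v
  simp [flip]

lemma sum_flip {d : ℕ} (j : Fin d) (F : (Fin d → Bool) → ℝ) :
    ∑ v, F (flip j v) = ∑ v, F v :=
  Equiv.sum_comp (flip_inv j).toPerm F

lemma sum_sg {d : ℕ} (j : Fin d) : ∑ v : Fin d → Bool, sg (v j) = 0 := by
  have := sum_flip j (fun v => sg (v j))
  simp only [flip, Function.update_self, sg_not, Finset.sum_neg_distrib] at this
  linarith

lemma sum_sg2 {d : ℕ} (x j : Fin d) (h : x ≠ j) :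
    ∑ v : Fin d → Bool, sg (v x) * sg (v j) = 0 := by
  have := sum_flip j (fun v => sg (v x) * sg (v j))
  simp only [flip, Function.update_self, sg_not, Function.update_of_ne h, mul_neg,
    Finset.sum_neg_distrib] at this
  linarith

lemma exp_ineq {ε : ℝ} (h0 : 0 ≤ ε) (h1 : ε ≤ 1) :
    1 + 0.45 * ε ≤ Real.exp ε * (1 - 0.45 * ε) := by
  have h := Real.sum_le_exp_of_nonneg h0 4
  simp [Finset.sum_range_succ, Nat.factorial] at h
  have : 0 ≤ 1 - 0.45 * ε := by norm_num; linarith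
  calc 1 + 0.45 * ε ≤ (1 + ε + ε ^ 2 / 2 + ε ^ 3 / 6) * (1 - 0.45 * ε) := by
        have h2 : ε ^ 2 ≤ ε := by nlinarith
        have h3 : ε ^ 3 ≤ ε := by nlinarith
        have h4 : ε ^ 4 ≤ ε ^ 2:= by nlinarith [sq_nonneg ε]
        nlinarith
    _ ≤ _ := mul_le_mul_of_nonneg_right (by linarith) this

lemma upper {k n : ℕ} {ε : ℝ} (hk : 1 ≤ k) (hn : 1 ≤ n) (h0 : 0 < ε) (h1 : ε ≤ 1) :
    optMinimaxRisk k n ε (l2sqLoss k) ≤ ENNReal.ofReal (4.95 * (k / (n * ε ^ 2))) := by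
  set δ := 0.45 * ε with hδ
  have hδ0 : 0 < δ := by positivity
  have hδ1 : δ < 1 := by rw [hδ]; norm_num; linarith
  let e := Fintype.equivFin (Fin k → Bool)
  let Q : Fin k → Fin (Fintype.card (Fin k → Bool)) → ℝ :=
    fun x y => (1 / 2 ^ k) * (1 + δ * sg (e.symm y x))
  have hsum : ∀ F : (Fin k → Bool) → ℝ, ∑ y, F (e.symm y) = ∑ v, F v :=
    fun F => Equiv.sum_comp e.symm F
  have hsg : ∀ b, 1 - δ ≤ 1 + δ * sg b ∧ 1 + δ * sg b ≤ 1 + δ := by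
    intro b; cases b <;> simp only [sg] <;> constructor <;> norm_num <;> linarith
  have hQ : RowStochastic Q := by
    refine ⟨fun x y => ?_, fun x => ?_⟩
    · have := (hsg (e.symm y x)).1
      exact mul_nonneg (by positivity) (by linarith)
    · rw [hsum (fun v => (1 / 2 ^ k) * (1 + δ * sg (v x))), ← Finset.mul_sum,
        Finset.sum_add_distrib, ← Finset.mul_sum, sum_sg]
      simp
  have hL : LDP ε Q := by
    intro x x' y
    have a := hsg (e.symm y x)
    have b := hsg (e.symm y x')
    have c := exp_ineq h0.le h1
    rw [← hδ] at c
    have := mul_le_mul_of_nonneg_left b.1 (Real.exp_pos ε).le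
    calc Q x y ≤ (1 / 2 ^ k) * (Real.exp ε * (1 + δ * sg (e.symm y x'))) :=
          mul_le_mul_of_nonneg_left (by linarith) (by positivity)
      _ = _ := by simp only [Q]; ring
  refine iInf_le_of_le _ (iInf_le_of_le Q (iInf_le_of_le hQ (iInf_le_of_le hL ?_)))
  refine (upper_gen hk hn Q hQ (fun y j => sg (e.symm y j) / δ) ?_ (k / δ ^ 2) ?_).trans ?_
  · intro x j
    rw [hsum (fun v => (1 / 2 ^ k) * (1 + δ * sg (v x)) * (sg (v j) / δ))]
    have : ∀ v : Fin k → Bool, (1 / 2 ^ k) * (1 + δ * sg (v x)) * (sg (v j) / δ)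
      = (1 / 2 ^ k / δ) * sg (v j) + (1 / 2 ^ k) * (sg (v x) * sg (v j)) := by
      intro v; field_simp
    simp only [this, Finset.sum_add_distrib, ← Finset.mul_sum, sum_sg]
    split_ifs with h
    · subst h
      simp [← pow_two, sg_sq]
    · rw [sum_sg2 x j h]; simp
  · intro y
    simp only [div_pow, sg_sq]
    simp [div_eq_mul_inv]
  · apply ENNReal.ofReal_le_ofReal
    have hn' : (0:ℝ) < n := by exact_mod_cast hn
    have : (k:ℝ) / δ ^ 2 / n = (1 / 0.2025) * (k / (n * ε ^ 2)) := by
      rw [hδ]; field_simp; norm_num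
    rw [this]
    have : 0 ≤ (k:ℝ) / (n * ε ^ 2) := by positivity
    exact mul_le_mul_of_nonneg_right (by norm_num) this

lemma upper_one {k n : ℕ} {ε : ℝ} (hk : 1 ≤ k) (h0 : 0 ≤ ε) :
    optMinimaxRisk k n ε (l2sqLoss k) ≤ ENNReal.ofReal 4.95 := by
  let Q : Fin k → Fin 1 → ℝ := fun _ _ => 1
  have hQ : RowStochastic Q := ⟨fun _ _ => zero_le_one, fun _ => by simp [Q]⟩
  have hL : LDP ε Q := fun _ _ _ => by simp [Q, h0]
  refine iInf_le_of_le _ (iInf_le_of_le Q (iInf_le_of_le hQ (iInf_le_of_le hL ?_)))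
  let a : ProbSimplex k := ⟨_, single_mem_stdSimplex ℝ (⟨0, hk⟩ : Fin k)⟩
  refine iInf_le_of_le (fun _ => PMF.pure a) (iSup_le fun p => ?_)
  have e1 : ∑' b : ProbSimplex k, (PMF.pure a) b * ENNReal.ofReal (l2sqLoss k p b)
      = ENNReal.ofReal (l2sqLoss k p a) := by
    rw [tsum_eq_single a]
    · simp
    · intro b hb
      rw [PMF.pure_apply, if_neg hb, zero_mul]
  unfold expLoss
  simp only [e1]
  have : ∑ x, p.1 x = 1 := p.2.2
  simp [Q, this]
  apply ENNReal.ofReal_le_ofReal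
  have hsq : ∀ p : ProbSimplex k, ∑ j, p.1 j ^ 2 ≤ 1 := by
    intro p
    refine (Finset.sum_le_sum (g := p.1) fun j _ => ?_).trans_eq p.2.2
    have h1 : p.1 j ≤ 1 := by
      exact (Finset.single_le_sum (f := p.1) (fun i _ => p.2.1 i) (Finset.mem_univ j)).trans_eq
        p.2.2
    nlinarith [p.2.1 j]
  calc l2sqLoss k p a ≤ ∑ j, (p.1 j ^ 2 + a.1 j ^ 2) :=
        Finset.sum_le_sum fun j _ => by nlinarith [mul_nonneg (p.2.1 j) (a.2.1 j)]
    _ ≤ 1 + 1 := by rw [Finset.sum_add_distrib]; exact add_le_add (hsq p) (hsq a)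
    _ ≤ _ := by norm_num

end Aux

namespace Aux

noncomputable def pf {d k : ℕ} (γ : ℝ) (a b : Fin d → Fin k) (v : Fin d → Bool) : Fin k → ℝ :=
  fun x => ∑ j, ((1 + γ * sg (v j)) / (2 * d) * (if x = a j then 1 else 0)
    + (1 - γ * sg (v j)) / (2 * d) * (if x = b j then 1 else 0))

lemma pf_sum {d k : ℕ} (γ : ℝ) (a b : Fin d → Fin k) (v : Fin d → Bool) (F : Fin k → ℝ) :
    ∑ x, pf γ a b v x * F x = ∑ j, ((1 + γ * sg (v j)) / (2 * d) * F (a j)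
      + (1 - γ * sg (v j)) / (2 * d) * F (b j)) := by
  simp only [pf, Finset.sum_mul]
  rw [Finset.sum_comm]
  refine Finset.sum_congr rfl fun j _ => ?_
  simp only [add_mul, Finset.sum_add_distrib, mul_assoc, ← Finset.mul_sum]
  simp

lemma pf_mem {d k : ℕ} {γ : ℝ} (hd : 1 ≤ d) (h0 : 0 ≤ γ) (h1 : γ ≤ 1)
    (a b : Fin d → Fin k) (v : Fin d → Bool) :
    (∀ i, 0 ≤ pf γ a b v i) ∧ ∑ i, pf γ a b v i = 1 := by
  constructor
  · intro i
    refine Finset.sum_nonneg fun j _ => ?_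
    have h : 0 ≤ 1 + γ * sg (v j) ∧ 0 ≤ 1 - γ * sg (v j) := by
      cases v j <;> simp only [sg] <;> constructor <;> norm_num <;> linarith
    have := h.1
    have := h.2
    split_ifs <;> positivity
  · have := pf_sum γ a b v (fun _ => 1)
    simp only [mul_one] at this
    rw [this]
    have hd' : (d:ℝ) ≠ 0 := by positivity
    have : ∀ j, (1 + γ * sg (v j)) / (2 * d) + (1 - γ * sg (v j)) / (2 * d) = 1 / d := by
      intro j; field_simp; ring
    simp [this, hd']

lemma pf_a {d k : ℕ} {γ : ℝ} (a b : Fin d → Fin k) (ha : Function.Injective a)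
    (hab : ∀ i j, a i ≠ b j) (v : Fin d → Bool) (j : Fin d) :
    pf γ a b v (a j) = (1 + γ * sg (v j)) / (2 * d) := by
  simp [pf, hab, ha.eq_iff]

lemma pf_flip {d k : ℕ} (hd : 1 ≤ d) (γ : ℝ) (a b : Fin d → Fin k) (v : Fin d → Bool)
    (j : Fin d) (F : Fin k → ℝ) :
    ∑ x, pf γ a b (flip j v) x * F x - ∑ x, pf γ a b v x * F x
      = - (γ / d * sg (v j)) * (F (a j) - F (b j)) := by
  have hd' : (d:ℝ) ≠ 0 := by positivity
  rw [pf_sum, pf_sum, ← Finset.sum_sub_distrib, Finset.sum_eq_single j]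
  · simp only [flip, Function.update_self, sg_not]
    field_simp
    ring
  · intro i _ hi
    simp [flip, Function.update_of_ne hi]
  · simp

lemma exp_diff {ε : ℝ} (h0 : 0 ≤ ε) (h1 : ε ≤ 1) : Real.exp ε - Real.exp (-ε) ≤ 3 * ε := by
  have a := Real.abs_exp_sub_one_sub_id_le (x := ε) (by rw [abs_of_nonneg h0]; exact h1)
  have a := (abs_le.1 a).2
  have b := Real.add_one_le_exp (-ε)
  nlinarith

/-- one-coordinate affinity bound -/
lemma bc_one {l : ℕ} (m m' : Fin l → ℝ) (hm : ∀ y, 0 ≤ m y) (hm' : ∀ y, 0 ≤ m' y)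
    (s : ∑ y, m y = 1) (s' : ∑ y, m' y = 1) (τ : ℝ)
    (h : ∀ y, |m' y - m y| ≤ τ * m y) :
    1 - τ ^ 2 / 2 ≤ ∑ y, √(m y) * √(m' y) := by
  have key : ∀ y, (m y + m' y) / 2 - τ ^ 2 / 2 * m y ≤ √(m y) * √(m' y) := by
    intro y
    obtain ⟨u, hu⟩ : ∃ u, u = √(m y) := ⟨_, rfl⟩
    obtain ⟨w, hw⟩ : ∃ w, w = √(m' y) := ⟨_, rfl⟩
    have hu0 : 0 ≤ u := hu ▸ Real.sqrt_nonneg _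
    have hw0 : 0 ≤ w := hw ▸ Real.sqrt_nonneg _
    have e1 : m y = u ^ 2 := by rw [hu, Real.sq_sqrt (hm y)]
    have e2 : m' y = w ^ 2 := by rw [hw, Real.sq_sqrt (hm' y)]
    have hy := h y
    rw [← hu, ← hw]
    rw [e1, e2] at hy ⊢
    rcases hu0.eq_or_lt with h0 | h0
    · rw [← h0] at hy ⊢
      have := (abs_le.1 hy).2
      nlinarith
    · have hsq : (w ^ 2 - u ^ 2) ^ 2 ≤ (τ * u ^ 2) ^ 2 := by
        rw [← sq_abs]; exact pow_le_pow_left₀ (abs_nonneg _) hy 2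
      have h3 : (w - u) ^ 2 * u ^ 2 ≤ (τ ^ 2 * u ^ 2) * u ^ 2 := by
        have : (w - u) ^ 2 * u ^ 2 ≤ (w - u) ^ 2 * (w + u) ^ 2 :=
          mul_le_mul_of_nonneg_left (by nlinarith) (sq_nonneg _)
        nlinarith
      have h4 := le_of_mul_le_mul_right h3 (by positivity)
      nlinarith
  calc 1 - τ ^ 2 / 2 = ∑ y, ((m y + m' y) / 2 - τ ^ 2 / 2 * m y) := by
        rw [Finset.sum_sub_distrib, ← Finset.mul_sum, ← Finset.sum_div, Finset.sum_add_distrib,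
          s, s']; ring
    _ ≤ _ := Finset.sum_le_sum fun y _ => key y

lemma min_sum {l n : ℕ} (m m' : Fin l → ℝ) (hm : ∀ y, 0 ≤ m y) (hm' : ∀ y, 0 ≤ m' y)
    (s : ∑ y, m y = 1) (s' : ∑ y, m' y = 1) (τ : ℝ)
    (h : ∀ y, |m' y - m y| ≤ τ * m y) (hτ : n * τ ^ 2 ≤ 1 / 2) (hτ1 : τ ^ 2 ≤ 1) :
    1 / 4 ≤ ∑ y : Fin n → Fin l, min (∏ i, m (y i)) (∏ i, m' (y i)) := by
  have hb := bc_one m m' hm hm' s s' τ h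
  have hpt : ∀ y : Fin n → Fin l, (∏ i, √(m (y i)) * √(m' (y i)))
      - ((∏ i, m (y i)) + ∏ i, m' (y i)) / 4 ≤ min (∏ i, m (y i)) (∏ i, m' (y i)) := by
    intro y
    have e1 : ∏ i, m (y i) = (∏ i, √(m (y i))) ^ 2 := by
      rw [← Finset.prod_pow]
      exact Finset.prod_congr rfl fun i _ => (Real.sq_sqrt (hm _)).symm
    have e2 : ∏ i, m' (y i) = (∏ i, √(m' (y i))) ^ 2 := by
      rw [← Finset.prod_pow]
      exact Finset.prod_congr rfl fun i _ => (Real.sq_sqrt (hm' _)).symm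
    rw [Finset.prod_mul_distrib, e1, e2]
    generalize (∏ i, √(m (y i))) = F
    generalize (∏ i, √(m' (y i))) = G
    refine le_min ?_ ?_
    · nlinarith [sq_nonneg (G / 2 - F), sq_nonneg F]
    · nlinarith [sq_nonneg (F / 2 - G), sq_nonneg G]
  have hsum := Finset.sum_le_sum fun y (_ : y ∈ Finset.univ) => hpt y
  rw [Finset.sum_sub_distrib, ← Finset.sum_div, Finset.sum_add_distrib,
    ← Fintype.sum_pow (fun z => √(m z) * √(m' z)), ← Fintype.sum_pow m, ← Fintype.sum_pow m',
    s, s', one_pow] at hsum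
  have hbern := one_add_mul_le_pow (a := - (τ ^ 2 / 2)) (by linarith) n
  have hp : (1 + -(τ ^ 2 / 2)) ^ n ≤ (∑ z, √(m z) * √(m' z)) ^ n :=
    pow_le_pow_left₀ (by linarith) (by linarith) n
  linarith

lemma lower_core {k l n d : ℕ} {ε γ : ℝ} (hn : 1 ≤ n) (hd : 1 ≤ d) (hdk : 2 * d ≤ k)
    (h0 : 0 ≤ ε) (h1 : ε ≤ 1) (g0 : 0 ≤ γ) (g1 : γ ≤ 1)
    (hg : 18 * (n * ε ^ 2) * γ ^ 2 ≤ d ^ 2)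
    (Q : Fin k → Fin l → ℝ) (hQ : RowStochastic Q) (hL : LDP ε Q)
    (est : (Fin n → Fin l) → PMF (ProbSimplex k)) :
    ENNReal.ofReal (γ ^ 2 / (16 * d)) ≤ ⨆ p, expLoss (l2sqLoss k) Q est p := by
  have hd' : (0:ℝ) < d := by exact_mod_cast hd
  have hn' : (1:ℝ) ≤ n := by exact_mod_cast hn
  let a : Fin d → Fin k := fun j => ⟨j, by omega⟩
  let b : Fin d → Fin k := fun j => ⟨d + j, by omega⟩
  have ha : Function.Injective a := fun i j h => by
    simp only [a, Fin.mk.injEq] at h; exact Fin.ext h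
  have hab : ∀ i j, a i ≠ b j := fun i j h => by
    simp only [a, b, Fin.mk.injEq] at h; omega
  let p : (Fin d → Bool) → ProbSimplex k := fun v => ⟨pf γ a b v, pf_mem hd g0 g1 a b v⟩
  let m : (Fin d → Bool) → Fin l → ℝ := fun v y => ∑ x, (p v).1 x * Q x y
  have hm0 : ∀ v y, 0 ≤ m v y := fun v y =>
    Finset.sum_nonneg fun x _ => mul_nonneg ((p v).2.1 x) (hQ.1 x y)
  have hm1 : ∀ v, ∑ y, m v y = 1 := by
    intro v
    simp only [m]
    rw [Finset.sum_comm]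
    simp only [← Finset.mul_sum, hQ.2, mul_one, (p v).2.2]
  have hup : ∀ v y x, Q x y ≤ Real.exp ε * m v y := by
    intro v y x
    calc Q x y = ∑ x', (p v).1 x' * Q x y := by rw [← Finset.sum_mul, (p v).2.2, one_mul]
      _ ≤ ∑ x', (p v).1 x' * (Real.exp ε * Q x' y) :=
        Finset.sum_le_sum fun x' _ => mul_le_mul_of_nonneg_left (hL x x' y) ((p v).2.1 x')
      _ = _ := by
        simp only [m, Finset.mul_sum]
        exact Finset.sum_congr rfl fun _ _ => by ring
  have hlo : ∀ v y x, Real.exp (-ε) * m v y ≤ Q x y := by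
    intro v y x
    have : m v y ≤ Real.exp ε * Q x y := by
      calc m v y ≤ ∑ x', (p v).1 x' * (Real.exp ε * Q x y) :=
            Finset.sum_le_sum fun x' _ => mul_le_mul_of_nonneg_left (hL x' x y) ((p v).2.1 x')
        _ = _ := by rw [← Finset.sum_mul, (p v).2.2, one_mul]
    calc _ ≤ Real.exp (-ε) * (Real.exp ε * Q x y) :=
          mul_le_mul_of_nonneg_left this (Real.exp_pos _).le
      _ = Q x y := by rw [← mul_assoc, ← Real.exp_add]; simp
  set τ := γ / d * (3 * ε) with hτ
  have hnτ : n * τ ^ 2 ≤ 1 / 2 := by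
    have : n * τ ^ 2 = (18 * (n * ε ^ 2) * γ ^ 2) / d ^ 2 / 2 := by
      rw [hτ]; field_simp; ring
    rw [this]
    have : (18 * (n * ε ^ 2) * γ ^ 2) / d ^ 2 ≤ 1 := (div_le_one (by positivity)).2 hg
    linarith
  have hτ1 : τ ^ 2 ≤ 1 := by nlinarith [sq_nonneg τ]
  have hdiff : ∀ v j y, |m (flip j v) y - m v y| ≤ τ * m v y := by
    intro v j y
    have e := pf_flip hd γ a b v j (fun x => Q x y)
    have : m (flip j v) y - m v y = - (γ / d * sg (v j)) * (Q (a j) y - Q (b j) y) := e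
    rw [this, abs_mul, abs_neg, abs_mul, abs_of_nonneg (by positivity : 0 ≤ γ / (d:ℝ))]
    have hs : |sg (v j)| = 1 := by cases v j <;> simp [sg]
    rw [hs, mul_one, hτ, mul_assoc]
    refine mul_le_mul_of_nonneg_left ?_ (by positivity)
    have := exp_diff h0 h1
    have h5 := mul_le_mul_of_nonneg_right this (hm0 v y)
    rw [abs_le]
    constructor <;> linarith [hup v y (a j), hup v y (b j), hlo v y (a j), hlo v y (b j)]
  let P : (Fin d → Bool) → (Fin n → Fin l) → ℝ := fun v y => ∏ i, m v (y i)
  have hP0 : ∀ v y, 0 ≤ P v y := fun v y => Finset.prod_nonneg fun i _ => hm0 _ _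
  have hmin : ∀ v j, 1 / 4 ≤ ∑ y, min (P v y) (P (flip j v) y) := fun v j =>
    min_sum (m v) (m (flip j v)) (hm0 _) (hm0 _) (hm1 _) (hm1 _) τ (hdiff v j) hnτ hτ1
  let C : (Fin n → Fin l) → ℝ := fun y =>
    ∑ j, ∑ v, (γ / d) ^ 2 / 4 * min (P v y) (P (flip j v) y)
  have hC : ∀ y (u : ProbSimplex k), C y ≤ ∑ v, P v y * l2sqLoss k (p v) u := by
    intro y u
    have s1 : ∀ v, ∑ j, ((p v).1 (a j) - u.1 (a j)) ^ 2 ≤ l2sqLoss k (p v) u := by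
      intro v
      unfold l2sqLoss
      refine (Finset.sum_map Finset.univ ⟨a, ha⟩ (fun x => ((p v).1 x - u.1 x) ^ 2)).symm.trans_le ?_
      exact Finset.sum_le_sum_of_subset_of_nonneg (Finset.subset_univ _)
        fun _ _ _ => sq_nonneg _
    calc C y ≤ ∑ j, ∑ v, P v y * ((p v).1 (a j) - u.1 (a j)) ^ 2 := by
          refine Finset.sum_le_sum fun j _ => ?_
          have e : ∑ v, P v y * ((p v).1 (a j) - u.1 (a j)) ^ 2 =
            ∑ v, (P v y * ((p v).1 (a j) - u.1 (a j)) ^ 2 +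
              P (flip j v) y * ((p (flip j v)).1 (a j) - u.1 (a j)) ^ 2) / 2 := by
            rw [← Finset.sum_div, Finset.sum_add_distrib,
              sum_flip j (fun v => P v y * ((p v).1 (a j) - u.1 (a j)) ^ 2)]
            ring
          rw [e]
          refine Finset.sum_le_sum fun v _ => ?_
          have q1 : (p v).1 (a j) = (1 + γ * sg (v j)) / (2 * d) := pf_a a b ha hab v j
          have q2 : (p (flip j v)).1 (a j) = (1 - γ * sg (v j)) / (2 * d) := by
            have : (p (flip j v)).1 (a j) = (1 + γ * sg (flip j v j)) / (2 * d) :=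
              pf_a a b ha hab (flip j v) j
            rw [this]; simp only [flip, Function.update_self, sg_not]; ring
          have q3 : ((p v).1 (a j) - (p (flip j v)).1 (a j)) ^ 2 = (γ / d) ^ 2 := by
            have : (p v).1 (a j) - (p (flip j v)).1 (a j) = (γ / d) * sg (v j) := by
              rw [q1, q2]; field_simp; ring
            rw [this, mul_pow, sg_sq, mul_one]
          rw [← q3]
          generalize (p v).1 (a j) = s
          generalize (p (flip j v)).1 (a j) = t
          generalize u.1 (a j) = w
          have m1 := min_le_left (P v y) (P (flip j v) y)
          have m2 := min_le_right (P v y) (P (flip j v) y)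
          have m0 : 0 ≤ min (P v y) (P (flip j v) y) := le_min (hP0 _ _) (hP0 _ _)
          revert m1 m2 m0
          generalize min (P v y) (P (flip j v) y) = M
          intro m1 m2 m0
          have r1 := mul_le_mul_of_nonneg_right m1 (sq_nonneg (s - w))
          have r2 := mul_le_mul_of_nonneg_right m2 (sq_nonneg (t - w))
          have r3 := mul_nonneg m0 (sq_nonneg ((s - w) + (t - w)))
          nlinarith
      _ = ∑ v, P v y * ∑ j, ((p v).1 (a j) - u.1 (a j)) ^ 2 := by
          rw [Finset.sum_comm]; simp only [Finset.mul_sum]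
      _ ≤ _ := Finset.sum_le_sum fun v _ => mul_le_mul_of_nonneg_left (s1 v) (hP0 v y)
  have hCsum : 2 ^ d * (γ ^ 2 / (16 * d)) ≤ ∑ y, C y := by
    calc (2:ℝ) ^ d * (γ ^ 2 / (16 * d))
        = ∑ j : Fin d, ∑ v : Fin d → Bool, (γ / d) ^ 2 / 4 * (1 / 4) := by
          simp; field_simp; norm_num
      _ ≤ ∑ j : Fin d, ∑ v : Fin d → Bool, (γ / d) ^ 2 / 4 *
            ∑ y, min (P v y) (P (flip j v) y) := by
          refine Finset.sum_le_sum fun j _ => Finset.sum_le_sum fun v _ => ?_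
          exact mul_le_mul_of_nonneg_left (hmin v j) (by positivity)
      _ = ∑ y, C y := by
          simp only [C]
          rw [Finset.sum_comm (s := (Finset.univ : Finset (Fin n → Fin l)))]
          refine Finset.sum_congr rfl fun j _ => ?_
          rw [Finset.sum_comm]
          simp only [Finset.mul_sum]
  have hC0 : ∀ y, 0 ≤ C y := fun y => Finset.sum_nonneg fun j _ => Finset.sum_nonneg fun v _ =>
    mul_nonneg (by positivity) (le_min (hP0 _ _) (hP0 _ _))
  have hl0 : ∀ p u, 0 ≤ l2sqLoss k p u := fun p u => Finset.sum_nonneg fun _ _ => sq_nonneg _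
  have hbig : ENNReal.ofReal (2 ^ d * (γ ^ 2 / (16 * d))) ≤
      ∑ v, expLoss (l2sqLoss k) Q est (p v) := by
    calc _ ≤ ENNReal.ofReal (∑ y, C y) := ENNReal.ofReal_le_ofReal hCsum
      _ = ∑ y, ENNReal.ofReal (C y) := ENNReal.ofReal_sum_of_nonneg fun y _ => hC0 y
      _ ≤ ∑ y, ∑ v, ENNReal.ofReal (P v y) *
            ∑' u, est y u * ENNReal.ofReal (l2sqLoss k (p v) u) := by
          refine Finset.sum_le_sum fun y _ => ?_
          calc ENNReal.ofReal (C y) = ∑' u, est y u * ENNReal.ofReal (C y) := by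
                rw [ENNReal.tsum_mul_right, (est y).tsum_coe, one_mul]
            _ ≤ ∑' u, est y u * ∑ v, ENNReal.ofReal (P v y) *
                  ENNReal.ofReal (l2sqLoss k (p v) u) := by
                refine ENNReal.tsum_le_tsum fun u => mul_le_mul_right ?_ _
                refine (ENNReal.ofReal_le_ofReal (hC y u)).trans ?_
                rw [ENNReal.ofReal_sum_of_nonneg fun v _ => mul_nonneg (hP0 v y) (hl0 _ _)]
                exact Finset.sum_le_sum fun v _ => (ENNReal.ofReal_mul (hP0 v y)).le
            _ = _ := by
                simp only [Finset.mul_sum]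
                rw [Summable.tsum_finsetSum fun _ _ => ENNReal.summable]
                refine Finset.sum_congr rfl fun v _ => ?_
                rw [← ENNReal.tsum_mul_left]
                exact tsum_congr fun u => by ring
      _ = _ := by rw [Finset.sum_comm]; rfl
  have hle : ∑ v, expLoss (l2sqLoss k) Q est (p v) ≤
      2 ^ d * ⨆ p, expLoss (l2sqLoss k) Q est p := by
    calc _ ≤ ∑ v : Fin d → Bool, ⨆ p, expLoss (l2sqLoss k) Q est p :=
          Finset.sum_le_sum fun v _ => le_iSup (expLoss (l2sqLoss k) Q est) (p v)
      _ = _ := by simp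
  have := hbig.trans hle
  rw [ENNReal.ofReal_mul (by positivity), ENNReal.ofReal_pow (by norm_num)] at this
  have h2 : ENNReal.ofReal 2 = 2 := by simp
  rw [h2] at this
  exact (ENNReal.mul_le_mul_iff_right (by simp) (by simp)).1 this

lemma lower {k n : ℕ} {ε : ℝ} (hk : 2 ≤ k) (hn : 1 ≤ n) (h0 : 0 ≤ ε) (h1 : ε ≤ 1) :
    ENNReal.ofReal (1 / 1200 * min (1 / √(max 1 (n * ε ^ 2))) (k / max 1 (n * ε ^ 2))) ≤
      optMinimaxRisk k n ε (l2sqLoss k) := by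
  set M : ℝ := max 1 (n * ε ^ 2) with hM
  have hM1 : 1 ≤ M := le_max_left _ _
  have hMN : n * ε ^ 2 ≤ M := le_max_right _ _
  have hs1 : 1 ≤ √M := by rw [Real.one_le_sqrt]; exact hM1
  have hss : √M ^ 2 = M := Real.sq_sqrt (by linarith)
  have hf1 : 1 ≤ ⌊√M⌋₊ := Nat.le_floor (by simpa using hs1)
  set d := min (k / 2) ⌊√M⌋₊ with hd
  have hd1 : 1 ≤ d := le_min (by omega) hf1
  have hdk : 2 * d ≤ k := by have : d ≤ k / 2 := min_le_left _ _
                             omega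
  have hds : (d:ℝ) ≤ √M := by
    have h : d ≤ ⌊√M⌋₊ := min_le_right _ _
    exact (Nat.cast_le.2 h).trans (Nat.floor_le (by positivity))
  have hd' : (1:ℝ) ≤ d := by exact_mod_cast hd1
  set γ : ℝ := d / (5 * √M) with hγ
  have hγ2 : γ ^ 2 = d ^ 2 / (25 * M) := by
    rw [hγ, div_pow, mul_pow, hss]; norm_num
  have hlow : min (1 / √M) (k / M) ≤ 3 * (d / M) := by
    rcases min_choice (k / 2) ⌊√M⌋₊ with h | h
    · refine (min_le_right _ _).trans ?_
      rw [← mul_div_assoc]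
      refine div_le_div_of_nonneg_right ?_ (by linarith)
      have h6 : k ≤ 3 * d := by omega
      exact_mod_cast h6
    · refine (min_le_left _ _).trans ?_
      have : √M ≤ 2 * d := by
        have h5 := Nat.lt_floor_add_one √M
        rw [← h, ← hd] at h5
        linarith
      rw [← mul_div_assoc, div_le_div_iff₀ (by linarith) (by linarith)]
      nlinarith
  unfold optMinimaxRisk
  refine le_iInf fun l => le_iInf fun Q => le_iInf fun hQ => le_iInf fun hL =>
    le_iInf fun est => ?_
  refine le_trans (ENNReal.ofReal_le_ofReal ?_)
    (lower_core hn hd1 hdk h0 h1 (γ := γ) (by positivity) ?_ ?_ Q hQ hL est)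
  · have : γ ^ 2 / (16 * d) = (1 / 400) * (d / M) := by
      rw [hγ2]; field_simp; norm_num
    rw [this]
    linarith
  · rw [hγ, div_le_one (by positivity)]; linarith
  · rw [hγ2]
    have e : 18 * (n * ε ^ 2) * ((d:ℝ) ^ 2 / (25 * M)) = d ^ 2 * ((18 / 25) * (n * ε ^ 2 / M)) := by
      field_simp
    rw [e]
    have : n * ε ^ 2 / M ≤ 1 := (div_le_one (by linarith)).2 hMN
    nlinarith [sq_nonneg (d:ℝ)]

end Aux
/-- There exist universal constants `0 < c_l ≤ c_u < 5` such that for all `k ≥ 2`,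
`n ≥ 1` and `ε ∈ [0,1]`, the optimal private minimax risk under squared `ℓ2` loss
satisfies `c_l · min{1, 1/√(nε²), k/(nε²)} ≤ r ≤ c_u · min{1, k/(nε²)}`
(the middle terms read as `∞` when `ε = 0`, computed in `ℝ≥0∞`). -/
theorem opt_minimax_l2sq_bounds :
    ∃ cl cu : ℝ, 0 < cl ∧ cl ≤ cu ∧ cu < 5 ∧
      ∀ (k n : ℕ) (ε : ℝ), 2 ≤ k → 1 ≤ n → 0 ≤ ε → ε ≤ 1 →
        ENNReal.ofReal cl *
            min 1 (min (1 / ENNReal.ofReal (Real.sqrt ((n : ℝ) * ε ^ 2)))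
              ((k : ℝ≥0∞) / ENNReal.ofReal ((n : ℝ) * ε ^ 2))) ≤
          optMinimaxRisk k n ε (l2sqLoss k) ∧
        optMinimaxRisk k n ε (l2sqLoss k) ≤
          ENNReal.ofReal cu * min 1 ((k : ℝ≥0∞) / ENNReal.ofReal ((n : ℝ) * ε ^ 2)) := by
  refine ⟨1 / 1200, 4.95, by norm_num, by norm_num, by norm_num, ?_⟩
  intro k n ε hk hn h0 h1
  have hn' : (0:ℝ) < n := by exact_mod_cast hn
  constructor
  · refine le_trans ?_ (Aux.lower hk hn h0 h1)
    rw [ENNReal.ofReal_mul (p := 1 / 1200) (by norm_num)]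
    refine mul_le_mul_right ?_ _
    rcases le_total ((n:ℝ) * ε ^ 2) 1 with h | h
    · rw [max_eq_left h]
      refine (min_le_left _ _).trans ?_
      rw [ENNReal.one_le_ofReal]
      have : (2:ℝ) ≤ k := by exact_mod_cast hk
      simp
      linarith
    · rw [max_eq_right h]
      refine (min_le_right _ _).trans ?_
      have h2 : 0 < √((n:ℝ) * ε ^ 2) := Real.sqrt_pos.2 (by linarith)
      rcases min_choice (1 / √((n:ℝ) * ε ^ 2)) (k / (n * ε ^ 2)) with h3 | h3 <;> rw [h3]
      · rw [ENNReal.ofReal_div_of_pos h2, ENNReal.ofReal_one]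
        exact min_le_left _ _
      · rw [ENNReal.ofReal_div_of_pos (by linarith), ENNReal.ofReal_natCast]
        exact min_le_right _ _
  · rcases h0.eq_or_lt with h | h
    · have : (k : ℝ≥0∞) / ENNReal.ofReal ((n : ℝ) * ε ^ 2) = ⊤ := by
        rw [← h]
        simp only [ne_eq, OfNat.ofNat_ne_zero, not_false_eq_true, zero_pow, mul_zero,
          ENNReal.ofReal_zero]
        exact ENNReal.div_zero (by simp; omega)
      rw [this, min_eq_left le_top, mul_one]
      exact Aux.upper_one (by omega) h0
    · rcases min_choice (1 : ℝ≥0∞) ((k : ℝ≥0∞) / ENNReal.ofReal ((n : ℝ) * ε ^ 2))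
        with h3 | h3 <;> rw [h3]
      · rw [mul_one]
        exact Aux.upper_one (by omega) h0
      · refine (Aux.upper (by omega) hn h h1).trans_eq ?_
        rw [ENNReal.ofReal_mul (by norm_num), ENNReal.ofReal_div_of_pos (by positivity),
          ENNReal.ofReal_natCast]
end

section
/- There exist universal constants 0 < c_l ≤ c_u < 5 such that for all integers k ≥ 2, all n ≥ 1, and all ε ∈ [0,1], the optimal private minimax risk under ℓ1 loss satisfies c_l · min{1, k/√(nε²)} ≤ r_{ℓ1,ε,k,n} ≤ c_u · min{1, k/√(nε²)}. -/
open scoped ENNReal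

/-- The `ℓ1` loss `ℓ1(p, p̂) = ∑ i, |p_i − p̂_i|`. -/
noncomputable def l1Loss (k : ℕ) (p q : ProbSimplex k) : ℝ :=
  ∑ i, |p.1 i - q.1 i|

namespace OptMM

lemma sum_prod_one {l : ℕ} (M : Fin l → ℝ) (hM : ∑ y, M y = 1) (n : ℕ) :
    ∑ y : Fin n → Fin l, ∏ i, M (y i) = 1 := by
  have h := Finset.prod_univ_sum (fun _ : Fin n => (Finset.univ : Finset (Fin l)))
    (fun _ y => M y)
  rw [Fintype.piFinset_univ] at h
  rw [← h]; simp [hM]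

lemma sum_prod_pow {l : ℕ} (M : Fin l → ℝ) (n : ℕ) :
    ∑ y : Fin n → Fin l, ∏ i, M (y i) = (∑ y, M y) ^ n := by
  have h := Finset.prod_univ_sum (fun _ : Fin n => (Finset.univ : Finset (Fin l)))
    (fun _ y => M y)
  rw [Fintype.piFinset_univ] at h
  rw [← h]; simp

lemma sum_cons {l n : ℕ} (F : (Fin (n+1) → Fin l) → ℝ) :
    ∑ y, F y = ∑ a : Fin l, ∑ y : Fin n → Fin l, F (Fin.cons a y) := by
  rw [← (Fin.consEquiv (fun _ => Fin l)).sum_comp, Fintype.sum_prod_type]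
  rfl

lemma first_moment {l : ℕ} (M g : Fin l → ℝ) (hM : ∑ y, M y = 1) (hg : ∑ y, M y * g y = 0)
    (n : ℕ) : ∑ y : Fin n → Fin l, (∏ i, M (y i)) * ∑ i, g (y i) = 0 := by
  induction n with
  | zero => simp
  | succ n ih =>
    rw [sum_cons]
    simp only [Fin.prod_univ_succ, Fin.sum_univ_succ, Fin.cons_zero, Fin.cons_succ]
    have : ∀ a, ∑ y : Fin n → Fin l, M a * (∏ i, M (y i)) * (g a + ∑ i, g (y i))
        = M a * g a := by
      intro a
      calc _ = M a * g a * (∑ y : Fin n → Fin l, ∏ i, M (y i))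
            + M a * ∑ y : Fin n → Fin l, (∏ i, M (y i)) * ∑ i, g (y i) := by
              rw [Finset.mul_sum, Finset.mul_sum, ← Finset.sum_add_distrib]
              exact Finset.sum_congr rfl fun y _ => by ring
        _ = _ := by rw [ih, sum_prod_one M hM]; ring
    simp only [this, hg]

lemma second_moment {l : ℕ} (M g : Fin l → ℝ) (hM : ∑ y, M y = 1) (hg : ∑ y, M y * g y = 0)
    (n : ℕ) : ∑ y : Fin n → Fin l, (∏ i, M (y i)) * (∑ i, g (y i)) ^ 2
      = n * ∑ y, M y * g y ^ 2 := by
  induction n with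
  | zero => simp
  | succ n ih =>
    rw [sum_cons]
    simp only [Fin.prod_univ_succ, Fin.sum_univ_succ, Fin.cons_zero, Fin.cons_succ]
    have : ∀ a, ∑ y : Fin n → Fin l, M a * (∏ i, M (y i)) * (g a + ∑ i, g (y i)) ^ 2
        = M a * g a ^ 2 + M a * (n * ∑ y, M y * g y ^ 2) := by
      intro a
      calc _ = M a * g a ^ 2 * (∑ y : Fin n → Fin l, ∏ i, M (y i))
            + 2 * M a * g a * (∑ y : Fin n → Fin l, (∏ i, M (y i)) * ∑ i, g (y i))
            + M a * ∑ y : Fin n → Fin l, (∏ i, M (y i)) * (∑ i, g (y i)) ^ 2 := by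
              rw [Finset.mul_sum, Finset.mul_sum, Finset.mul_sum, ← Finset.sum_add_distrib,
                ← Finset.sum_add_distrib]
              exact Finset.sum_congr rfl fun y _ => by ring
        _ = _ := by rw [ih, sum_prod_one M hM, first_moment M g hM hg]; ring
    simp only [this]
    rw [Finset.sum_add_distrib, ← Finset.sum_mul, hM]
    push_cast; ring

/-- expected absolute deviation -/
lemma abs_dev {l : ℕ} (M f : Fin l → ℝ) (hM0 : ∀ y, 0 ≤ M y) (hM : ∑ y, M y = 1)
    (μ : ℝ) (hf : ∑ y, M y * f y = μ) (hf2 : ∀ y, f y ^ 2 = 1) (n : ℕ) :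
    ∑ y : Fin n → Fin l, (∏ i, M (y i)) * |n * μ - ∑ i, f (y i)| ≤ √n := by
  set g : Fin l → ℝ := fun y => f y - μ
  have hg : ∑ y, M y * g y = 0 := by
    simp only [g, mul_sub, Finset.sum_sub_distrib, ← Finset.sum_mul, hf, hM]; ring
  have hg2 : ∑ y, M y * g y ^ 2 ≤ 1 := by
    have : ∀ y, M y * g y ^ 2 = M y - 2 * μ * (M y * f y) + μ ^ 2 * M y := by
      intro y
      simp only [g]
      linear_combination M y * hf2 y
    simp only [this]
    rw [Finset.sum_add_distrib, Finset.sum_sub_distrib, ← Finset.mul_sum, ← Finset.mul_sum, hf, hM]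
    nlinarith [sq_nonneg μ]
  have h2 := second_moment M g hM hg n
  have hP : ∀ y : Fin n → Fin l, 0 ≤ ∏ i, M (y i) := fun y => Finset.prod_nonneg fun i _ => hM0 _
  have hs : ∀ y : Fin n → Fin l, |n * μ - ∑ i, f (y i)| = |∑ i, g (y i)| := by
    intro y
    rw [abs_sub_comm]; simp [g]
  simp only [hs]
  apply Real.le_sqrt_of_sq_le
  have cs := Finset.sum_mul_sq_le_sq_mul_sq Finset.univ
    (fun y : Fin n → Fin l => √(∏ i, M (y i)))
    (fun y : Fin n → Fin l => √(∏ i, M (y i)) * |∑ i, g (y i)|)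
  simp only [mul_pow, Real.sq_sqrt (hP _), sq_abs, ← mul_assoc, Real.mul_self_sqrt (hP _)] at cs
  rw [sum_prod_one M hM, one_mul, h2] at cs
  refine cs.trans ?_
  have : (0:ℝ) ≤ n := Nat.cast_nonneg n
  nlinarith

lemma sqrt_lower {A B η : ℝ} (hB : 0 ≤ B) (hη : η ≤ 1) (h : |A - B| ≤ η * B) :
    B + (A - B) / 2 - η ^ 2 * B / 2 ≤ √(A * B) := by
  rcases hB.eq_or_lt with h0 | hB
  · subst h0
    have : A = 0 := by simpa using h
    simp [this]
  obtain ⟨u, rfl⟩ : ∃ u, A = B + u * B := ⟨(A - B) / B, by field_simp; ring⟩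
  have hu : |u| ≤ η := by
    rw [add_sub_cancel_left, abs_mul, abs_of_pos hB] at h
    exact le_of_mul_le_mul_right h hB
  have hu' := abs_le.1 (hu.trans hη)
  have hu2 : u ^ 2 ≤ η ^ 2 := by
    rw [← sq_abs u]; exact pow_le_pow_left₀ (abs_nonneg u) hu 2
  have h1 : B + (B + u * B - B) / 2 - η ^ 2 * B / 2 ≤ B * (1 + u / 2 - u ^ 2 / 2) := by
    nlinarith
  refine h1.trans (Real.le_sqrt_of_sq_le ?_)
  have h2 : (1 + u / 2 - u ^ 2 / 2) ^ 2 ≤ 1 + u := by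
    nlinarith [mul_nonneg (sq_nonneg u) (mul_nonneg (by linarith : 0 ≤ 3 - u) (by linarith : 0 ≤ u + 1))]
  calc _ = B ^ 2 * (1 + u / 2 - u ^ 2 / 2) ^ 2 := by ring
    _ ≤ B ^ 2 * (1 + u) := by gcongr
    _ = _ := by ring

lemma sum_min {l : ℕ} (A B : Fin l → ℝ) (hA0 : ∀ y, 0 ≤ A y) (hB0 : ∀ y, 0 ≤ B y)
    (hA : ∑ y, A y = 1) (hB : ∑ y, B y = 1) (η : ℝ) (hη1 : η ≤ 1) (hη0 : 0 ≤ η)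
    (h : ∀ y, |A y - B y| ≤ η * B y) (n : ℕ) :
    (1 - n * η ^ 2) / 2 ≤ ∑ y : Fin n → Fin l, min (∏ i, A (y i)) (∏ i, B (y i)) := by
  have h1 : 1 - η ^ 2 / 2 ≤ ∑ y, √(A y * B y) := by
    calc 1 - η ^ 2 / 2 = ∑ y, (B y + (A y - B y) / 2 - η ^ 2 * B y / 2) := by
          rw [Finset.sum_sub_distrib, Finset.sum_add_distrib, ← Finset.sum_div, ← Finset.sum_div,
            Finset.sum_sub_distrib, ← Finset.mul_sum, hA, hB]; ring
      _ ≤ _ := Finset.sum_le_sum fun y _ => sqrt_lower (hB0 y) hη1 (h y)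
  have hPA : ∀ y : Fin n → Fin l, 0 ≤ ∏ i, A (y i) := fun y => Finset.prod_nonneg fun i _ => hA0 _
  have hPB : ∀ y : Fin n → Fin l, 0 ≤ ∏ i, B (y i) := fun y => Finset.prod_nonneg fun i _ => hB0 _
  have h2 : (1 - η ^ 2 / 2) ^ n ≤ ∑ y : Fin n → Fin l, √((∏ i, A (y i)) * (∏ i, B (y i))) := by
    have : ∀ y : Fin n → Fin l, √((∏ i, A (y i)) * (∏ i, B (y i))) = ∏ i, √(A (y i) * B (y i)) := by
      intro y
      rw [← Finset.prod_mul_distrib, Real.sqrt_eq_iff_mul_self_eq]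
      · rw [← Finset.prod_mul_distrib]
        exact Finset.prod_congr rfl fun i _ => (Real.mul_self_sqrt (mul_nonneg (hA0 _) (hB0 _))).symm
      · exact Finset.prod_nonneg fun i _ => mul_nonneg (hA0 _) (hB0 _)
      · exact Finset.prod_nonneg fun i _ => Real.sqrt_nonneg _
    simp only [this]
    rw [sum_prod_pow (fun y => √(A y * B y))]
    exact pow_le_pow_left₀ (by nlinarith) h1 n
  have h3 := Finset.sum_mul_sq_le_sq_mul_sq Finset.univ
    (fun y : Fin n → Fin l => √(min (∏ i, A (y i)) (∏ i, B (y i))))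
    (fun y : Fin n → Fin l => √(max (∏ i, A (y i)) (∏ i, B (y i))))
  have e1 : ∀ y : Fin n → Fin l, 0 ≤ min (∏ i, A (y i)) (∏ i, B (y i)) := 
    fun y => le_min (hPA y) (hPB y)
  have e2 : ∀ y : Fin n → Fin l, 0 ≤ max (∏ i, A (y i)) (∏ i, B (y i)) := 
    fun y => le_max_of_le_left (hPA y)
  simp only [Real.sq_sqrt (e1 _), Real.sq_sqrt (e2 _), ← Real.sqrt_mul (e1 _), min_mul_max] at h3
  have h4 : ∑ y : Fin n → Fin l, max (∏ i, A (y i)) (∏ i, B (y i)) ≤ 2 := by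
    calc _ ≤ ∑ y : Fin n → Fin l, ((∏ i, A (y i)) + (∏ i, B (y i))) :=
          Finset.sum_le_sum fun y _ => max_le_add_of_nonneg (hPA y) (hPB y)
      _ = 2 := by rw [Finset.sum_add_distrib, sum_prod_one A hA, sum_prod_one B hB]; norm_num
  have h5 : 0 ≤ ∑ y : Fin n → Fin l, min (∏ i, A (y i)) (∏ i, B (y i)) :=
    Finset.sum_nonneg fun y _ => e1 y
  have h6 : 1 - n * η ^ 2 ≤ ((1 - η ^ 2 / 2) ^ n) ^ 2 := by
    rw [← pow_mul]
    have := one_add_mul_le_pow (a := -(η ^ 2 / 2)) (by nlinarith) (n * 2)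
    push_cast at this
    calc _ = 1 + (n * 2 : ℝ) * -(η ^ 2 / 2) := by ring
      _ ≤ _ := this
      _ = _ := by ring
  have h7 : ((1 - η ^ 2 / 2) ^ n) ^ 2 ≤ 
      (∑ y : Fin n → Fin l, √((∏ i, A (y i)) * (∏ i, B (y i)))) ^ 2 :=
    pow_le_pow_left₀ (pow_nonneg (by nlinarith) n) h2 2
  nlinarith

lemma Q_diff {k l : ℕ} (Q : Fin k → Fin l → ℝ) (ε : ℝ) (hε : 0 ≤ ε)
    (hL : LDP ε Q) (p : ProbSimplex k) (a b : Fin k) (y : Fin l) :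
    |Q a y - Q b y| ≤ (Real.exp ε - 1) * ∑ x, p.1 x * Q x y := by
  have : Nonempty (Fin k) := ⟨a⟩
  obtain ⟨x0, h0⟩ := Finite.exists_min (fun x => Q x y)
  have he : 0 ≤ Real.exp ε - 1 := by linarith [Real.one_le_exp hε]
  have h1 : |Q a y - Q b y| ≤ (Real.exp ε - 1) * Q x0 y := by
    rw [abs_le]
    constructor <;> linarith [h0 a, h0 b, hL a x0 y, hL b x0 y]
  refine h1.trans (mul_le_mul_of_nonneg_left ?_ he)
  calc Q x0 y = ∑ x, p.1 x * Q x0 y := by rw [← Finset.sum_mul, p.2.2, one_mul]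
    _ ≤ _ := Finset.sum_le_sum fun x _ => mul_le_mul_of_nonneg_left (h0 x) (p.2.1 x)

lemma mix_nonneg {k l : ℕ} {Q : Fin k → Fin l → ℝ} (hQ : RowStochastic Q) (p : ProbSimplex k)
    (y : Fin l) : 0 ≤ ∑ x, p.1 x * Q x y :=
  Finset.sum_nonneg fun x _ => mul_nonneg (p.2.1 x) (hQ.1 x y)

lemma mix_sum {k l : ℕ} {Q : Fin k → Fin l → ℝ} (hQ : RowStochastic Q) (p : ProbSimplex k) :
    ∑ y, ∑ x, p.1 x * Q x y = 1 := by
  rw [Finset.sum_comm]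
  simp only [← Finset.mul_sum, hQ.2, mul_one, p.2.2]

/-- hypercube of distributions -/
noncomputable def pv (m : ℕ) (s : ℝ) (hs : 0 ≤ s) (hm : m * s ≤ 1) (v : Fin m → Bool) :
    ProbSimplex (m + 1) :=
  ⟨Fin.cons (1 - ∑ j, if v j then s else 0) (fun j => if v j then s else 0), by
    constructor
    · intro i
      refine Fin.cases ?_ (fun j => ?_) i
      · simp only [Fin.cons_zero, sub_nonneg]
        calc _ ≤ ∑ j : Fin m, s := Finset.sum_le_sum fun j _ => by split_ifs <;> simp [hs]
          _ ≤ 1 := by simpa using hm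
      · simp only [Fin.cons_succ]; split_ifs <;> simp [hs]
    · simp [Fin.sum_univ_succ]⟩

def flip {m : ℕ} (j : Fin m) (v : Fin m → Bool) : Fin m → Bool := Function.update v j (!v j)

lemma flip_inv {m : ℕ} (j : Fin m) : Function.Involutive (flip j) := by
  intro v; simp [flip]

lemma pv_diff {m l : ℕ} (s : ℝ) (hs : 0 ≤ s) (hm : m * s ≤ 1) (v : Fin m → Bool) (j : Fin m)
    (Q : Fin (m+1) → Fin l → ℝ) (y : Fin l) :
    |∑ x, (pv m s hs hm v).1 x * Q x y - ∑ x, (pv m s hs hm (flip j v)).1 x * Q x y|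
      = s * |Q j.succ y - Q 0 y| := by
  have key : ∑ x, (pv m s hs hm v).1 x * Q x y - ∑ x, (pv m s hs hm (flip j v)).1 x * Q x y
      = (if v j then s else -s) * (Q j.succ y - Q 0 y) := by
    have e : ∀ w, ∑ x, (pv m s hs hm w).1 x * Q x y
        = Q 0 y + ∑ i, (if w i then s else 0) * (Q i.succ y - Q 0 y) := by
      intro w
      simp only [pv, Fin.sum_univ_succ, Fin.cons_zero, Fin.cons_succ, mul_sub,
        Finset.sum_sub_distrib, ← Finset.sum_mul]
      ring
    rw [e, e, add_sub_add_left_eq_sub, ← Finset.sum_sub_distrib, Finset.sum_eq_single j]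
    · simp only [flip, Function.update_self]
      cases v j <;> simp
    · intro i _ hi
      simp [flip, Function.update_of_ne hi]
    · simp
  rw [key, abs_mul]
  congr 1
  split_ifs <;> simp [abs_of_nonneg hs]

lemma pv_sep {m : ℕ} (s : ℝ) (hs : 0 ≤ s) (hm : m * s ≤ 1) (v : Fin m → Bool) (j : Fin m)
    (a : ℝ) : s ≤ |(pv m s hs hm v).1 j.succ - a| + |(pv m s hs hm (flip j v)).1 j.succ - a| := by
  have : |(pv m s hs hm v).1 j.succ - (pv m s hs hm (flip j v)).1 j.succ| = s := by
    simp only [pv, Fin.cons_succ, flip, Function.update_self]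
    cases v j <;> simp [abs_of_nonneg hs]
  calc s = _ := this.symm
    _ ≤ _ := abs_sub_le _ a _
    _ = _ := by rw [abs_sub_comm a]

/-- coordinate risk -/
noncomputable def T {k l n : ℕ} (Q : Fin k → Fin l → ℝ)
    (est : (Fin n → Fin l) → PMF (ProbSimplex k)) (i : Fin k) (p : ProbSimplex k) : ℝ≥0∞ :=
  ∑ y : Fin n → Fin l,
    ENNReal.ofReal (∏ t, ∑ x, p.1 x * Q x (y t)) *
      ∑' a : ProbSimplex k, est y a * ENNReal.ofReal |p.1 i - a.1 i|

lemma T_sum {m l n : ℕ} (Q : Fin (m+1) → Fin l → ℝ)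
    (est : (Fin n → Fin l) → PMF (ProbSimplex (m+1))) (p : ProbSimplex (m+1)) :
    ∑ j : Fin m, T Q est j.succ p ≤ expLoss (l1Loss (m+1)) Q est p := by
  unfold T expLoss
  rw [Finset.sum_comm]
  refine Finset.sum_le_sum fun y _ => ?_
  rw [← Finset.mul_sum]
  gcongr
  rw [← Summable.tsum_finsetSum (fun _ _ => ENNReal.summable)]
  refine ENNReal.tsum_le_tsum fun a => ?_
  rw [← Finset.mul_sum]
  gcongr
  rw [← ENNReal.ofReal_sum_of_nonneg (fun _ _ => abs_nonneg _)]
  apply ENNReal.ofReal_le_ofReal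
  rw [l1Loss, Fin.sum_univ_succ]
  linarith [abs_nonneg (p.1 0 - a.1 0)]

lemma T_pair {m l n : ℕ} (Q : Fin (m+1) → Fin l → ℝ) (hQ : RowStochastic Q) (ε : ℝ) (hε : 0 ≤ ε)
    (hL : LDP ε Q)
    (est : (Fin n → Fin l) → PMF (ProbSimplex (m+1)))
    (s : ℝ) (hs : 0 ≤ s) (hm : m * s ≤ 1) (hη : s * (Real.exp ε - 1) ≤ 1)
    (v : Fin m → Bool) (j : Fin m) :
    ENNReal.ofReal ((1 - n * (s * (Real.exp ε - 1)) ^ 2) / 2 * s) ≤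
      T Q est j.succ (pv m s hs hm v) + T Q est j.succ (pv m s hs hm (flip j v)) := by
  set p := pv m s hs hm v
  set p' := pv m s hs hm (flip j v)
  have he : 0 ≤ Real.exp ε - 1 := by linarith [Real.one_le_exp hε]
  have hmin := sum_min (fun y => ∑ x, p.1 x * Q x y) (fun y => ∑ x, p'.1 x * Q x y)
    (mix_nonneg hQ p) (mix_nonneg hQ p') (mix_sum hQ p) (mix_sum hQ p') (s * (Real.exp ε - 1)) hη
    (mul_nonneg hs he) (fun y => by
      rw [pv_diff, mul_assoc]
      exact mul_le_mul_of_nonneg_left (Q_diff Q ε hε hL p' _ _ y) hs) n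
  calc _ ≤ ENNReal.ofReal ((∑ y : Fin n → Fin l, min (∏ i, ∑ x, p.1 x * Q x (y i))
          (∏ i, ∑ x, p'.1 x * Q x (y i))) * s) :=
        ENNReal.ofReal_le_ofReal (mul_le_mul_of_nonneg_right hmin hs)
    _ = ∑ y : Fin n → Fin l, ENNReal.ofReal (min (∏ i, ∑ x, p.1 x * Q x (y i))
          (∏ i, ∑ x, p'.1 x * Q x (y i))) * ENNReal.ofReal s := by
        have e1 : ∀ y : Fin n → Fin l, 0 ≤ min (∏ i, ∑ x, p.1 x * Q x (y i))
          (∏ i, ∑ x, p'.1 x * Q x (y i)) := fun y =>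
            le_min (Finset.prod_nonneg fun i _ => mix_nonneg hQ p _)
              (Finset.prod_nonneg fun i _ => mix_nonneg hQ p' _)
        rw [ENNReal.ofReal_mul (Finset.sum_nonneg fun y _ => e1 y),
          ENNReal.ofReal_sum_of_nonneg (fun y _ => e1 y), Finset.sum_mul]
    _ ≤ ∑ y : Fin n → Fin l, ENNReal.ofReal (min (∏ i, ∑ x, p.1 x * Q x (y i))
          (∏ i, ∑ x, p'.1 x * Q x (y i))) * 
          ((∑' a, est y a * ENNReal.ofReal |p.1 j.succ - a.1 j.succ|) +
           (∑' a, est y a * ENNReal.ofReal |p'.1 j.succ - a.1 j.succ|)) := by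
        refine Finset.sum_le_sum fun y _ => ?_
        gcongr
        rw [← ENNReal.tsum_add]
        calc ENNReal.ofReal s = ∑' a, est y a * ENNReal.ofReal s := by
              rw [ENNReal.tsum_mul_right, PMF.tsum_coe, one_mul]
          _ ≤ _ := by
            refine ENNReal.tsum_le_tsum fun a => ?_
            rw [← mul_add, ← ENNReal.ofReal_add (abs_nonneg _) (abs_nonneg _)]
            gcongr
            exact pv_sep s hs hm v j _
    _ ≤ _ := by
        rw [T, T, ← Finset.sum_add_distrib]
        refine Finset.sum_le_sum fun y _ => ?_
        rw [mul_add]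
        gcongr
        · exact min_le_left _ _
        · exact min_le_right _ _

lemma lower_aux {m l n : ℕ} (Q : Fin (m+1) → Fin l → ℝ) (hQ : RowStochastic Q) (ε : ℝ)
    (hε : 0 ≤ ε) (hL : LDP ε Q)
    (s : ℝ) (hs : 0 ≤ s) (hm : m * s ≤ 1) (hη : s * (Real.exp ε - 1) ≤ 1) :
    m * ENNReal.ofReal ((1 - n * (s * (Real.exp ε - 1)) ^ 2) / 2 * s) ≤
      2 * minimaxRisk (m+1) l n (l1Loss (m+1)) Q := by
  unfold minimaxRisk
  rw [ENNReal.mul_iInf_of_ne (by norm_num) (by norm_num)]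
  refine le_iInf fun est => ?_
  set c := ENNReal.ofReal ((1 - n * (s * (Real.exp ε - 1)) ^ 2) / 2 * s)
  set S := ⨆ p, expLoss (l1Loss (m+1)) Q est p
  have h1 : ∀ j : Fin m, (2 ^ m : ℝ≥0∞) * c ≤ 2 * ∑ v, T Q est j.succ (pv m s hs hm v) := by
    intro j
    have e : ∑ v, T Q est j.succ (pv m s hs hm (flip j v))
        = ∑ v, T Q est j.succ (pv m s hs hm v) :=
      Equiv.sum_comp (flip_inv j).toPerm (fun v => T Q est j.succ (pv m s hs hm v))
    calc (2 ^ m : ℝ≥0∞) * c = ∑ v : Fin m → Bool, c := by simp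
      _ ≤ ∑ v, (T Q est j.succ (pv m s hs hm v) + T Q est j.succ (pv m s hs hm (flip j v))) :=
        Finset.sum_le_sum fun v _ => T_pair Q hQ ε hε hL est s hs hm hη v j
      _ = _ := by rw [Finset.sum_add_distrib, e, two_mul]
  have h2 : ∑ j : Fin m, ∑ v, T Q est j.succ (pv m s hs hm v) ≤ 2 ^ m * S := by
    rw [Finset.sum_comm]
    calc _ ≤ ∑ v : Fin m → Bool, S := Finset.sum_le_sum fun v _ =>
            (T_sum Q est _).trans (le_iSup (fun p => expLoss (l1Loss (m+1)) Q est p) _)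
      _ = _ := by simp
  have h3 : (2 ^ m : ℝ≥0∞) * (m * c) ≤ 2 ^ m * (2 * S) := by
    calc (2 ^ m : ℝ≥0∞) * (m * c) = ∑ j : Fin m, (2 ^ m : ℝ≥0∞) * c := by simp; ring
      _ ≤ ∑ j : Fin m, 2 * ∑ v, T Q est j.succ (pv m s hs hm v) :=
        Finset.sum_le_sum fun j _ => h1 j
      _ = 2 * ∑ j : Fin m, ∑ v, T Q est j.succ (pv m s hs hm v) := by rw [Finset.mul_sum]
      _ ≤ 2 * (2 ^ m * S) := by gcongr
      _ = _ := by ring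
  exact (ENNReal.mul_le_mul_iff_right (by simp) (by simp)).1 h3

lemma lower {k n : ℕ} (ε z : ℝ) (hk : 2 ≤ k) (hn : 1 ≤ n) (hε : 0 ≤ ε) (hε1 : ε ≤ 1)
    (hz : 0 ≤ z) (hz1 : z ≤ 1) (hzk : z * √(n * ε ^ 2) ≤ k) :
    ENNReal.ofReal (1 / 48 * z) ≤ optMinimaxRisk k n ε (l1Loss k) := by
  obtain ⟨m, rfl⟩ : ∃ m, k = m + 1 := ⟨k - 1, by omega⟩
  unfold optMinimaxRisk
  refine le_iInf fun l => le_iInf fun Q => le_iInf fun hQ => le_iInf fun hL => ?_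
  have hm1 : (1:ℝ) ≤ m := by exact_mod_cast (by omega : 1 ≤ m)
  have hm0 : (0:ℝ) < m := by linarith
  have hn1 : (1:ℝ) ≤ n := by exact_mod_cast hn
  set s : ℝ := z / 6 / m with hsdef
  have hs : 0 ≤ s := by positivity
  have hms : m * s = z / 6 := by rw [hsdef]; field_simp
  have he0 : 0 ≤ Real.exp ε - 1 := by linarith [Real.one_le_exp hε]
  have he : Real.exp ε - 1 ≤ 2 * ε := by
    have := Real.abs_exp_sub_one_le (x := ε) (by rw [abs_of_nonneg hε]; exact hε1)
    rw [abs_of_nonneg hε, abs_of_nonneg he0] at this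
    exact this
  have hsq : z ^ 2 * (n * ε ^ 2) ≤ (m + 1) ^ 2 := by
    have h0 : (0:ℝ) ≤ n * ε ^ 2 := by positivity
    have := pow_le_pow_left₀ (by positivity) hzk 2
    rw [mul_pow, Real.sq_sqrt h0] at this
    simpa using this
  have hη2 : n * (s * (Real.exp ε - 1)) ^ 2 ≤ 1 / 2 := by
    have h1 : s * (Real.exp ε - 1) ≤ s * (2 * ε) := mul_le_mul_of_nonneg_left he hs
    have h2 : (s * (Real.exp ε - 1)) ^ 2 ≤ (s * (2 * ε)) ^ 2 :=
      pow_le_pow_left₀ (mul_nonneg hs he0) h1 2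
    calc n * (s * (Real.exp ε - 1)) ^ 2 ≤ n * (s * (2 * ε)) ^ 2 := by gcongr
      _ = z ^ 2 * (n * ε ^ 2) / (9 * m ^ 2) := by rw [hsdef]; field_simp; ring
      _ ≤ (m + 1) ^ 2 / (9 * m ^ 2) := by gcongr
      _ ≤ 1 / 2 := by rw [div_le_div_iff₀ (by positivity) (by norm_num)]; nlinarith
  have hη : s * (Real.exp ε - 1) ≤ 1 := by
    have h0 := mul_nonneg hs he0
    nlinarith [sq_nonneg (s * (Real.exp ε - 1))]
  have key := lower_aux (n := n) Q hQ ε hε hL s hs (by rw [hms]; linarith) hη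
  have : 2 * ENNReal.ofReal (1 / 48 * z) ≤
      m * ENNReal.ofReal ((1 - n * (s * (Real.exp ε - 1)) ^ 2) / 2 * s) := by
    rw [← ENNReal.ofReal_natCast, ← ENNReal.ofReal_ofNat 2, ← ENNReal.ofReal_mul (by positivity),
      ← ENNReal.ofReal_mul (by positivity)]
    apply ENNReal.ofReal_le_ofReal
    calc _ = (1/4) * (z / 6) := by ring
      _ = (1 / 4) * (m * s) := by rw [hms]
      _ ≤ ((1 - n * (s * (Real.exp ε - 1)) ^ 2) / 2) * (m * s) := by
        refine mul_le_mul_of_nonneg_right ?_ (by positivity)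
        linarith
      _ = _ := by ring
  exact (ENNReal.mul_le_mul_iff_right (by norm_num) (by norm_num)).1 (this.trans key)

lemma l1_le_two {k : ℕ} (p q : ProbSimplex k) : l1Loss k p q ≤ 2 := by
  calc l1Loss k p q ≤ ∑ i, (p.1 i + q.1 i) := Finset.sum_le_sum fun i _ => by
        rw [abs_le]; constructor <;> linarith [p.2.1 i, q.2.1 i]
    _ = 2 := by rw [Finset.sum_add_distrib, p.2.2, q.2.2]; norm_num

lemma expLoss_pure {k l n : ℕ} {Q : Fin k → Fin l → ℝ} (hQ : RowStochastic Q)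
    (f : (Fin n → Fin l) → ProbSimplex k) (p : ProbSimplex k) :
    expLoss (l1Loss k) Q (fun y => PMF.pure (f y)) p =
      ENNReal.ofReal (∑ y : Fin n → Fin l, (∏ i, ∑ x, p.1 x * Q x (y i)) * l1Loss k p (f y)) := by
  have hl : ∀ q, 0 ≤ l1Loss k p q := fun q => Finset.sum_nonneg fun i _ => abs_nonneg _
  have hP : ∀ y : Fin n → Fin l, 0 ≤ ∏ i, ∑ x, p.1 x * Q x (y i) :=
    fun y => Finset.prod_nonneg fun i _ => mix_nonneg hQ p _
  rw [ENNReal.ofReal_sum_of_nonneg (fun y _ => mul_nonneg (hP y) (hl _))]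
  unfold expLoss
  refine Finset.sum_congr rfl fun y _ => ?_
  rw [ENNReal.ofReal_mul (hP y)]
  congr 1
  rw [tsum_eq_single (f y)]
  · simp
  · intro a ha
    simp [PMF.pure_apply, ha]

lemma upper_trivial {k n : ℕ} (ε : ℝ) (hk : 2 ≤ k) (hε : 0 ≤ ε) :
    optMinimaxRisk k n ε (l1Loss k) ≤ ENNReal.ofReal 2 := by
  have hQ : RowStochastic (fun (_ : Fin k) (_ : Fin 1) => (1:ℝ)) :=
    ⟨fun _ _ => zero_le_one, fun _ => by simp⟩
  have hL : LDP ε (fun (_ : Fin k) (_ : Fin 1) => (1:ℝ)) := fun _ _ _ => by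
    simpa using hε
  let q : ProbSimplex k := ⟨Pi.single ⟨0, by omega⟩ 1, fun i => by
    by_cases h : i = ⟨0, by omega⟩
    · subst h; simp
    · simp [Pi.single_eq_of_ne h], by simp⟩
  refine iInf_le_of_le 1 (iInf_le_of_le _ (iInf_le_of_le hQ (iInf_le_of_le hL ?_)))
  refine iInf_le_of_le (fun _ => PMF.pure q) (iSup_le fun p => ?_)
  rw [expLoss_pure hQ]
  apply ENNReal.ofReal_le_ofReal
  calc _ ≤ ∑ y : Fin n → Fin 1, (∏ i, ∑ x, p.1 x * 1) * 2 :=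
        Finset.sum_le_sum fun y _ => mul_le_mul_of_nonneg_left (l1_le_two _ _)
          (Finset.prod_nonneg fun i _ => mix_nonneg hQ p 0)
    _ = 2 := by simp [p.2.2]

lemma exists_proj {k : ℕ} (hk : 2 ≤ k) (u : Fin k → ℝ) :
    ∃ q : ProbSimplex k, ∀ p : ProbSimplex k, ∑ i, |q.1 i - u i| ≤ ∑ i, |p.1 i - u i| := by
  have hne : (stdSimplex ℝ (Fin k)).Nonempty :=
    ⟨_, single_mem_stdSimplex ℝ (⟨0, by omega⟩ : Fin k)⟩
  obtain ⟨q, hq, hmin⟩ := (isCompact_stdSimplex ℝ (Fin k)).exists_isMinOn hne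
    (f := fun q => ∑ i, |q i - u i|) (by fun_prop)
  exact ⟨⟨q, hq⟩, fun p => hmin p.2⟩

/-- sign -/
def sg (b : Bool) : ℝ := if b then 1 else -1

lemma sg_not (b : Bool) : sg (!b) = - sg b := by cases b <;> simp [sg]
lemma sg_sq (b : Bool) : sg b ^ 2 = 1 := by cases b <;> simp [sg]
lemma sg_abs (b : Bool) : |sg b| = 1 := by cases b <;> simp [sg]

lemma sum_sg {k : ℕ} (i : Fin k) : ∑ v : Fin k → Bool, sg (v i) = 0 := by
  have := Equiv.sum_comp (flip_inv i).toPerm (fun v : Fin k → Bool => sg (v i))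
  simp only [Function.Involutive.coe_toPerm, flip, Function.update_self, sg_not,
    Finset.sum_neg_distrib] at this
  linarith

lemma sum_sg_sg {k : ℕ} (x i : Fin k) :
    ∑ v : Fin k → Bool, sg (v x) * sg (v i) = if x = i then 2 ^ k else 0 := by
  split_ifs with h
  · subst h
    simp [← sq, sg_sq]
  · have := Equiv.sum_comp (flip_inv i).toPerm (fun v : Fin k → Bool => sg (v x) * sg (v i))
    simp only [Function.Involutive.coe_toPerm, flip, Function.update_self, sg_not,
      Function.update_of_ne h, mul_neg, Finset.sum_neg_distrib] at this
    linarith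

lemma exp_bound (ε : ℝ) (h0 : 0 ≤ ε) (h1 : ε ≤ 1) :
    1 + 3 / 7 * ε ≤ Real.exp ε * (1 - 3 / 7 * ε) := by
  have := Real.quadratic_le_exp_of_nonneg h0
  have h : (1 + ε + ε ^ 2 / 2) * (1 - 3 / 7 * ε) ≤ Real.exp ε * (1 - 3 / 7 * ε) :=
    mul_le_mul_of_nonneg_right this (by linarith)
  refine le_trans ?_ h
  nlinarith [mul_nonneg h0 (sub_nonneg.2 h1), mul_nonneg (mul_nonneg h0 h0) (sub_nonneg.2 h1)]

lemma upper {k n : ℕ} (ε : ℝ) (hk : 2 ≤ k) (hn : 1 ≤ n) (hε : 0 < ε) (hε1 : ε ≤ 1) :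
    optMinimaxRisk k n ε (l1Loss k) ≤ ENNReal.ofReal (14 / 3 * (k / √(n * ε ^ 2))) := by
  set τ : ℝ := 3 / 7 * ε with hτ
  have hτ0 : 0 < τ := by positivity
  have hn0 : (0:ℝ) < n := by exact_mod_cast hn
  let e : (Fin k → Bool) ≃ Fin (Fintype.card (Fin k → Bool)) := Fintype.equivFin _
  set l := Fintype.card (Fin k → Bool)
  let Q : Fin k → Fin l → ℝ := fun x y => (1 + τ * sg (e.symm y x)) / 2 ^ k
  have hsum : ∀ F : (Fin k → Bool) → ℝ, ∑ y : Fin l, F (e.symm y) = ∑ v, F v :=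
    fun F => e.symm.sum_comp F
  have hb : ∀ b, 1 - τ ≤ 1 + τ * sg b ∧ 1 + τ * sg b ≤ 1 + τ := by
    intro b; cases b <;> simp [sg] <;> linarith
  have hQ : RowStochastic Q := by
    constructor
    · intro x y
      refine div_nonneg ?_ (by positivity)
      linarith [(hb (e.symm y x)).1]
    · intro x
      simp only [Q]
      rw [hsum (fun v => (1 + τ * sg (v x)) / 2 ^ k), ← Finset.sum_div, Finset.sum_add_distrib,
        ← Finset.mul_sum, sum_sg]
      simp
  have hL : LDP ε Q := by
    intro x x' y
    simp only [Q]
    rw [← mul_div_assoc]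
    gcongr
    refine (hb _).2.trans ((exp_bound ε hε.le hε1).trans ?_)
    gcongr
    exact (hb _).1
  choose proj hproj using exists_proj (k := k) hk
  let u : (Fin n → Fin l) → Fin k → ℝ := fun y i => (∑ t, sg (e.symm (y t) i)) / (n * τ)
  refine iInf_le_of_le l (iInf_le_of_le Q (iInf_le_of_le hQ (iInf_le_of_le hL ?_)))
  refine iInf_le_of_le (fun y => PMF.pure (proj (u y))) (iSup_le fun p => ?_)
  rw [expLoss_pure hQ]
  apply ENNReal.ofReal_le_ofReal
  set M : Fin l → ℝ := fun y => ∑ x, p.1 x * Q x y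
  have hM0 : ∀ y, 0 ≤ M y := mix_nonneg hQ p
  have hM1 : ∑ y, M y = 1 := mix_sum hQ p
  have hmean : ∀ i, ∑ y, M y * sg (e.symm y i) = τ * p.1 i := by
    intro i
    have h1 : ∀ x, ∑ y, Q x y * sg (e.symm y i) = if x = i then τ else 0 := by
      intro x
      simp only [Q]
      rw [hsum (fun v => (1 + τ * sg (v x)) / 2 ^ k * sg (v i))]
      calc _ = (∑ v : Fin k → Bool, sg (v i)) / 2 ^ k
            + τ * (∑ v : Fin k → Bool, sg (v x) * sg (v i)) / 2 ^ k := by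
            rw [Finset.mul_sum, Finset.sum_div, Finset.sum_div, ← Finset.sum_add_distrib]
            exact Finset.sum_congr rfl fun v _ => by ring
        _ = _ := by
          rw [sum_sg, sum_sg_sg]
          split_ifs <;> simp
    calc _ = ∑ y, ∑ x, p.1 x * (Q x y * sg (e.symm y i)) := by
          refine Finset.sum_congr rfl fun y _ => ?_
          rw [Finset.sum_mul]
          exact Finset.sum_congr rfl fun x _ => by ring
      _ = ∑ x, p.1 x * ∑ y, Q x y * sg (e.symm y i) := by
          rw [Finset.sum_comm]
          simp only [Finset.mul_sum]
      _ = _ := by simp only [h1]; simp [mul_comm]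
  have hdev : ∀ i, ∑ y : Fin n → Fin l, (∏ t, M (y t)) * |p.1 i - u y i| ≤ √n / (n * τ) := by
    intro i
    have := abs_dev M (fun y => sg (e.symm y i)) hM0 hM1 _ (hmean i) (fun y => sg_sq _) n
    rw [le_div_iff₀ (by positivity), Finset.sum_mul]
    refine le_trans (le_of_eq ?_) this
    refine Finset.sum_congr rfl fun y _ => ?_
    have h2 : (n : ℝ) * (τ * p.1 i) - ∑ t, sg (e.symm (y t) i) = (p.1 i - u y i) * (n * τ) := by
      simp only [u]
      field_simp
    rw [h2, abs_mul, abs_of_pos (by positivity : (0:ℝ) < n * τ)]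
    ring
  calc _ ≤ ∑ y : Fin n → Fin l, (∏ t, M (y t)) * (2 * ∑ i, |p.1 i - u y i|) := by
        refine Finset.sum_le_sum fun y _ => mul_le_mul_of_nonneg_left ?_
          (Finset.prod_nonneg fun t _ => hM0 _)
        calc l1Loss k p (proj (u y)) 
            ≤ ∑ i, (|p.1 i - u y i| + |(proj (u y)).1 i - u y i|) := by
              refine Finset.sum_le_sum fun i _ => ?_
              rw [abs_sub_comm ((proj (u y)).1 i)]
              exact abs_sub_le _ _ _
          _ ≤ _ := by
            rw [Finset.sum_add_distrib]
            linarith [hproj (u y) p]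
    _ = 2 * ∑ i, ∑ y : Fin n → Fin l, (∏ t, M (y t)) * |p.1 i - u y i| := by
        rw [Finset.sum_comm, Finset.mul_sum]
        refine Finset.sum_congr rfl fun y _ => ?_
        rw [← Finset.mul_sum]; ring
    _ ≤ 2 * ∑ i : Fin k, √n / (n * τ) := by
        gcongr with i; exact hdev i
    _ = _ := by
        rw [Real.sqrt_mul hn0.le, Real.sqrt_sq hε.le]
        have hsn : 0 < √(n:ℝ) := Real.sqrt_pos.2 hn0
        have : (n:ℝ) = √n * √n := (Real.mul_self_sqrt hn0.le).symm
        simp only [Finset.sum_const, Finset.card_univ, Fintype.card_fin, nsmul_eq_mul]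
        rw [hτ]
        have h3 : √(n:ℝ) / (n * (3 / 7 * ε)) = 7 / 3 / (√n * ε) := by
          rw [div_eq_div_iff (by positivity) (by positivity)]
          linear_combination (-ε) * this
        rw [h3]; ring

end OptMM

/-- There exist universal constants `0 < c_l ≤ c_u < 5` such that for all `k ≥ 2`,
`n ≥ 1` and `ε ∈ [0,1]`, the optimal private minimax risk under `ℓ1` loss satisfies
`c_l · min{1, k/√(nε²)} ≤ r ≤ c_u · min{1, k/√(nε²)}`
(the quotient reads as `∞` when `ε = 0`, computed in `ℝ≥0∞`). -/
theorem opt_minimax_l1_bounds :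
    ∃ cl cu : ℝ, 0 < cl ∧ cl ≤ cu ∧ cu < 5 ∧
      ∀ (k n : ℕ) (ε : ℝ), 2 ≤ k → 1 ≤ n → 0 ≤ ε → ε ≤ 1 →
        ENNReal.ofReal cl *
            min 1 ((k : ℝ≥0∞) / ENNReal.ofReal (Real.sqrt ((n : ℝ) * ε ^ 2))) ≤
          optMinimaxRisk k n ε (l1Loss k) ∧
        optMinimaxRisk k n ε (l1Loss k) ≤
          ENNReal.ofReal cu *
            min 1 ((k : ℝ≥0∞) / ENNReal.ofReal (Real.sqrt ((n : ℝ) * ε ^ 2))) := by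
  refine ⟨1 / 48, 14 / 3, by norm_num, by norm_num, by norm_num, ?_⟩
  intro k n ε hk hn hε hε1
  have hn0 : (0:ℝ) < n := by exact_mod_cast hn
  rcases hε.eq_or_lt with h0 | hpos
  · have hz : min 1 ((k : ℝ≥0∞) / ENNReal.ofReal (Real.sqrt ((n : ℝ) * ε ^ 2))) = 1 := by
      rw [← h0]
      have : (k : ℝ≥0∞) ≠ 0 := by simp; omega
      simp [ENNReal.div_zero this]
    rw [hz, mul_one, mul_one]
    constructor
    · have := OptMM.lower (k := k) (n := n) ε 1 hk hn hε hε1 zero_le_one le_rfl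
        (by rw [← h0]; simp)
      simpa using this
    · exact (OptMM.upper_trivial ε hk hε).trans (ENNReal.ofReal_le_ofReal (by norm_num))
  · have hs : 0 < Real.sqrt ((n : ℝ) * ε ^ 2) := Real.sqrt_pos.2 (by positivity)
    have hq : (k : ℝ≥0∞) / ENNReal.ofReal (Real.sqrt ((n : ℝ) * ε ^ 2))
        = ENNReal.ofReal (k / Real.sqrt ((n : ℝ) * ε ^ 2)) := by
      rw [ENNReal.ofReal_div_of_pos hs, ENNReal.ofReal_natCast]
    rw [hq, ← ENNReal.ofReal_one, ← ENNReal.ofReal_min, ← ENNReal.ofReal_mul (by norm_num),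
      ← ENNReal.ofReal_mul (by norm_num)]
    constructor
    · refine OptMM.lower ε _ hk hn hε hε1 (by positivity) (min_le_left _ _) ?_
      calc _ ≤ k / Real.sqrt ((n : ℝ) * ε ^ 2) * Real.sqrt ((n : ℝ) * ε ^ 2) := by
            gcongr; exact min_le_right _ _
        _ = k := div_mul_cancel₀ _ hs.ne'
    · rcases min_choice (1:ℝ) (k / Real.sqrt ((n : ℝ) * ε ^ 2)) with h | h
      · rw [h]
        exact (OptMM.upper_trivial ε hk hε).trans (ENNReal.ofReal_le_ofReal (by norm_num))
      · rw [h]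
        exact OptMM.upper ε hk hn hpos hε1
end

section
/- Fix an integer k ≥ 2, ε > 0, an integer n ≥ 1, and p ∈ S^k. Let X_1,…,X_n be drawn i.i.d. from p, let each Y_i be obtained by applying the k-RR mechanism independently to X_i, and let p̂ be the empirical estimator under k-RR. Then E ||p̂ − p||₂² = (1 − Σ_{i=1}^k p_i²)/n + ((k−1)/n) · (k + 2(e^ε − 1))/(e^ε − 1)². -/
/-- The `k`-ary randomized response mechanism with privacy parameter `ε`. -/
noncomputable def kRR (k : ℕ) (ε : ℝ) (x y : Fin k) : ℝ :=
  if y = x then Real.exp ε / ((k : ℝ) - 1 + Real.exp ε)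
  else 1 / ((k : ℝ) - 1 + Real.exp ε)

/-- Probability of observing the output sequence `y = (Y_1, …, Y_n)` when
`X_1, …, X_n` are i.i.d. from `p` and each `Y_i` is obtained by applying `k`-RR
independently to `X_i`. -/
noncomputable def kRRJointProb (k n : ℕ) (ε : ℝ) (p : Fin k → ℝ)
    (y : Fin n → Fin k) : ℝ :=
  ∏ i, ∑ x, p x * kRR k ε x (y i)

/-- The empirical estimator under `k`-RR: with `m̂_i` the empirical frequency of
symbol `i` among the outputs, `p̂_i = ((e^ε + k − 1) m̂_i − 1)/(e^ε − 1)`. -/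
noncomputable def kRREmpEst (k n : ℕ) (ε : ℝ) (y : Fin n → Fin k) (i : Fin k) : ℝ :=
  ((Real.exp ε + (k : ℝ) - 1) *
      (((Finset.univ.filter fun j => y j = i).card : ℝ) / n) - 1) /
    (Real.exp ε - 1)

theorem kRR_aux_moments {k : ℕ} (q f : Fin k → ℝ) (hq : ∑ a, q a = 1)
    (hf : ∑ a, q a * f a = 0) (n : ℕ) :
    (∑ y : Fin n → Fin k, ∏ j, q (y j)) = 1 ∧
    (∑ y : Fin n → Fin k, (∏ j, q (y j)) * ∑ j, f (y j)) = 0 ∧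
    (∑ y : Fin n → Fin k, (∏ j, q (y j)) * (∑ j, f (y j)) ^ 2) =
      n * ∑ a, q a * f a ^ 2 := by
  induction n with
  | zero => simp
  | succ n ih =>
    obtain ⟨h0, h1, h2⟩ := ih
    have key : ∀ g : (Fin (n + 1) → Fin k) → ℝ,
        ∑ y, g y = ∑ a : Fin k, ∑ y : Fin n → Fin k, g (Fin.cons a y) := by
      intro g
      rw [← (Fin.consEquiv (fun _ : Fin (n + 1) => Fin k)).sum_comp, Fintype.sum_prod_type]
      rfl
    refine ⟨?_, ?_, ?_⟩
    · rw [key]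
      simp only [Fin.prod_univ_succ, Fin.cons_zero, Fin.cons_succ, ← Finset.mul_sum, h0, mul_one,
        hq]
    · rw [key]
      simp only [Fin.prod_univ_succ, Fin.sum_univ_succ, Fin.cons_zero, Fin.cons_succ]
      have : ∀ a : Fin k, ∑ y : Fin n → Fin k,
          q a * (∏ j, q (y j)) * (f a + ∑ j, f (y j)) = q a * f a := by
        intro a
        calc _ = q a * f a * (∑ y : Fin n → Fin k, ∏ j, q (y j)) +
              q a * (∑ y : Fin n → Fin k, (∏ j, q (y j)) * ∑ j, f (y j)) := by
              rw [Finset.mul_sum, Finset.mul_sum, ← Finset.sum_add_distrib]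
              exact Finset.sum_congr rfl fun y _ => by ring
          _ = _ := by rw [h0, h1]; ring
      simp only [this, hf]
    · rw [key]
      simp only [Fin.prod_univ_succ, Fin.sum_univ_succ, Fin.cons_zero, Fin.cons_succ]
      have : ∀ a : Fin k, ∑ y : Fin n → Fin k,
          q a * (∏ j, q (y j)) * (f a + ∑ j, f (y j)) ^ 2 =
            q a * f a ^ 2 + q a * (n * ∑ a, q a * f a ^ 2) := by
        intro a
        calc _ = q a * f a ^ 2 * (∑ y : Fin n → Fin k, ∏ j, q (y j)) +
              2 * q a * f a * (∑ y : Fin n → Fin k, (∏ j, q (y j)) * ∑ j, f (y j)) +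
              q a * (∑ y : Fin n → Fin k, (∏ j, q (y j)) * (∑ j, f (y j)) ^ 2) := by
              rw [Finset.mul_sum, Finset.mul_sum, Finset.mul_sum, ← Finset.sum_add_distrib,
                ← Finset.sum_add_distrib]
              exact Finset.sum_congr rfl fun y _ => by ring
          _ = _ := by rw [h0, h1, h2]; ring
      simp only [this, Finset.sum_add_distrib, ← Finset.sum_mul, hq]
      push_cast
      ring

/-- The exact squared `ℓ2` risk of the empirical estimator under `k`-RR:
`E ‖p̂ − p‖₂² = (1 − Σ p_i²)/n + ((k−1)/n) · (k + 2(e^ε − 1))/(e^ε − 1)²`. -/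
theorem kRR_empirical_l2_risk (k n : ℕ) (hk : 2 ≤ k) (hn : 1 ≤ n) (ε : ℝ) (hε : 0 < ε)
    (p : Fin k → ℝ) (hp_nonneg : ∀ i, 0 ≤ p i) (hp_sum : ∑ i, p i = 1) :
    ∑ y : Fin n → Fin k,
        kRRJointProb k n ε p y * ∑ i, (kRREmpEst k n ε y i - p i) ^ 2 =
      (1 - ∑ i, p i ^ 2) / n +
        ((k : ℝ) - 1) / n *
          (((k : ℝ) + 2 * (Real.exp ε - 1)) / (Real.exp ε - 1) ^ 2) := by
  have hE : 0 < Real.exp ε - 1 := by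
    have := Real.add_one_lt_exp hε.ne'
    linarith
  have hk' : (2 : ℝ) ≤ k := by exact_mod_cast hk
  have hn' : (n : ℝ) ≠ 0 := by
    have : (1 : ℝ) ≤ n := by exact_mod_cast hn
    linarith
  unfold kRRJointProb kRREmpEst
  generalize hEe : Real.exp ε = E at *
  have hD : (k : ℝ) - 1 + E ≠ 0 := by linarith
  have hE' : E - 1 ≠ 0 := hE.ne'
  set q : Fin k → ℝ := fun a => (p a * (E - 1) + 1) / ((k : ℝ) - 1 + E) with hqdef
  have hqa : ∀ a, q a * ((k : ℝ) - 1 + E) = p a * (E - 1) + 1 := by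
    intro a
    simp only [hqdef]
    field_simp
  have hq : ∀ a, ∑ x, p x * kRR k ε x a = q a := by
    intro a
    have : ∀ x, p x * kRR k ε x a =
        p x * (1 / ((k : ℝ) - 1 + E)) +
          (if a = x then p x * ((E - 1) / ((k : ℝ) - 1 + E)) else 0) := by
      intro x
      unfold kRR
      rw [hEe]
      split_ifs <;> ring
    simp only [this, Finset.sum_add_distrib, ← Finset.sum_mul, hp_sum, Finset.sum_ite_eq,
      Finset.mem_univ, if_true, hqdef]
    ring
  simp only [hq]
  have hqs : ∑ a, q a = 1 := by
    simp only [hqdef, ← Finset.sum_div, Finset.sum_add_distrib, ← Finset.sum_mul, hp_sum]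
    simp only [Finset.sum_const, Finset.card_univ, Fintype.card_fin, nsmul_eq_mul]
    rw [div_eq_one_iff_eq hD]
    ring
  have hest : ∀ (y : Fin n → Fin k) (i : Fin k),
      ((E + (k : ℝ) - 1) * (((Finset.univ.filter fun j => y j = i).card : ℝ) / n) - 1) /
        (E - 1) - p i =
      ((k : ℝ) - 1 + E) / ((E - 1) * n) * ∑ j, ((if y j = i then (1 : ℝ) else 0) - q i) := by
    intro y i
    rw [Finset.sum_sub_distrib, Finset.sum_boole]
    simp only [Finset.sum_const, Finset.card_univ, Fintype.card_fin, nsmul_eq_mul, hqdef]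
    field_simp
    ring
  simp only [hest, mul_pow, Finset.mul_sum (Finset.univ : Finset (Fin k))]
  rw [Finset.sum_comm]
  have hvar : ∀ i : Fin k, ∑ a, q a * ((if a = i then (1 : ℝ) else 0) - q i) ^ 2 =
      q i - q i ^ 2 := by
    intro i
    have : ∀ a, q a * ((if a = i then (1 : ℝ) else 0) - q i) ^ 2 =
        (if a = i then q a * (1 - 2 * q i) else 0) + q a * q i ^ 2 := by
      intro a
      split_ifs <;> ring
    simp only [this, Finset.sum_add_distrib, ← Finset.sum_mul, hqs, Finset.sum_ite_eq',
      Finset.mem_univ, if_true]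
    ring
  have hmean : ∀ i : Fin k, ∑ a, q a * ((if a = i then (1 : ℝ) else 0) - q i) = 0 := by
    intro i
    simp [mul_sub, Finset.sum_sub_distrib, ← Finset.sum_mul, hqs]
  have hterm : ∀ i : Fin k, ∑ y : Fin n → Fin k, (∏ j, q (y j)) *
      ((((k : ℝ) - 1 + E) / ((E - 1) * n)) ^ 2 *
        (∑ j, ((if y j = i then (1 : ℝ) else 0) - q i)) ^ 2) =
      (((k : ℝ) - 1 + E) / ((E - 1) * n)) ^ 2 * (n * (q i - q i ^ 2)) := by
    intro i
    rw [← hvar i, ← (kRR_aux_moments q (fun a => (if a = i then (1 : ℝ) else 0) - q i) hqs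
      (hmean i) n).2.2, Finset.mul_sum]
    exact Finset.sum_congr rfl fun y _ => by ring
  have hq2 : ∑ i, q i ^ 2 =
      ((E - 1) ^ 2 * ∑ i, p i ^ 2 + 2 * (E - 1) + k) / ((k : ℝ) - 1 + E) ^ 2 := by
    have : ∀ i, q i ^ 2 = ((E - 1) ^ 2 * p i ^ 2 + 2 * (E - 1) * p i + 1) /
        ((k : ℝ) - 1 + E) ^ 2 := by
      intro i
      simp only [hqdef]
      rw [div_pow]
      congr 1
      ring
    simp only [this, ← Finset.sum_div, Finset.sum_add_distrib, ← Finset.mul_sum, hp_sum]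
    simp
  rw [Finset.sum_congr rfl fun i _ => hterm i]
  simp only [← Finset.mul_sum, Finset.sum_sub_distrib, hqs, hq2]
  field_simp
  ring
end

section
/- Fix an integer k ≥ 2, ε > 0, and p ∈ S^k. For each n, let X_1,…,X_n be drawn i.i.d. from p, let each Y_i be obtained by applying the k-RR mechanism independently to X_i, and let p̂ be the empirical estimator under k-RR. Then lim_{n→∞} E ||p̂ − p||₁ / b_n = 1, where b_n = Σ_{i=1}^k √( 2((e^ε − 1)p_i + 1)((e^ε − 1)(1 − p_i) + k − 1) / (π n (e^ε − 1)²) ). -/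
open MeasureTheory ProbabilityTheory Filter Topology
lemma aux_trunc (ρ : Measure ℝ) [IsProbabilityMeasure ρ] (C M : ℝ) (hM : 0 < M)
    (h2 : Integrable (fun x : ℝ => x ^ 2) ρ) (hC : ∫ x, x ^ 2 ∂ρ ≤ C) :
    |∫ x, |x| ∂ρ - ∫ x, min |x| M ∂ρ| ≤ C / M := by
  have hm : Integrable (fun x : ℝ => min |x| M) ρ := by
    refine (integrable_const M).mono' (by fun_prop) (ae_of_all _ fun x => ?_)
    rw [Real.norm_eq_abs, abs_of_nonneg (le_min (abs_nonneg _) hM.le)]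
    exact min_le_right _ _
  have h1 : Integrable (fun x : ℝ => |x|) ρ := by
    refine (h2.add (integrable_const 1)).mono' (by fun_prop) (ae_of_all _ fun x => ?_)
    simp only [Pi.add_apply, Real.norm_eq_abs, abs_abs]
    rw [← sq_abs x]; nlinarith [sq_nonneg (|x| - 1), abs_nonneg x]
  rw [← integral_sub h1 hm, abs_of_nonneg
    (integral_nonneg fun x => sub_nonneg.2 (min_le_left _ _))]
  calc ∫ x, (|x| - min |x| M) ∂ρ ≤ ∫ x, x ^ 2 / M ∂ρ := by
        refine integral_mono (h1.sub hm) (h2.div_const M) fun x => ?_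
        show |x| - min |x| M ≤ x ^ 2 / M
        rw [le_div_iff₀ hM, ← sq_abs x]
        rcases le_total |x| M with h | h
        · rw [min_eq_left h]; simp; positivity
        · rw [min_eq_right h]; nlinarith [abs_nonneg x, sq_nonneg (|x| - M)]
    _ = (∫ x, x ^ 2 ∂ρ) / M := integral_div _ _
    _ ≤ C / M := by gcongr

lemma aux_abs_tendsto (ρ : ℕ → ProbabilityMeasure ℝ) (ν : ProbabilityMeasure ℝ)
    (h : Tendsto ρ atTop (𝓝 ν)) (C : ℝ)
    (h2 : ∀ n, Integrable (fun x : ℝ => x ^ 2) (ρ n : Measure ℝ))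
    (hC : ∀ n, ∫ x, x ^ 2 ∂(ρ n : Measure ℝ) ≤ C)
    (h2' : Integrable (fun x : ℝ => x ^ 2) (ν : Measure ℝ))
    (hC' : ∫ x, x ^ 2 ∂(ν : Measure ℝ) ≤ C) :
    Tendsto (fun n => ∫ x, |x| ∂(ρ n : Measure ℝ)) atTop (𝓝 (∫ x, |x| ∂(ν : Measure ℝ))) := by
  have hC0 : 0 ≤ C := le_trans (integral_nonneg fun x => sq_nonneg x) hC'
  rw [Metric.tendsto_atTop]
  intro δ hδ
  set M : ℝ := 3 * (C + 1) / δ with hMdef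
  have hM : 0 < M := by positivity
  have hCM : C / M < δ / 3 := by
    rw [hMdef, div_div_eq_mul_div, div_lt_div_iff₀ (by positivity) (by norm_num)]
    nlinarith
  let f : BoundedContinuousFunction ℝ ℝ := BoundedContinuousFunction.ofNormedAddCommGroup
    (fun x => min |x| M) (by fun_prop) M (fun x => by
      rw [Real.norm_eq_abs, abs_of_nonneg (le_min (abs_nonneg _) hM.le)]
      exact min_le_right _ _)
  have hf := (ProbabilityMeasure.tendsto_iff_forall_integral_tendsto.1 h) f
  rw [Metric.tendsto_atTop] at hf
  obtain ⟨N, hN⟩ := hf (δ / 3) (by positivity)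
  refine ⟨N, fun n hn => ?_⟩
  have e1 := aux_trunc (ρ n) C M hM (h2 n) (hC n)
  have e2 := aux_trunc ν C M hM h2' hC'
  have e3 : |∫ x, min |x| M ∂(ρ n : Measure ℝ) - ∫ x, min |x| M ∂(ν : Measure ℝ)| < δ / 3 :=
    hN n hn
  rw [Real.dist_eq]
  rw [abs_lt] at *
  rw [abs_le] at e1 e2
  constructor <;> linarith [e1.1, e1.2, e2.1, e2.2, e3.1, e3.2]

lemma aux_gauss (v : NNReal) (hv : v ≠ 0) :
    ∫ x, |x| ∂(gaussianReal 0 v) = Real.sqrt (2 * v / Real.pi) := by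
  have hv' : (0:ℝ) < v := by positivity
  rw [integral_gaussianReal_eq_integral_smul hv]
  simp only [gaussianPDFReal, smul_eq_mul, sub_zero]
  have h1 := integral_comp_abs (f := fun x : ℝ => (√(2 * Real.pi * v))⁻¹ * Real.exp (-x ^ 2 / (2 * v)) * x)
  simp only [sq_abs] at h1
  rw [h1]
  have h2 := integral_rpow_mul_exp_neg_mul_rpow (p := 2) (q := 1) (b := 1 / (2 * v)) (by norm_num) (by norm_num) (by positivity)
  have h3 : ∫ x in Set.Ioi (0:ℝ), (√(2 * Real.pi * v))⁻¹ * Real.exp (-x ^ 2 / (2 * v)) * x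
     = (√(2 * Real.pi * v))⁻¹ * v := by
    simp only [mul_assoc]
    rw [integral_const_mul]
    congr 1
    calc _ = ∫ x in Set.Ioi (0:ℝ), x ^ (1:ℝ) * Real.exp (-(1 / (2 * v)) * x ^ (2:ℝ)) := by
          refine integral_congr_ae (ae_of_all _ fun x => ?_)
          simp only [Real.rpow_one, Real.rpow_two]
          rw [mul_comm]; congr 2; ring
      _ = v := by
          rw [h2]; norm_num [Real.rpow_neg_one]; ring
  rw [h3, eq_comm, Real.sqrt_eq_iff_eq_sq (by positivity) (by positivity), mul_pow, mul_pow, inv_pow,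
    Real.sq_sqrt (by positivity)]
  field_simp

lemma aux_iid {Ω : Type*} [MeasurableSpace Ω] (P : Measure Ω) [IsProbabilityMeasure P]
    (X : ℕ → Ω → ℝ) (hX : MemLp (X 0) 2 P) (hindep : iIndepFun X P)
    (hident : ∀ i, IdentDistrib (X i) (X 0) P P) (hv : 0 < Var[X 0; P]) :
    Tendsto (fun n : ℕ => ∫ ω, |(√(n:ℝ))⁻¹ * (∑ j ∈ Finset.range n, X j ω - n * P[X 0])| ∂P)
      atTop (𝓝 (√(2 * Var[X 0; P] / Real.pi))) := by
  set v := Var[X 0; P] with hvdef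
  have hY : HasLaw (id : ℝ → ℝ) (gaussianReal 0 v.toNNReal) (gaussianReal 0 v.toNNReal) := .id
  have hT := tendstoInDistribution_inv_sqrt_mul_sum_sub hY hX hindep hident
  have hXi : ∀ i, MemLp (X i) 2 P := fun i => (hident i).memLp_iff.2 hX
  set W : ℕ → Ω → ℝ := fun n ω => (√(n:ℝ))⁻¹ * (∑ j ∈ Finset.range n, X j ω - n * P[X 0]) with hW
  have hWm : ∀ n, AEMeasurable (W n) P := hT.forall_aemeasurable
  have hW2 : ∀ n, MemLp (W n) 2 P := fun n =>
    ((memLp_finsetSum _ fun j _ => hXi j).sub (memLp_const _)).const_mul _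
  have hWv : ∀ n, ∫ ω, W n ω ^ 2 ∂P ≤ v := by
    intro n
    have hs : MemLp (∑ j ∈ Finset.range n, X j) 2 P := memLp_finsetSum' _ fun j _ => hXi j
    have hvar : Var[∑ j ∈ Finset.range n, X j; P] = n * v := by
      rw [IndepFun.variance_sum (fun i _ => hXi i) (fun i _ j _ hij => hindep.indepFun hij),
        Finset.sum_congr rfl fun i _ => (hident i).variance_eq]
      simp [hvdef]
    have hmean : ∫ ω, (∑ j ∈ Finset.range n, X j) ω ∂P = (n:ℝ) * P[X 0] := by
      simp only [Finset.sum_apply]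
      rw [integral_finsetSum _ fun i _ => (hXi i).integrable (by norm_num),
        Finset.sum_congr rfl fun i _ => (hident i).integral_eq]
      simp
    rw [variance_eq_integral hs.aestronglyMeasurable.aemeasurable, hmean] at hvar
    simp only [Finset.sum_apply] at hvar
    have : ∀ ω, W n ω ^ 2 = (n:ℝ)⁻¹ * (∑ j ∈ Finset.range n, X j ω - n * P[X 0]) ^ 2 := by
      intro ω
      simp only [hW]
      rw [mul_pow, inv_pow, Real.sq_sqrt (by positivity)]
    simp_rw [this]
    rw [integral_const_mul, hvar]
    rcases Nat.eq_zero_or_pos n with rfl | hn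
    · simpa using hv.le
    · rw [inv_mul_cancel_left₀ (by positivity)]
  have hg2 : Integrable (fun x : ℝ => x ^ 2) (gaussianReal 0 v.toNNReal) :=
    (memLp_id_gaussianReal' 2 (by norm_num)).integrable_sq
  have hgv : ∫ x, x ^ 2 ∂(gaussianReal 0 v.toNNReal) = v := by
    have := variance_fun_id_gaussianReal (μ := 0) (v := v.toNNReal)
    rw [variance_eq_integral measurable_id'.aemeasurable] at this
    simpa [hv.le] using this
  have key := aux_abs_tendsto _ _ hT.tendsto v ?_ ?_ ?_ ?_
  · simp only [ProbabilityMeasure.coe_mk, Measure.map_id] at key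
    rw [aux_gauss _ (by simpa using hv), Real.coe_toNNReal _ hv.le] at key
    refine key.congr fun n => ?_
    rw [integral_map (hWm n) (by fun_prop)]
  · intro n
    simp only [ProbabilityMeasure.coe_mk]
    rw [integrable_map_measure (by fun_prop) (hWm n)]
    exact (hW2 n).integrable_sq
  · intro n
    simp only [ProbabilityMeasure.coe_mk]
    rw [integral_map (hWm n) (by fun_prop)]
    exact hWv n
  · simpa only [ProbabilityMeasure.coe_mk, Measure.map_id] using hg2
  · simp only [ProbabilityMeasure.coe_mk, Measure.map_id]
    exact hgv.le

lemma aux_core {k : ℕ} (Q : Fin k → ℝ) (hQ : ∀ i, 0 ≤ Q i) (hs : ∑ i, Q i = 1) (i : Fin k)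
    (h0 : 0 < Q i) (h1 : Q i < 1) :
    Tendsto (fun n : ℕ => √(n:ℝ) * ∑ y : Fin n → Fin k, (∏ j, Q (y j)) *
      |((Finset.univ.filter fun j => y j = i).card : ℝ) / n - Q i|) atTop
      (𝓝 (√(2 * (Q i * (1 - Q i)) / Real.pi))) := by
  let μ : Measure (Fin k) := (PMF.ofFintype (fun x => ENNReal.ofReal (Q x)) (by
    rw [← ENNReal.ofReal_sum_of_nonneg fun i _ => hQ i, hs, ENNReal.ofReal_one])).toMeasure
  have hμp : IsProbabilityMeasure μ := PMF.toMeasure.isProbabilityMeasure _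
  have hμ : ∀ x, μ.real {x} = Q x := by
    intro x
    rw [measureReal_def, PMF.toMeasure_apply_singleton _ _ (measurableSet_singleton x)]
    simp [hQ x]
  let P : Measure (ℕ → Fin k) := Measure.infinitePi (fun _ => μ)
  let g : Fin k → ℝ := fun x => if x = i then 1 else 0
  have hg : Measurable g := measurable_of_finite _
  let X : ℕ → (ℕ → Fin k) → ℝ := fun j ω => g (ω j)
  have hmp : ∀ j, MeasurePreserving (fun ω : ℕ → Fin k => ω j) P μ := fun j =>
    measurePreserving_eval_infinitePi _ j
  have hindep : iIndepFun X P := iIndepFun_infinitePi (X := fun _ => g) fun _ => hg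
  have hident : ∀ j, IdentDistrib (X j) (X 0) P P := fun j =>
    ⟨(hg.comp (hmp j).measurable).aemeasurable, (hg.comp (hmp 0).measurable).aemeasurable, by
      have : ∀ j, P.map (X j) = μ.map g := fun j => by
        rw [← (hmp j).map_eq, Measure.map_map hg (hmp j).measurable]; rfl
      rw [this, this]⟩
  have hint : ∀ f : Fin k → ℝ, ∫ ω, f (ω 0) ∂P = ∑ x, Q x * f x := by
    intro f
    have : ∫ ω, f (ω 0) ∂P = ∫ x, f x ∂μ := by
      rw [← (hmp 0).map_eq, integral_map (hmp 0).measurable.aemeasurable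
        (measurable_of_finite f).aestronglyMeasurable]
    rw [this, integral_fintype .of_finite]
    simp [hμ]
  have hX : MemLp (X 0) 2 P := by
    refine MemLp.of_bound (hident 0).aemeasurable_fst.aestronglyMeasurable 1 (ae_of_all _ fun ω => ?_)
    simp only [X, g]; split_ifs <;> simp
  have hmean : P[X 0] = Q i := by
    rw [show P[X 0] = ∫ ω, g (ω 0) ∂P from rfl, hint]
    simp [g]
  have hvar : Var[X 0; P] = Q i * (1 - Q i) := by
    rw [variance_eq_sub hX, hmean, show P[X 0 ^ 2] = ∫ ω, (fun x => g x ^ 2) (ω 0) ∂P from rfl, hint (fun x => g x ^ 2)]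
    simp [g]; ring
  have key := aux_iid P X hX hindep hident (by rw [hvar]; nlinarith)
  rw [hvar, hmean] at key
  refine key.congr fun n => ?_
  have hmap : P.map (fun ω (j : Fin n) => ω j) = Measure.pi (fun _ : Fin n => μ) := by
    have h1 : iIndepFun (fun (j : ℕ) (ω : ℕ → Fin k) => ω j) P :=
      iIndepFun_infinitePi (X := fun _ => id) fun _ => measurable_id
    have h2 := h1.precomp (g := fun j : Fin n => (j : ℕ)) Fin.val_injective
    have h2 := h2.map_fun_eq_pi_map fun j : Fin n => (hmp (j : ℕ)).measurable.aemeasurable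
    rw [h2]
    congr 1; ext1 j; exact (hmp j).map_eq
  have hm : Measurable (fun (ω : ℕ → Fin k) (j : Fin n) => ω j) := by fun_prop
  let F : (Fin n → Fin k) → ℝ := fun y => |(√(n:ℝ))⁻¹ * (∑ j, g (y j) - n * Q i)|
  have e1 : ∫ ω, |(√(n:ℝ))⁻¹ * (∑ j ∈ Finset.range n, X j ω - n * Q i)| ∂P
      = ∑ y : Fin n → Fin k, (∏ j, Q (y j)) * F y := by
    calc _ = ∫ ω, F (fun j : Fin n => ω j) ∂P := by
          refine integral_congr_ae (ae_of_all _ fun ω => ?_)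
          simp only [F, X]
          rw [← Fin.sum_univ_eq_sum_range (fun j => g (ω j))]
      _ = ∫ y, F y ∂(Measure.pi (fun _ : Fin n => μ)) := by
          rw [← hmap, integral_map hm.aemeasurable (measurable_of_finite F).aestronglyMeasurable]
      _ = _ := by
          rw [integral_fintype .of_finite]
          refine Finset.sum_congr rfl fun y _ => ?_
          rw [measureReal_def, Measure.pi_singleton, ENNReal.toReal_prod, smul_eq_mul]
          congr 1
          exact Finset.prod_congr rfl fun j _ => hμ (y j)
  rw [e1, Finset.mul_sum]
  refine Finset.sum_congr rfl fun y _ => ?_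
  rw [mul_left_comm]
  congr 1
  simp only [F, g, Finset.sum_boole]
  rcases Nat.eq_zero_or_pos n with rfl | hn
  · simp
  have hn' : (0:ℝ) < n := by positivity
  have hsq : √(n:ℝ) * √(n:ℝ) = n := Real.mul_self_sqrt hn'.le
  have hsp : 0 < √(n:ℝ) := Real.sqrt_pos.2 hn'
  rw [← abs_of_pos hsp, ← abs_mul, abs_of_pos hsp]
  congr 1
  field_simp
  rw [Real.sq_sqrt hn'.le]

/-- The asymptotic `ℓ1` risk of the empirical estimator under `k`-RR:
`E ‖p̂ − p‖₁ / b_n → 1` where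
`b_n = Σ_i √(2((e^ε−1)p_i+1)((e^ε−1)(1−p_i)+k−1)/(π n (e^ε−1)²))`. -/
theorem kRR_empirical_l1_risk_asymptotic (k : ℕ) (hk : 2 ≤ k) (ε : ℝ) (hε : 0 < ε)
    (p : Fin k → ℝ) (hp_nonneg : ∀ i, 0 ≤ p i) (hp_sum : ∑ i, p i = 1) :
    Filter.Tendsto
      (fun n : ℕ =>
        (∑ y : Fin n → Fin k,
            kRRJointProb k n ε p y * ∑ i, |kRREmpEst k n ε y i - p i|) /
          ∑ i, Real.sqrt
            (2 * ((Real.exp ε - 1) * p i + 1) *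
                ((Real.exp ε - 1) * (1 - p i) + (k : ℝ) - 1) /
              (Real.pi * n * (Real.exp ε - 1) ^ 2)))
      Filter.atTop (nhds 1) := by
  have hk2 : (2:ℝ) ≤ k := by exact_mod_cast hk
  have hE : 0 < Real.exp ε - 1 := by
    have := Real.one_lt_exp_iff.2 hε
    linarith
  set E := Real.exp ε with hEdef
  have hD : 0 < (k:ℝ) - 1 + E := by linarith
  have hp1 : ∀ i, p i ≤ 1 := fun i => hp_sum ▸
    Finset.single_le_sum (fun j _ => hp_nonneg j) (Finset.mem_univ i)
  let Q : Fin k → ℝ := fun y => ∑ x, p x * kRR k ε x y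
  have hQe : ∀ y, Q y = ((E - 1) * p y + 1) / ((k:ℝ) - 1 + E) := by
    intro y
    have : ∀ x, p x * kRR k ε x y
        = p x * (1 / ((k:ℝ) - 1 + E)) + (if y = x then p x * ((E - 1) / ((k:ℝ) - 1 + E)) else 0) := by
      intro x
      simp only [kRR]
      split_ifs <;> ring
    simp only [Q, this]
    rw [Finset.sum_add_distrib, ← Finset.sum_mul, hp_sum]
    simp only [Finset.sum_ite_eq, Finset.mem_univ, if_true]
    ring
  have hQpos : ∀ y, 0 < Q y := by
    intro y; rw [hQe]
    have := mul_nonneg hE.le (hp_nonneg y)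
    positivity
  have hQlt : ∀ y, Q y < 1 := by
    intro y; rw [hQe, div_lt_one hD]
    nlinarith [hp1 y]
  have hQs : ∑ y, Q y = 1 := by
    simp only [hQe]
    rw [← Finset.sum_div, Finset.sum_add_distrib, ← Finset.mul_sum, hp_sum]
    simp only [Finset.sum_const, Finset.card_univ, Fintype.card_fin, nsmul_eq_mul]
    rw [div_eq_one_iff_eq hD.ne']; ring
  set c : ℝ := ((k:ℝ) - 1 + E) / (E - 1) with hc
  have hcpos : 0 < c := by positivity
  let L : ℝ := ∑ i, c * √(2 * (Q i * (1 - Q i)) / Real.pi)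
  have hLpos : 0 < L := by
    refine Finset.sum_pos (fun i _ => ?_) ⟨⟨0, by omega⟩, Finset.mem_univ _⟩
    have := hQpos i
    have := sub_pos.2 (hQlt i)
    have := Real.pi_pos
    positivity
  have hT : Tendsto (fun n : ℕ => (∑ i, c * (√(n:ℝ) * ∑ y : Fin n → Fin k, (∏ j, Q (y j)) *
      |((Finset.univ.filter fun j => y j = i).card : ℝ) / n - Q i|)) / L) atTop (𝓝 (L / L)) :=
    (tendsto_finsetSum _ fun i _ => (aux_core Q (fun i => (hQpos i).le) hQs i (hQpos i)
      (hQlt i)).const_mul c).div_const L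
  rw [div_self hLpos.ne'] at hT
  refine hT.congr' ?_
  filter_upwards [eventually_gt_atTop 0] with n hn
  have hn' : (0:ℝ) < n := by exact_mod_cast hn
  have hsp : 0 < √(n:ℝ) := Real.sqrt_pos.2 hn'
  have hden : ∑ i, √(2 * ((E - 1) * p i + 1) * ((E - 1) * (1 - p i) + (k : ℝ) - 1) /
              (Real.pi * n * (E - 1) ^ 2)) = L / √(n:ℝ) := by
    simp only [L]
    rw [Finset.sum_div]
    refine Finset.sum_congr rfl fun i _ => ?_
    have hq := hQpos i
    have hq' := sub_pos.2 (hQlt i)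
    have hpi := Real.pi_pos
    rw [Real.sqrt_eq_iff_mul_self_eq_of_pos (by positivity)]
    have h1 : √(2 * (Q i * (1 - Q i)) / Real.pi) ^ 2 = 2 * (Q i * (1 - Q i)) / Real.pi :=
      Real.sq_sqrt (by positivity)
    have h2 : √(n:ℝ) ^ 2 = n := Real.sq_sqrt hn'.le
    rw [← sq, div_pow, mul_pow, h1, h2, hQe, hc]
    field_simp
    ring
  have hnum : ∑ y : Fin n → Fin k, kRRJointProb k n ε p y * ∑ i, |kRREmpEst k n ε y i - p i|
      = ∑ i, c * ∑ y : Fin n → Fin k, (∏ j, Q (y j)) *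
      |((Finset.univ.filter fun j => y j = i).card : ℝ) / n - Q i| := by
    simp only [Finset.mul_sum]
    rw [Finset.sum_comm]
    refine Finset.sum_congr rfl fun i _ => Finset.sum_congr rfl fun y _ => ?_
    rw [mul_left_comm]
    congr 1
    rw [← abs_of_pos hcpos, ← abs_mul]
    congr 1
    rw [hQe, hc]
    simp only [kRREmpEst, ← hEdef]
    field_simp
    ring
  rw [hnum, hden]
  simp only [mul_left_comm c]
  rw [← Finset.mul_sum]
  field_simp
end

section
/- Fix an integer k ≥ 2, ε > 0, an integer n ≥ 1, and any p ∈ S^k. With p̂ the empirical estimator under the k-RR mechanism from n i.i.d. samples of p, the squared ℓ2 risk is maximized at the uniform distribution: E ||p̂ − p||₂² ≤ (1 + k(k + 2(e^ε − 1))/(e^ε − 1)²) · (1 − 1/k)/n, with equality when p is the uniform distribution (1/k,…,1/k). -/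
lemma aux_step {k n : ℕ} (F : (Fin (n+1) → Fin k) → ℝ) :
    ∑ y : Fin (n+1) → Fin k, F y = ∑ a : Fin k, ∑ z : Fin n → Fin k, F (Fin.cons a z) := by
  rw [← (Fin.consEquiv (fun _ : Fin (n+1) => Fin k)).sum_comp, Fintype.sum_prod_type]
  rfl

lemma aux_one {k : ℕ} (m : Fin k → ℝ) (hm : ∑ i, m i = 1) (n : ℕ) :
    ∑ y : Fin n → Fin k, ∏ j, m (y j) = 1 := by
  induction n with
  | zero => simp
  | succ n ih =>
    rw [aux_step]
    simp only [Fin.prod_univ_succ, Fin.cons_zero, Fin.cons_succ, ← Finset.mul_sum, ih, mul_one, hm]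

lemma aux_lin {k : ℕ} (m f : Fin k → ℝ) (hm : ∑ i, m i = 1) (hf : ∑ i, m i * f i = 0) (n : ℕ) :
    ∑ y : Fin n → Fin k, (∏ j, m (y j)) * ∑ j, f (y j) = 0 := by
  induction n with
  | zero => simp
  | succ n ih =>
    rw [aux_step]
    have h : ∀ a : Fin k, ∑ z : Fin n → Fin k, (m a * ∏ j, m (z j)) * (f a + ∑ j, f (z j))
        = m a * f a := by
      intro a
      have : ∀ z : Fin n → Fin k, (m a * ∏ j, m (z j)) * (f a + ∑ j, f (z j))
        = m a * f a * (∏ j, m (z j)) + m a * ((∏ j, m (z j)) * ∑ j, f (z j)) := by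
        intro z; ring
      simp only [this, Finset.sum_add_distrib, ← Finset.mul_sum, ih, aux_one m hm n]
      ring
    simp only [Fin.prod_univ_succ, Fin.sum_univ_succ, Fin.cons_zero, Fin.cons_succ, h, hf]

lemma aux_sq {k : ℕ} (m f : Fin k → ℝ) (hm : ∑ i, m i = 1) (hf : ∑ i, m i * f i = 0) (n : ℕ) :
    ∑ y : Fin n → Fin k, (∏ j, m (y j)) * (∑ j, f (y j)) ^ 2 = n * ∑ i, m i * f i ^ 2 := by
  induction n with
  | zero => simp
  | succ n ih =>
    rw [aux_step]
    have h : ∀ a : Fin k, ∑ z : Fin n → Fin k, (m a * ∏ j, m (z j)) * (f a + ∑ j, f (z j)) ^ 2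
        = m a * f a ^ 2 + m a * (n * ∑ i, m i * f i ^ 2) := by
      intro a
      have : ∀ z : Fin n → Fin k, (m a * ∏ j, m (z j)) * (f a + ∑ j, f (z j)) ^ 2
        = m a * f a ^ 2 * (∏ j, m (z j)) + 2 * m a * f a * ((∏ j, m (z j)) * ∑ j, f (z j))
          + m a * ((∏ j, m (z j)) * (∑ j, f (z j)) ^ 2) := by
        intro z; ring
      simp only [this, Finset.sum_add_distrib, ← Finset.mul_sum, ih, aux_one m hm n,
        aux_lin m f hm hf n]
      ring
    simp only [Fin.prod_univ_succ, Fin.sum_univ_succ, Fin.cons_zero, Fin.cons_succ, h,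
      Finset.sum_add_distrib, ← Finset.sum_mul, hm]
    push_cast
    ring

lemma aux_var {k : ℕ} (m : Fin k → ℝ) (hm : ∑ i, m i = 1) (n : ℕ) (i : Fin k) :
    ∑ y : Fin n → Fin k, (∏ j, m (y j)) *
      (((Finset.univ.filter fun j => y j = i).card : ℝ) - n * m i) ^ 2
      = n * (m i - m i ^ 2) := by
  have h1 : ∑ a, m a * ((if a = i then (1:ℝ) else 0) - m i) = 0 := by
    simp [mul_sub, Finset.sum_sub_distrib, ← Finset.sum_mul, hm]
  have h2 : ∑ a, m a * ((if a = i then (1:ℝ) else 0) - m i) ^ 2 = m i - m i ^ 2 := by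
    have : ∀ a, m a * ((if a = i then (1:ℝ) else 0) - m i) ^ 2
        = (if a = i then m a * (1 - 2 * m i) else 0) + m a * m i ^ 2 := by
      intro a; split_ifs <;> ring
    simp only [this, Finset.sum_add_distrib, ← Finset.sum_mul, hm]
    simp
    ring
  have := aux_sq m (fun a => (if a = i then (1:ℝ) else 0) - m i) hm h1 n
  rw [h2] at this
  rw [← this]
  refine Finset.sum_congr rfl fun y _ => ?_
  simp [Finset.sum_sub_distrib]

lemma aux_risk (k n : ℕ) (hk : 2 ≤ k) (hn : 1 ≤ n)
    (ε : ℝ) (hε : 0 < ε) (p : Fin k → ℝ) (hp_sum : ∑ i, p i = 1) :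
    ∑ y : Fin n → Fin k,
        kRRJointProb k n ε p y * ∑ i, (kRREmpEst k n ε y i - p i) ^ 2 =
      (1 + (k : ℝ) * ((k : ℝ) + 2 * (Real.exp ε - 1)) / (Real.exp ε - 1) ^ 2) *
        ((1 - 1 / (k : ℝ)) / n) - (∑ i, (p i - 1 / k) ^ 2) / n := by
  have hE : 0 < Real.exp ε - 1 := by
    have := Real.add_one_lt_exp hε.ne'
    linarith
  have hk0 : (2:ℝ) ≤ k := by exact_mod_cast hk
  have hn0 : (1:ℝ) ≤ n := by exact_mod_cast hn
  obtain ⟨E, hEE⟩ : ∃ E, E = Real.exp ε - 1 := ⟨_, rfl⟩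
  have hexp : Real.exp ε = E + 1 := by linarith
  rw [← hEE] at hE
  obtain ⟨m, hmd⟩ : ∃ m : Fin k → ℝ, m = fun i => (p i * E + 1) / (E + k) := ⟨_, rfl⟩
  have hD : 0 < E + k := by linarith
  have hm : ∑ i, m i = 1 := by
    simp only [hmd, ← Finset.sum_div, Finset.sum_add_distrib, ← Finset.sum_mul, hp_sum]
    simp only [one_mul, Finset.sum_const, Finset.card_univ, Fintype.card_fin, nsmul_eq_mul, mul_one]
    exact div_self hD.ne'
  have hJ : ∀ y, kRRJointProb k n ε p y = ∏ j, m (y j) := by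
    intro y
    unfold kRRJointProb
    refine Finset.prod_congr rfl fun j _ => ?_
    have : ∀ x, p x * kRR k ε x (y j)
        = (if y j = x then p x * (E / (E + k)) else 0) + p x * (1 / (E + k)) := by
      intro x
      unfold kRR
      rw [hexp, show (k:ℝ) - 1 + (E + 1) = E + k by ring]
      split_ifs <;> ring
    simp only [this, Finset.sum_add_distrib, ← Finset.sum_mul, hp_sum, hmd]
    simp
    ring
  have hS : ∀ y, ∑ i, (kRREmpEst k n ε y i - p i) ^ 2 = ((E + k) / (E * n)) ^ 2 *
      ∑ i, (((Finset.univ.filter fun j => y j = i).card : ℝ) - n * m i) ^ 2 := by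
    intro y
    rw [Finset.mul_sum]
    refine Finset.sum_congr rfl fun i _ => ?_
    rw [← mul_pow]
    congr 1
    unfold kRREmpEst
    rw [hexp, hmd]
    have : E ≠ 0 := hE.ne'
    have : (n:ℝ) ≠ 0 := by linarith
    have : E + k ≠ 0 := hD.ne'
    rw [show E + 1 + (k:ℝ) - 1 = E + k by ring, show E + 1 - 1 = E by ring]
    field_simp
    ring
  have hmain : ∑ y : Fin n → Fin k,
        kRRJointProb k n ε p y * ∑ i, (kRREmpEst k n ε y i - p i) ^ 2
        = ((E + k) / (E * n)) ^ 2 * (n * (1 - ∑ i, m i ^ 2)) := by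
    simp only [hJ, hS]
    simp only [mul_left_comm _ (((E + k) / (E * n)) ^ 2)]
    rw [← Finset.mul_sum]
    congr 1
    simp only [Finset.mul_sum]
    rw [Finset.sum_comm]
    simp only [aux_var m hm n, ← Finset.mul_sum, Finset.sum_sub_distrib, hm]
  have hq : ∑ i, m i ^ 2 = (E ^ 2 * ∑ i, p i ^ 2 + 2 * E + k) / (E + k) ^ 2 := by
    have : ∀ i, m i ^ 2 = (E ^ 2 * p i ^ 2 + 2 * E * p i + 1) / (E + k) ^ 2 := by
      intro i; rw [hmd]; simp only [div_pow]; ring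
    simp only [this, ← Finset.sum_div, Finset.sum_add_distrib, ← Finset.mul_sum, hp_sum]
    simp
  have hr : ∑ i, (p i - 1 / (k:ℝ)) ^ 2 = ∑ i, p i ^ 2 - 1 / k := by
    have : ∀ i, (p i - 1 / (k:ℝ)) ^ 2 = p i ^ 2 - 2 / k * p i + (1 / k) ^ 2 := by
      intro i; ring
    simp only [this, Finset.sum_add_distrib, Finset.sum_sub_distrib, ← Finset.mul_sum, hp_sum]
    simp
    field_simp
    ring
  rw [hmain, hq, hr, hexp, show E + 1 - 1 = E by ring]
  have : E ≠ 0 := hE.ne'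
  have : (n:ℝ) ≠ 0 := by linarith
  have : (k:ℝ) ≠ 0 := by linarith
  have : E + k ≠ 0 := hD.ne'
  field_simp
  ring

/-- The squared `ℓ2` risk of the empirical estimator under `k`-RR is maximized at the
uniform distribution:
`E ‖p̂ − p‖₂² ≤ (1 + k(k + 2(e^ε − 1))/(e^ε − 1)²) · (1 − 1/k)/n`,
with equality when `p` is the uniform distribution `(1/k, …, 1/k)`. -/
theorem kRR_empirical_l2_risk_le_uniform (k n : ℕ) (hk : 2 ≤ k) (hn : 1 ≤ n)
    (ε : ℝ) (hε : 0 < ε)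
    (p : Fin k → ℝ) (hp_nonneg : ∀ i, 0 ≤ p i) (hp_sum : ∑ i, p i = 1) :
    (∑ y : Fin n → Fin k,
        kRRJointProb k n ε p y * ∑ i, (kRREmpEst k n ε y i - p i) ^ 2 ≤
      (1 + (k : ℝ) * ((k : ℝ) + 2 * (Real.exp ε - 1)) / (Real.exp ε - 1) ^ 2) *
        ((1 - 1 / (k : ℝ)) / n)) ∧
    (p = (fun _ => 1 / (k : ℝ)) →
      ∑ y : Fin n → Fin k,
          kRRJointProb k n ε p y * ∑ i, (kRREmpEst k n ε y i - p i) ^ 2 =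
        (1 + (k : ℝ) * ((k : ℝ) + 2 * (Real.exp ε - 1)) / (Real.exp ε - 1) ^ 2) *
          ((1 - 1 / (k : ℝ)) / n)) := by
  have h := aux_risk k n hk hn ε hε p hp_sum
  constructor
  · rw [h]
    have : (0:ℝ) ≤ (∑ i, (p i - 1 / (k:ℝ)) ^ 2) / (n:ℝ) := by positivity
    linarith
  · intro hp
    rw [h, hp]
    simp
end

section
/- Fix an integer k ≥ 2, ε > 0, an integer n ≥ 1, and p ∈ S^k. Let X_1,…,X_n be drawn i.i.d. from p, let each Y_i ∈ {0,1}^k be obtained by applying the k-RAPPOR mechanism independently to X_i, and let p̂ be the empirical estimator under k-RAPPOR. Then E ||p̂ − p||₂² = (1 − Σ_{i=1}^k p_i²)/n + k e^{ε/2}/(n (e^{ε/2} − 1)²). -/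
/-- Probability of observing `y = (Y_1, …, Y_n)` when `X_1, …, X_n` are i.i.d. from `p`
and each `Y_i ∈ {0,1}^k` is obtained by applying `k`-RAPPOR independently to `X_i`. -/
noncomputable def kRapporJointProb (k n : ℕ) (ε : ℝ) (p : Fin k → ℝ)
    (y : Fin n → Fin k → Bool) : ℝ :=
  ∏ i, ∑ x, p x * kRappor k ε x (y i)

/-- The empirical estimator under `k`-RAPPOR: with `T_j = Σ_i Y_i^{(j)}`,
`p̂_j = ((e^{ε/2}+1)/(e^{ε/2}−1)) T_j/n − 1/(e^{ε/2}−1)`. -/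
noncomputable def kRapporEmpEst (k n : ℕ) (ε : ℝ) (y : Fin n → Fin k → Bool)
    (j : Fin k) : ℝ :=
  ((Real.exp (ε / 2) + 1) / (Real.exp (ε / 2) - 1)) *
      ((∑ i, if y i j then (1 : ℝ) else 0) / n) -
    1 / (Real.exp (ε / 2) - 1)

theorem aux_single {ι α : Type*} [Fintype ι] [DecidableEq ι] [Fintype α]
    (h : ι → α → ℝ) (hh : ∀ l, ∑ a, h l a = 1) (j : ι) (g : α → ℝ) :
    ∑ b : ι → α, (∏ l, h l (b l)) * g (b j) = ∑ a, h j a * g a := by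
  have h1 : ∀ b : ι → α, (∏ l, h l (b l)) * g (b j) =
      ∏ l, (h l (b l) * (if l = j then g (b l) else 1)) := by
    intro b
    rw [Finset.prod_mul_distrib]
    simp
  simp_rw [h1]
  rw [← Fintype.prod_sum (fun l a => h l a * (if l = j then g a else 1))]
  rw [Finset.prod_eq_single j]
  · simp
  · intro l _ hl
    simp [hl, hh]
  · simp

theorem aux_pair {ι α : Type*} [Fintype ι] [DecidableEq ι] [Fintype α]
    (q f : α → ℝ) (hf : ∑ a, q a * f a = 0) (i j : ι) (hij : i ≠ j) :
    ∑ b : ι → α, (∏ l, q (b l)) * (f (b i) * f (b j)) = 0 := by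
  have h1 : ∀ b : ι → α, (∏ l, q (b l)) * (f (b i) * f (b j)) =
      ∏ l, (q (b l) * ((if l = i then f (b l) else 1) * (if l = j then f (b l) else 1))) := by
    intro b
    rw [Finset.prod_mul_distrib, Finset.prod_mul_distrib]
    simp
  simp_rw [h1]
  rw [← Fintype.prod_sum
    (fun l a => q a * ((if l = i then f a else 1) * (if l = j then f a else 1)))]
  apply Finset.prod_eq_zero (Finset.mem_univ i)
  simp [hij, hf]

theorem aux_sq_s12 {α : Type*} [Fintype α] (n : ℕ)
    (q f : α → ℝ) (hq : ∑ a, q a = 1) (hf : ∑ a, q a * f a = 0) :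
    ∑ b : Fin n → α, (∏ l, q (b l)) * (∑ i, f (b i)) ^ 2 = n * ∑ a, q a * f a ^ 2 := by
  simp_rw [pow_two, Finset.sum_mul_sum, Finset.mul_sum]
  rw [Finset.sum_comm]
  have : ∀ i : Fin n, ∑ b : Fin n → α, ∑ j, (∏ l, q (b l)) * (f (b i) * f (b j)) =
      ∑ a, q a * (f a * f a) := by
    intro i
    rw [Finset.sum_comm, Finset.sum_eq_single i]
    · exact aux_single (fun _ => q) (fun _ => hq) i (fun a => f a * f a)
    · intro j _ hj
      exact aux_pair q f hf i j hj.symm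
    · simp
  simp [this, Finset.mul_sum]

theorem aux_marg (k : ℕ) (ε : ℝ) (p : Fin k → ℝ) (hp_sum : ∑ i, p i = 1) (j : Fin k)
    (g : Bool → ℝ) :
    ∑ b : Fin k → Bool, (∑ x, p x * kRappor k ε x b) * g (b j) =
      p j * ((Real.exp (ε / 2) * g true + g false) / (1 + Real.exp (ε / 2))) +
      (1 - p j) * ((Real.exp (ε / 2) * g false + g true) / (1 + Real.exp (ε / 2))) := by
  have hE := Real.exp_pos (ε / 2)
  have h1 : ∀ x, ∑ b : Fin k → Bool, kRappor k ε x b * g (b j) =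
      (Real.exp (ε / 2) * g false + g true) / (1 + Real.exp (ε / 2)) +
      if j = x then (Real.exp (ε / 2) * g true + g false) / (1 + Real.exp (ε / 2)) -
        (Real.exp (ε / 2) * g false + g true) / (1 + Real.exp (ε / 2)) else 0 := by
    intro x
    unfold kRappor
    rw [aux_single (fun (l : Fin k) (a : Bool) => if a = decide (l = x) then
      Real.exp (ε / 2) / (1 + Real.exp (ε / 2)) else 1 / (1 + Real.exp (ε / 2)))]
    · by_cases h : j = x <;> simp [h] <;> ring
    · intro l
      by_cases h : l = x <;> simp [h] <;> field_simp <;> ring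
  simp_rw [Finset.sum_mul]
  rw [Finset.sum_comm]
  simp_rw [mul_assoc, ← Finset.mul_sum, h1, mul_add, Finset.sum_add_distrib, ← Finset.sum_mul,
    hp_sum]
  simp
  ring

/-- The exact squared `ℓ2` risk of the empirical estimator under `k`-RAPPOR:
`E ‖p̂ − p‖₂² = (1 − Σ p_i²)/n + k e^{ε/2}/(n (e^{ε/2} − 1)²)`. -/
theorem kRappor_empirical_l2_risk (k n : ℕ) (hk : 2 ≤ k) (hn : 1 ≤ n)
    (ε : ℝ) (hε : 0 < ε)
    (p : Fin k → ℝ) (hp_nonneg : ∀ i, 0 ≤ p i) (hp_sum : ∑ i, p i = 1) :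
    ∑ y : Fin n → Fin k → Bool,
        kRapporJointProb k n ε p y * ∑ j, (kRapporEmpEst k n ε y j - p j) ^ 2 =
      (1 - ∑ i, p i ^ 2) / n +
        (k : ℝ) * Real.exp (ε / 2) / (n * (Real.exp (ε / 2) - 1) ^ 2) := by
  have hE : 1 < Real.exp (ε / 2) := Real.one_lt_exp_iff.2 (by linarith)
  have hn0 : (n : ℝ) ≠ 0 := by positivity
  have hk0 : 0 < k := by omega
  have hE0 : Real.exp (ε / 2) - 1 ≠ 0 := by linarith
  have hE1 : 1 + Real.exp (ε / 2) ≠ 0 := by linarith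
  have hM := aux_marg k ε p hp_sum
  unfold kRapporJointProb kRapporEmpEst
  generalize Real.exp (ε / 2) = E at *
  set q : (Fin k → Bool) → ℝ := fun b => ∑ x, p x * kRappor k ε x b with hq
  have hq1 : ∑ b, q b = 1 := by
    have := hM ⟨0, hk0⟩ (fun _ => 1)
    simp only [mul_one] at this
    rw [this]
    field_simp
    ring
  let G : Fin k → Bool → ℝ := fun j c => (E + 1) / (E - 1) * (if c then 1 else 0) -
    1 / (E - 1) - p j
  have hG0 : ∀ j, ∑ b, q b * G j (b j) = 0 := by
    intro j
    rw [hM j (G j)]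
    simp only [G]
    simp
    field_simp
    ring
  have hG2 : ∀ j, ∑ b, q b * G j (b j) ^ 2 = p j - p j ^ 2 + E / (E - 1) ^ 2 := by
    intro j
    rw [hM j (fun c => G j c ^ 2)]
    simp only [G]
    simp
    field_simp
    ring
  have hest : ∀ (y : Fin n → Fin k → Bool) j,
      ((E + 1) / (E - 1) * ((∑ i, if y i j then (1 : ℝ) else 0) / n) - 1 / (E - 1) - p j) ^ 2 =
      (1 / (n : ℝ) ^ 2) * (∑ i, G j (y i j)) ^ 2 := by
    intro y j
    simp only [G, Finset.sum_sub_distrib, ← Finset.mul_sum, Finset.sum_const, Finset.card_univ,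
      Fintype.card_fin, nsmul_eq_mul]
    field_simp
  simp_rw [hest, Finset.mul_sum]
  rw [Finset.sum_comm]
  have key : ∀ j, ∑ y : Fin n → Fin k → Bool,
      (∏ i, q (y i)) * (1 / (n : ℝ) ^ 2 * (∑ i, G j (y i j)) ^ 2) =
      (p j - p j ^ 2 + E / (E - 1) ^ 2) / n := by
    intro j
    have := aux_sq_s12 n q (fun b => G j (b j)) hq1 (hG0 j)
    simp_rw [mul_left_comm _ (1 / (n : ℝ) ^ 2), ← Finset.mul_sum]
    rw [this, hG2]
    field_simp
  refine (Finset.sum_congr rfl fun j _ => key j).trans ?_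
  rw [← Finset.sum_div, Finset.sum_add_distrib, Finset.sum_sub_distrib, hp_sum]
  simp
  field_simp
end

section
/- Fix an integer k ≥ 2, ε > 0, and p ∈ S^k. For each n, let X_1,…,X_n be drawn i.i.d. from p, let each Y_i ∈ {0,1}^k be obtained by applying the k-RAPPOR mechanism independently to X_i, and let p̂ be the empirical estimator under k-RAPPOR. Then lim_{n→∞} E ||p̂ − p||₁ / b_n = 1, where b_n = Σ_{i=1}^k √( 2((e^{ε/2} − 1)p_i + 1)((e^{ε/2} − 1)(1 − p_i) + 1) / (π n (e^{ε/2} − 1)²) ). -/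
open MeasureTheory ProbabilityTheory Filter Topology

lemma trunc_bound (ν : Measure ℝ) [IsProbabilityMeasure ν] (hi : Integrable (fun x : ℝ => x ^ 2) ν)
    (h1 : ∫ x, x ^ 2 ∂ν ≤ 1) (M : ℝ) (hM : 0 < M) :
    |∫ x, |x| ∂ν - ∫ x, min |x| M ∂ν| ≤ 1 / M := by
  have hia : Integrable (fun x : ℝ => |x|) ν := by
    refine Integrable.mono' (hi.add (integrable_const 1)) (by fun_prop) (ae_of_all _ fun x => ?_)
    simp only [Real.norm_eq_abs, abs_abs, Pi.add_apply]
    nlinarith [sq_abs x, sq_nonneg (|x| - 1), abs_nonneg x]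
  have him : Integrable (fun x : ℝ => min |x| M) ν := by
    refine Integrable.mono' hia (by fun_prop) (ae_of_all _ fun x => ?_)
    rw [Real.norm_eq_abs, abs_of_nonneg (le_min (abs_nonneg x) hM.le)]
    exact min_le_left _ _
  rw [← integral_sub hia him, abs_of_nonneg (integral_nonneg fun x => by simp)]
  calc _ ≤ ∫ x, x ^ 2 / M ∂ν := by
        refine integral_mono (hia.sub him) (hi.div_const M) fun x => ?_
        simp only
        rw [le_div_iff₀ hM]
        rcases le_total |x| M with h | h
        · rw [min_eq_left h]; nlinarith [sq_nonneg x]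
        · rw [min_eq_right h, ← sq_abs]; nlinarith [sq_nonneg (|x| - M), abs_nonneg x]
    _ ≤ 1 / M := by rw [integral_div]; gcongr

lemma gauss_abs : ∫ x, |x| ∂(gaussianReal 0 1) = √(2 / Real.pi) := by
  rw [integral_gaussianReal_eq_integral_smul (by simp)]
  have h1 : ∀ x : ℝ, gaussianPDFReal 0 1 x • |x| =
      (fun y : ℝ => (√(2 * Real.pi))⁻¹ * (y ^ (1:ℝ) * Real.exp (-(1/2) * y ^ (2:ℝ)))) |x| := by
    intro x
    simp only [gaussianPDFReal, smul_eq_mul, Real.rpow_one, Real.rpow_ofNat, sq_abs]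
    simp
    ring_nf
  simp_rw [h1]
  rw [integral_comp_abs (f := fun y : ℝ => (√(2 * Real.pi))⁻¹ * (y ^ (1:ℝ) * Real.exp (-(1/2) * y ^ (2:ℝ)))),
    integral_const_mul, integral_rpow_mul_exp_neg_mul_rpow (by norm_num) (by norm_num) (by norm_num)]
  norm_num
  have := Real.pi_pos
  have h2 : √2 * √2 = 2 := Real.mul_self_sqrt (by norm_num)
  field_simp
  nlinarith

lemma gauss_sq : Integrable (fun x : ℝ => x ^ 2) (gaussianReal 0 1) ∧
    ∫ x, x ^ 2 ∂(gaussianReal 0 1) ≤ 1 := by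
  have hm : MemLp (fun x : ℝ => x) 2 (gaussianReal 0 1) := memLp_id_gaussianReal 2
  refine ⟨hm.integrable_sq, ?_⟩
  have h := variance_fun_id_gaussianReal (μ := 0) (v := 1)
  rw [variance_of_integral_eq_zero (by fun_prop) (by simp)] at h
  simpa using h.le

lemma tendsto_abs_of_dist {ν : ℕ → ProbabilityMeasure ℝ} {γ : ProbabilityMeasure ℝ}
    (h : Tendsto ν atTop (𝓝 γ))
    (hν : ∀ n, Integrable (fun x : ℝ => x ^ 2) (ν n : Measure ℝ) ∧ ∫ x, x ^ 2 ∂(ν n : Measure ℝ) ≤ 1)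
    (hγ : Integrable (fun x : ℝ => x ^ 2) (γ : Measure ℝ) ∧ ∫ x, x ^ 2 ∂(γ : Measure ℝ) ≤ 1) :
    Tendsto (fun n => ∫ x, |x| ∂(ν n : Measure ℝ)) atTop (𝓝 (∫ x, |x| ∂(γ : Measure ℝ))) := by
  rw [Metric.tendsto_atTop]
  intro e he
  set M : ℝ := 4 / e with hMdef
  have hM : 0 < M := by positivity
  let g : BoundedContinuousFunction ℝ ℝ :=
    BoundedContinuousFunction.ofNormedAddCommGroup (fun x => min |x| M) (by fun_prop) M (by
      intro x
      rw [Real.norm_eq_abs, abs_of_nonneg (le_min (abs_nonneg x) hM.le)]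
      exact min_le_right _ _)
  have hg := (ProbabilityMeasure.tendsto_iff_forall_integral_tendsto.1 h) g
  rw [Metric.tendsto_atTop] at hg
  obtain ⟨N, hN⟩ := hg (e / 2) (by positivity)
  refine ⟨N, fun n hn => ?_⟩
  have h1 := trunc_bound (ν n) (hν n).1 (hν n).2 M hM
  have h2 := trunc_bound γ hγ.1 hγ.2 M hM
  have h3 := hN n hn
  have hM' : 1 / M = e / 4 := by rw [hMdef]; field_simp
  rw [hM'] at h1 h2
  rw [Real.dist_eq] at h3 ⊢
  change |∫ x, min |x| M ∂(ν n : Measure ℝ) - ∫ x, min |x| M ∂(γ : Measure ℝ)| < e / 2 at h3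
  rw [abs_le] at h1 h2
  rw [abs_lt] at h3 ⊢
  constructor <;> linarith [h1.1, h1.2, h2.1, h2.2, h3.1, h3.2]

lemma finite_clt_abs {A : Type} [Fintype A] [MeasurableSpace A] [MeasurableSingletonClass A]
    (w : A → ℝ) (hw : ∀ a, 0 ≤ w a) (hw1 : ∑ a, w a = 1) (f : A → ℝ)
    (hf0 : ∑ a, w a * f a = 0) (hf1 : ∑ a, w a * f a ^ 2 = 1) :
    Tendsto (fun n : ℕ => ∑ y : Fin n → A, (∏ i, w (y i)) * |(√(n : ℝ))⁻¹ * ∑ i, f (y i)|)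
      atTop (𝓝 √(2 / Real.pi)) := by
  classical
  let q : PMF A := PMF.ofFintype (fun a => ENNReal.ofReal (w a)) (by
    rw [← ENNReal.ofReal_sum_of_nonneg (fun a _ => hw a), hw1, ENNReal.ofReal_one])
  have hq : ∀ a, (q a).toReal = w a := fun a => by
    simp [q, PMF.ofFintype_apply, ENNReal.toReal_ofReal (hw a)]
  let μ : Measure A := q.toMeasure
  have : IsProbabilityMeasure μ := by infer_instance
  have hint : ∀ g : A → ℝ, ∫ a, g a ∂μ = ∑ a, w a * g a := fun g => by
    simp only [μ, PMF.integral_eq_sum, hq, smul_eq_mul]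
  have hμr : ∀ a, μ.real {a} = w a := fun a => by
    simp [μ, Measure.real, hq]
  have hfm : Measurable f := measurable_of_finite f
  let P : Measure (ℕ → A) := Measure.infinitePi (fun _ => μ)
  have : IsProbabilityMeasure P := by infer_instance
  let X : ℕ → (ℕ → A) → ℝ := fun i ω => f (ω i)
  have hev : ∀ i, Measure.map (fun ω : ℕ → A => ω i) P = μ := fun i =>
    (measurePreserving_eval_infinitePi (fun _ : ℕ => μ) i).map_eq
  have hXm : ∀ i, Measurable (X i) := fun i => hfm.comp (measurable_pi_apply i)
  have hindep : iIndepFun X P := iIndepFun_infinitePi (X := fun _ => f) (fun _ => hfm)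
  have hXint : ∀ (g : A → ℝ) (i : ℕ), ∫ ω, g (ω i) ∂P = ∑ a, w a * g a := fun g i => by
    rw [← hint, ← hev i, integral_map (measurable_pi_apply i).aemeasurable (measurable_of_finite g).aestronglyMeasurable]
  have hident : ∀ i, IdentDistrib (X i) (X 0) P P := fun i =>
    IdentDistrib.comp (u := f) (f := fun ω : ℕ → A => ω i) (g := fun ω : ℕ → A => ω 0)
      ⟨(measurable_pi_apply i).aemeasurable, (measurable_pi_apply 0).aemeasurable, by rw [hev, hev]⟩ hfm
  have hmem : ∀ i, MemLp (X i) 2 P := fun i => by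
    refine MemLp.of_bound (hXm i).aestronglyMeasurable (∑ a, |f a|) (ae_of_all _ fun ω => ?_)
    exact Finset.single_le_sum (f := fun a => |f a|) (fun a _ => abs_nonneg _) (Finset.mem_univ (ω i))
  have hX0 : ∀ i, ∫ ω, X i ω ∂P = 0 := fun i => by rw [← hf0]; exact hXint f i
  have hX1 : ∀ i, ∫ ω, X i ω ^ 2 ∂P = 1 := fun i => by
    rw [← hf1]; exact hXint (fun a => f a ^ 2) i
  let Z : ℕ → (ℕ → A) → ℝ := fun n ω => (√(n : ℝ))⁻¹ * ∑ k ∈ Finset.range n, X k ω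
  have hclt := tendstoInDistribution_inv_sqrt_mul_sum (P := P) (X := X)
    (P' := gaussianReal 0 1) (Y := id) HasLaw.id (hX0 0) (hX1 0) hindep hident
  have hZm : ∀ n, Measurable (Z n) := fun n => by
    apply Measurable.const_mul
    exact Finset.measurable_fun_sum _ fun i _ => hXm i
  have hZmem : ∀ n, MemLp (Z n) 2 P := fun n =>
    (memLp_finsetSum _ fun i _ => hmem i).const_mul _
  have hZsq : ∀ n, ∫ ω, Z n ω ^ 2 ∂P ≤ 1 := fun n => by
    have hv : Var[∑ i ∈ Finset.range n, X i; P] = n := by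
      rw [IndepFun.variance_sum (fun i _ => hmem i) (fun i _ j _ hij => hindep.indepFun hij)]
      simp [fun i => variance_of_integral_eq_zero (hXm i).aemeasurable (hX0 i), hX1]
    have hs0 : ∫ ω, (∑ i ∈ Finset.range n, X i) ω ∂P = 0 := by
      simp only [Finset.sum_apply]
      rw [integral_finsetSum _ fun i _ => (hmem i).integrable (by norm_num)]
      simp [hX0]
    rw [variance_of_integral_eq_zero (Finset.aemeasurable_sum _ fun i _ => (hXm i).aemeasurable)
      hs0] at hv
    simp only [Finset.sum_apply] at hv
    simp only [Z, mul_pow]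
    rw [integral_const_mul, hv, inv_pow, Real.sq_sqrt (Nat.cast_nonneg n)]
    exact inv_mul_le_one
  have key := tendsto_abs_of_dist hclt.tendsto (fun n => by
      have hZn := (hZm n).aemeasurable (μ := P)
      simp only [ProbabilityMeasure.coe_mk]
      change Integrable _ (Measure.map (Z n) P) ∧ ∫ x, x ^ 2 ∂(Measure.map (Z n) P) ≤ 1
      rw [integrable_map_measure (by fun_prop) hZn, integral_map hZn (by fun_prop)]
      exact ⟨(hZmem n).integrable_sq, hZsq n⟩) (by
      simp only [ProbabilityMeasure.coe_mk, Measure.map_id]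
      exact gauss_sq)
  simp only [ProbabilityMeasure.coe_mk, Measure.map_id, gauss_abs] at key
  refine key.congr fun n => ?_
  have hZn := (hZm n).aemeasurable (μ := P)
  change ∫ x, |x| ∂(Measure.map (Z n) P) = _
  rw [integral_map hZn (by fun_prop)]
  have hmap : Measure.map (fun (ω : ℕ → A) (i : Fin n) => ω i) P = Measure.pi (fun _ => μ) := by
    have h1 : iIndepFun (fun (i : ℕ) (ω : ℕ → A) => ω i) P :=
      iIndepFun_infinitePi (X := fun _ => id) (fun _ => measurable_id)
    have h2 := h1.precomp (g := fun i : Fin n => (i : ℕ)) Fin.val_injective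
    rw [iIndepFun_iff_map_fun_eq_pi_map (fun i => (measurable_pi_apply _).aemeasurable)] at h2
    simpa only [hev] using h2
  have e1 : ∀ ω, |Z n ω| = (fun y : Fin n → A => |(√(n : ℝ))⁻¹ * ∑ i, f (y i)|) (fun i => ω i) := by
    intro ω
    simp only [Z, X, Finset.sum_range]
  simp_rw [e1]
  rw [← integral_map (φ := fun (ω : ℕ → A) (i : Fin n) => ω i)
    (f := fun y : Fin n → A => |(√(n : ℝ))⁻¹ * ∑ i, f (y i)|)
    (measurable_pi_lambda _ fun i => measurable_pi_apply _).aemeasurable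
    (measurable_of_finite _).aestronglyMeasurable, hmap, integral_fintype .of_finite]
  refine Finset.sum_congr rfl fun y _ => ?_
  rw [Measure.real, Measure.pi_singleton, ENNReal.toReal_prod, smul_eq_mul]
  congr 1
  exact Finset.prod_congr rfl fun i _ => hμr _

lemma kRappor_nonneg (k : ℕ) (ε : ℝ) (x : Fin k) (y : Fin k → Bool) : 0 ≤ kRappor k ε x y := by
  unfold kRappor
  refine Finset.prod_nonneg fun j _ => ?_
  split_ifs <;> positivity

lemma kRappor_sum (k : ℕ) (ε : ℝ) (x : Fin k) : ∑ y, kRappor k ε x y = 1 := by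
  unfold kRappor
  rw [← Fintype.prod_sum (fun (j : Fin k) (b : Bool) =>
    if b = decide (j = x) then Real.exp (ε / 2) / (1 + Real.exp (ε / 2))
    else 1 / (1 + Real.exp (ε / 2)))]
  refine Finset.prod_eq_one fun j _ => ?_
  have := Real.exp_pos (ε / 2)
  by_cases h : j = x <;> simp [h] <;> field_simp <;> ring

lemma kRappor_marg (k : ℕ) (ε : ℝ) (x j : Fin k) :
    ∑ y, kRappor k ε x y * (if y j then (1 : ℝ) else 0) =
      if j = x then Real.exp (ε / 2) / (1 + Real.exp (ε / 2)) else 1 / (1 + Real.exp (ε / 2)) := by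
  have hE := Real.exp_pos (ε / 2)
  have h1 : ∀ y : Fin k → Bool, kRappor k ε x y * (if y j then (1 : ℝ) else 0) =
      ∏ i, ((if y i = decide (i = x) then Real.exp (ε / 2) / (1 + Real.exp (ε / 2))
        else 1 / (1 + Real.exp (ε / 2))) * (if i = j then (if y i then (1 : ℝ) else 0) else 1)) := by
    intro y
    rw [Finset.prod_mul_distrib]
    simp [kRappor]
  simp_rw [h1]
  rw [← Fintype.prod_sum (fun (i : Fin k) (b : Bool) =>
    (if b = decide (i = x) then Real.exp (ε / 2) / (1 + Real.exp (ε / 2))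
    else 1 / (1 + Real.exp (ε / 2))) * (if i = j then (if b then (1 : ℝ) else 0) else 1))]
  rw [Finset.prod_eq_single j]
  · by_cases h : j = x <;> simp [h]
  · intro i _ hij
    by_cases h : i = x <;> simp [hij] <;> simp [h] <;> field_simp <;> ring
  · simp

/-- The asymptotic `ℓ1` risk of the empirical estimator under `k`-RAPPOR:
`E ‖p̂ − p‖₁ / b_n → 1` where
`b_n = Σ_i √(2((e^{ε/2}−1)p_i+1)((e^{ε/2}−1)(1−p_i)+1)/(π n (e^{ε/2}−1)²))`. -/
theorem kRappor_empirical_l1_risk_asymptotic (k : ℕ) (hk : 2 ≤ k) (ε : ℝ) (hε : 0 < ε)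
    (p : Fin k → ℝ) (hp_nonneg : ∀ i, 0 ≤ p i) (hp_sum : ∑ i, p i = 1) :
    Filter.Tendsto
      (fun n : ℕ =>
        (∑ y : Fin n → Fin k → Bool,
            kRapporJointProb k n ε p y * ∑ j, |kRapporEmpEst k n ε y j - p j|) /
          ∑ i, Real.sqrt
            (2 * ((Real.exp (ε / 2) - 1) * p i + 1) *
                ((Real.exp (ε / 2) - 1) * (1 - p i) + 1) /
              (Real.pi * n * (Real.exp (ε / 2) - 1) ^ 2)))
      Filter.atTop (nhds 1) := by
  
  set E := Real.exp (ε / 2) with hE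
  have hE1 : 1 < E := by rw [hE]; exact Real.one_lt_exp_iff.2 (by positivity)
  have hEm : 0 < E - 1 := by linarith
  have hEp : 0 < E + 1 := by linarith
  have hple : ∀ i, p i ≤ 1 := fun i => by
    rw [← hp_sum]; exact Finset.single_le_sum (fun i _ => hp_nonneg i) (Finset.mem_univ i)
  let w : (Fin k → Bool) → ℝ := fun a => ∑ x, p x * kRappor k ε x a
  have hw : ∀ a, 0 ≤ w a := fun a =>
    Finset.sum_nonneg fun x _ => mul_nonneg (hp_nonneg x) (kRappor_nonneg k ε x a)
  have hw1 : ∑ a, w a = 1 := by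
    simp only [w]
    rw [Finset.sum_comm]
    simp_rw [← Finset.mul_sum, kRappor_sum, mul_one, hp_sum]
  let q : Fin k → ℝ := fun j => ((E - 1) * p j + 1) / (E + 1)
  have hq : ∀ j, ∑ a, w a * (if a j then (1 : ℝ) else 0) = q j := by
    intro j
    simp only [w, Finset.sum_mul]
    rw [Finset.sum_comm]
    simp_rw [mul_assoc, ← Finset.mul_sum, kRappor_marg]
    rw [← hE]
    have h1 : ∀ x, p x * (if j = x then E / (1 + E) else 1 / (1 + E)) =
        p x * (1 / (1 + E)) + (if j = x then p x * ((E - 1) / (1 + E)) else 0) := by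
      intro x
      split_ifs
      · field_simp; ring
      · ring
    simp_rw [h1]
    rw [Finset.sum_add_distrib, ← Finset.sum_mul, hp_sum, Finset.sum_ite_eq]
    simp only [Finset.mem_univ, if_true, q]
    field_simp
    ring
  have hqpos : ∀ j, 0 < q j := fun j => by
    have := mul_nonneg hEm.le (hp_nonneg j)
    simp only [q]; positivity
  have hq1 : ∀ j, 1 - q j = ((E - 1) * (1 - p j) + 1) / (E + 1) := fun j => by
    simp only [q]; field_simp; ring
  have hqpos1 : ∀ j, 0 < 1 - q j := fun j => by
    have := mul_nonneg hEm.le (sub_nonneg.2 (hple j))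
    rw [hq1]; positivity
  let s : Fin k → ℝ := fun j => √(q j * (1 - q j))
  have hs : ∀ j, 0 < s j := fun j => Real.sqrt_pos.2 (mul_pos (hqpos j) (hqpos1 j))
  have hs2 : ∀ j, s j ^ 2 = q j * (1 - q j) := fun j =>
    Real.sq_sqrt (mul_pos (hqpos j) (hqpos1 j)).le
  let f : Fin k → (Fin k → Bool) → ℝ := fun j a => ((if a j then (1 : ℝ) else 0) - q j) / s j
  let G : Fin k → ℕ → ℝ := fun j n =>
    ∑ y : Fin n → Fin k → Bool, (∏ i, w (y i)) * |(√(n : ℝ))⁻¹ * ∑ i, f j (y i)|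
  have hG : ∀ j, Tendsto (G j) atTop (𝓝 √(2 / Real.pi)) := fun j => by
    refine finite_clt_abs w hw hw1 (f j) ?_ ?_
    · have h1 : ∀ a, w a * f j a =
          (w a * (if a j then (1 : ℝ) else 0)) / s j - w a * (q j / s j) := by
        intro a; simp only [f]; ring
      simp_rw [h1]
      rw [Finset.sum_sub_distrib, ← Finset.sum_div, ← Finset.sum_mul, hq, hw1]
      ring
    · have h1 : ∀ a, w a * f j a ^ 2 =
          (w a * (if a j then (1 : ℝ) else 0)) * ((1 - 2 * q j) / s j ^ 2)
            + w a * (q j ^ 2 / s j ^ 2) := by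
        intro a; simp only [f]
        split_ifs <;> ring
      simp_rw [h1]
      rw [Finset.sum_add_distrib, ← Finset.sum_mul, ← Finset.sum_mul, hq, hw1, hs2]
      have h2 := (hqpos j).ne'
      have h3 := (hqpos1 j).ne'
      field_simp
      ring
  let c : Fin k → ℝ := fun j => (E + 1) / (E - 1) * s j
  have hc : ∀ j, 0 < c j := fun j => mul_pos (div_pos hEp hEm) (hs j)
  have hpi : 0 < √(2 / Real.pi) := Real.sqrt_pos.2 (by positivity)
  have hne : (Finset.univ : Finset (Fin k)).Nonempty := ⟨⟨0, by omega⟩, Finset.mem_univ _⟩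
  have hD : 0 < ∑ j, c j * √(2 / Real.pi) :=
    Finset.sum_pos (fun j _ => mul_pos (hc j) hpi) hne
  have hlim : Tendsto (fun n => (∑ j, c j * G j n) / ∑ j, c j * √(2 / Real.pi)) atTop (𝓝 1) := by
    rw [← div_self hD.ne']
    exact (tendsto_finsetSum _ fun j _ => (hG j).const_mul (c j)).div_const _
  refine hlim.congr' ?_
  filter_upwards [eventually_gt_atTop 0] with n hn
  have hn' : (0 : ℝ) < n := Nat.cast_pos.2 hn
  have hsn : 0 < √(n : ℝ) := Real.sqrt_pos.2 hn'
  have hnn : √(n : ℝ) ^ 2 = n := Real.sq_sqrt hn'.le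
  have hden : ∀ i, √(2 * ((E - 1) * p i + 1) * ((E - 1) * (1 - p i) + 1) /
      (Real.pi * n * (E - 1) ^ 2)) = (√(n : ℝ))⁻¹ * (c i * √(2 / Real.pi)) := by
    intro i
    have h0 : 0 ≤ (√(n : ℝ))⁻¹ * (c i * √(2 / Real.pi)) :=
      mul_nonneg (inv_nonneg.2 hsn.le) (mul_nonneg (hc i).le hpi.le)
    rw [← Real.sqrt_sq h0]
    congr 1
    rw [mul_pow, mul_pow, inv_pow, hnn, Real.sq_sqrt (by positivity)]
    simp only [c]
    rw [mul_pow, hs2, hq1]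
    simp only [q]
    have := Real.pi_pos
    field_simp
  have hnum : ∑ y : Fin n → Fin k → Bool,
      kRapporJointProb k n ε p y * ∑ j, |kRapporEmpEst k n ε y j - p j| =
      (√(n : ℝ))⁻¹ * ∑ j, c j * G j n := by
    simp only [G]
    simp_rw [Finset.mul_sum]
    rw [Finset.sum_comm]
    refine Finset.sum_congr rfl fun j _ => Finset.sum_congr rfl fun y _ => ?_
    have h1 : kRapporEmpEst k n ε y j - p j =
        (√(n : ℝ))⁻¹ * (c j * ((√(n : ℝ))⁻¹ * ∑ i, f j (y i))) := by
      simp only [f, kRapporEmpEst, c]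
      rw [← Finset.sum_div, Finset.sum_sub_distrib, ← hE]
      simp only [Finset.sum_const, Finset.card_univ, Fintype.card_fin, nsmul_eq_mul]
      generalize (∑ i, if y i j then (1 : ℝ) else 0) = T
      have := (hs j).ne'
      have e : (√(n : ℝ))⁻¹ * ((E + 1) / (E - 1) * s j * ((√(n : ℝ))⁻¹ * ((T - n * q j) / s j))) =
          (E + 1) / (E - 1) * ((T - n * q j) / √(n : ℝ) ^ 2) := by
        field_simp
      rw [e, hnn]
      simp only [q]
      field_simp
      ring
    have h2 : kRapporJointProb k n ε p y = ∏ i, w (y i) := rfl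
    rw [← Finset.mul_sum, h1, h2, abs_mul, abs_mul (c j), abs_of_pos (inv_pos.2 hsn),
      abs_of_pos (hc j)]
    ring
  rw [hnum]
  simp_rw [hden]
  rw [← Finset.mul_sum, mul_div_mul_left _ _ (inv_pos.2 hsn).ne']
end

section
/- Fix an integer k ≥ 2, an integer n ≥ 1, and ε ≥ ln k. For every p ∈ S^k, the empirical estimator p̂_KRR under the k-RR mechanism has squared ℓ2 risk at most that of the empirical estimator p̂_RAPPOR under the k-RAPPOR mechanism (both from n i.i.d. samples of p): E ||p̂_KRR − p||₂² ≤ E ||p̂_RAPPOR − p||₂². Equivalently, (k−1)·(2/(e^ε−1) + k/(e^ε−1)²) ≤ k e^{ε/2}/(e^{ε/2}−1)². -/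
lemma aux_moments {α : Type*} [Fintype α] (P g : α → ℝ) (v : ℝ) (hP : ∑ a, P a = 1)
    (hg : ∑ a, P a * g a = 0) (hv : ∑ a, P a * g a ^ 2 = v) (n : ℕ) :
    (∑ y : Fin n → α, ∏ i, P (y i) = 1) ∧
    (∑ y : Fin n → α, (∏ i, P (y i)) * ∑ i, g (y i) = 0) ∧
    (∑ y : Fin n → α, (∏ i, P (y i)) * (∑ i, g (y i)) ^ 2 = n * v) := by
  induction n with
  | zero => simp
  | succ n ih =>
    obtain ⟨h0, h1, h2⟩ := ih
    have key : ∀ F : (Fin (n+1) → α) → ℝ, ∑ y, F y =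
        ∑ a : α, ∑ z : Fin n → α, F (Fin.cons a z) := by
      intro F
      rw [← Fintype.sum_prod_type' (f := fun (a : α) (z : Fin n → α) => F (Fin.cons a z))]
      exact (Equiv.sum_comp (Fin.consEquiv (fun _ => α)) F).symm
    refine ⟨?_, ?_, ?_⟩
    · rw [key]
      simp only [Fin.prod_univ_succ, Fin.cons_zero, Fin.cons_succ]
      simp_rw [← Finset.mul_sum, h0]
      simpa using hP
    · rw [key]
      simp only [Fin.prod_univ_succ, Fin.sum_univ_succ, Fin.cons_zero, Fin.cons_succ]
      have : ∀ a : α, ∑ z : Fin n → α, P a * (∏ i, P (z i)) * (g a + ∑ i, g (z i))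
          = P a * g a := by
        intro a
        calc _ = P a * g a * (∑ z : Fin n → α, ∏ i, P (z i)) +
              P a * ∑ z : Fin n → α, (∏ i, P (z i)) * ∑ i, g (z i) := by
              rw [Finset.mul_sum, Finset.mul_sum, ← Finset.sum_add_distrib]
              refine Finset.sum_congr rfl fun z _ => by ring
          _ = _ := by rw [h0, h1]; ring
      simp_rw [this, hg]
    · rw [key]
      simp only [Fin.prod_univ_succ, Fin.sum_univ_succ, Fin.cons_zero, Fin.cons_succ]
      have : ∀ a : α, ∑ z : Fin n → α, P a * (∏ i, P (z i)) * (g a + ∑ i, g (z i)) ^ 2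
          = P a * g a ^ 2 + P a * (n * v) := by
        intro a
        calc _ = P a * g a ^ 2 * (∑ z : Fin n → α, ∏ i, P (z i)) +
              2 * P a * g a * (∑ z : Fin n → α, (∏ i, P (z i)) * ∑ i, g (z i)) +
              P a * ∑ z : Fin n → α, (∏ i, P (z i)) * (∑ i, g (z i)) ^ 2 := by
              rw [Finset.mul_sum, Finset.mul_sum, Finset.mul_sum, ← Finset.sum_add_distrib,
                ← Finset.sum_add_distrib]
              refine Finset.sum_congr rfl fun z _ => by ring
          _ = _ := by rw [h0, h1, h2]; ring
      simp_rw [this, Finset.sum_add_distrib, ← Finset.sum_mul, hP, hv]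
      push_cast; ring

lemma aux_risk_s14 {α : Type*} [Fintype α] (P A : α → ℝ) (a b q r : ℝ) (hP : ∑ x, P x = 1)
    (hA : ∀ x, A x ^ 2 = A x) (hq : ∑ x, P x * A x = q) (hr : a * q - b = r)
    (n : ℕ) (hn : 1 ≤ n) :
    ∑ y : Fin n → α, (∏ i, P (y i)) * (a * ((∑ i, A (y i)) / n) - b - r) ^ 2
      = a ^ 2 * (q * (1 - q)) / n := by
  have hn' : (n : ℝ) ≠ 0 := by positivity
  have h := (aux_moments P (fun x => A x - q) (q * (1 - q)) hP
    (by simp_rw [mul_sub, Finset.sum_sub_distrib, ← Finset.sum_mul, hP, hq]; ring)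
    (by
      have : ∀ x, P x * (A x - q) ^ 2 = (1 - 2 * q) * (P x * A x) + q ^ 2 * P x := by
        intro x
        linear_combination P x * hA x
      simp_rw [this, Finset.sum_add_distrib, ← Finset.mul_sum, hP, hq]; ring) n).2.2
  have e : ∀ y : Fin n → α, (∏ i, P (y i)) * (a * ((∑ i, A (y i)) / n) - b - r) ^ 2
      = (a / n) ^ 2 * ((∏ i, P (y i)) * (∑ i, (A (y i) - q)) ^ 2) := by
    intro y
    simp only [Finset.sum_sub_distrib, Finset.sum_const, Finset.card_univ, Fintype.card_fin,
      nsmul_eq_mul]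
    subst hr
    field_simp
    ring
  simp_rw [e, ← Finset.mul_sum, h]
  field_simp

lemma aux_kRR (k n : ℕ) (hk : 2 ≤ k) (hn : 1 ≤ n) (ε : ℝ) (hE : 1 < Real.exp ε)
    (p : Fin k → ℝ) (hp : ∑ i, p i = 1) :
    ∑ y : Fin n → Fin k, kRRJointProb k n ε p y * ∑ i, (kRREmpEst k n ε y i - p i) ^ 2
     = (1 - ∑ i, p i ^ 2 +
      ((k : ℝ) - 1) * (2 / (Real.exp ε - 1) + (k : ℝ) / (Real.exp ε - 1) ^ 2)) / n := by
  have hk' : (2 : ℝ) ≤ k := by exact_mod_cast hk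
  unfold kRRJointProb kRREmpEst
  generalize hEE : Real.exp ε = E at *
  have hE1 : E - 1 ≠ 0 := by linarith
  have hD : (k : ℝ) - 1 + E ≠ 0 := by linarith
  have hD' : E + (k : ℝ) - 1 ≠ 0 := by linarith
  have hn' : (n : ℝ) ≠ 0 := by positivity
  have hm : ∀ y, ∑ x, p x * kRR k ε x y = (p y * (E - 1) + 1) / (E + k - 1) := by
    intro y
    have : ∀ x, p x * kRR k ε x y =
        p x * (1 / (E + k - 1)) + (if y = x then p x * ((E - 1) / (E + k - 1)) else 0) := by
      intro x
      unfold kRR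
      rw [hEE, show (k : ℝ) - 1 + E = E + k - 1 by ring]
      split_ifs
      · field_simp; ring
      · ring
    simp_rw [this, Finset.sum_add_distrib, ← Finset.sum_mul, hp]
    simp
    field_simp
    ring
  simp_rw [hm, Finset.mul_sum]
  rw [Finset.sum_comm]
  have hPs : ∑ y, (p y * (E - 1) + 1) / (E + k - 1) = 1 := by
    rw [← Finset.sum_div, Finset.sum_add_distrib, ← Finset.sum_mul, hp]
    simp
    field_simp
    ring
  have hi : ∀ i : Fin k, ∑ y : Fin n → Fin k,
      (∏ j, (p (y j) * (E - 1) + 1) / (E + k - 1)) *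
      (((E + k - 1) * (((Finset.univ.filter fun j => y j = i).card : ℝ) / n) - 1) / (E - 1)
        - p i) ^ 2 = (p i * ((E + k - 3) / (E - 1)) - p i ^ 2 + (E + k - 2) / (E - 1) ^ 2)/n := by
    intro i
    have := aux_risk_s14 (fun y => (p y * (E - 1) + 1) / (E + k - 1))
      (fun y => if y = i then (1 : ℝ) else 0) ((E + k - 1) / (E - 1)) (1 / (E - 1))
      ((p i * (E - 1) + 1) / (E + k - 1)) (p i) hPs (by intro x; split_ifs <;> simp)
      (by simp) (by field_simp; ring) n hn
    calc _ = _ := ?_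
      _ = _ := this
      _ = _ := ?_
    · refine Finset.sum_congr rfl fun y _ => ?_
      simp only [Finset.sum_boole]
      congr 2
      ring
    · field_simp
      ring
  simp_rw [hi]
  rw [← Finset.sum_div, Finset.sum_add_distrib, Finset.sum_sub_distrib, ← Finset.sum_mul, hp]
  simp
  field_simp
  ring

lemma aux_rappor_prod (k : ℕ) (F : Fin k → Bool → ℝ) :
    ∑ y : Fin k → Bool, ∏ l, F l (y l) = ∏ l, (F l true + F l false) := by
  have := Finset.prod_univ_sum (fun _ : Fin k => (Finset.univ : Finset Bool)) F
  rw [Fintype.piFinset_univ] at this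
  rw [← this]
  simp

lemma aux_rappor (k n : ℕ) (hn : 1 ≤ n) (ε : ℝ) (hE : 1 < Real.exp (ε / 2))
    (p : Fin k → ℝ) (hp : ∑ i, p i = 1) :
    ∑ y : Fin n → Fin k → Bool,
          kRapporJointProb k n ε p y * ∑ j, (kRapporEmpEst k n ε y j - p j) ^ 2
     = (1 - ∑ i, p i ^ 2 +
      (k : ℝ) * Real.exp (ε / 2) / (Real.exp (ε / 2) - 1) ^ 2) / n := by
  have hs1 : ∀ x, ∑ y, kRappor k ε x y = 1 := by
    intro x
    unfold kRappor
    rw [aux_rappor_prod k (fun l b => if b = decide (l = x) then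
      Real.exp (ε / 2) / (1 + Real.exp (ε / 2)) else 1 / (1 + Real.exp (ε / 2)))]
    refine Finset.prod_eq_one fun l _ => ?_
    by_cases h : l = x <;> simp [h] <;> field_simp <;> ring
  have hs2 : ∀ x j, ∑ y, kRappor k ε x y * (if y j then (1 : ℝ) else 0) =
      if j = x then Real.exp (ε / 2) / (1 + Real.exp (ε / 2))
      else 1 / (1 + Real.exp (ε / 2)) := by
    intro x j
    unfold kRappor
    have : ∀ y : Fin k → Bool, (if y j then (1 : ℝ) else 0) =
        ∏ l, if l = j then (if y l then (1 : ℝ) else 0) else 1 := by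
      intro y; simp [Finset.prod_ite_eq']
    simp_rw [this, ← Finset.prod_mul_distrib]
    rw [aux_rappor_prod k (fun l b => (if b = decide (l = x) then
      Real.exp (ε / 2) / (1 + Real.exp (ε / 2)) else 1 / (1 + Real.exp (ε / 2))) *
      (if l = j then (if b then (1 : ℝ) else 0) else 1))]
    rw [Finset.prod_eq_single j]
    · by_cases h : j = x <;> simp [h]
    · intro l _ hl
      by_cases h : l = x <;> simp [hl, h]
      · subst h; simp [hl]; field_simp; try ring
      · field_simp; try ring
    · simp
  unfold kRapporJointProb kRapporEmpEst
  generalize hEE : Real.exp (ε / 2) = E at *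
  have hE1 : E - 1 ≠ 0 := by linarith
  have hD : 1 + E ≠ 0 := by linarith
  have hD' : E + 1 ≠ 0 := by linarith
  have hn' : (n : ℝ) ≠ 0 := by positivity
  have hPs : ∑ y, ∑ x, p x * kRappor k ε x y = 1 := by
    rw [Finset.sum_comm]
    simp_rw [← Finset.mul_sum, hs1]
    simpa using hp
  have hq : ∀ j, ∑ y, (∑ x, p x * kRappor k ε x y) * (if y j then (1 : ℝ) else 0) =
      (p j * (E - 1) + 1) / (E + 1) := by
    intro j
    simp_rw [Finset.sum_mul]
    rw [Finset.sum_comm]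
    simp_rw [mul_assoc, ← Finset.mul_sum, hs2]
    have : ∀ x, p x * (if j = x then E / (1 + E) else 1 / (1 + E)) =
        p x * (1 / (E + 1)) + (if j = x then p x * ((E - 1) / (E + 1)) else 0) := by
      intro x
      rw [show 1 + E = E + 1 by ring]
      split_ifs
      · field_simp; ring
      · ring
    simp_rw [this, Finset.sum_add_distrib, ← Finset.sum_mul, hp]
    simp
    field_simp
    ring
  simp_rw [Finset.mul_sum]
  rw [Finset.sum_comm]
  have hi : ∀ j : Fin k, ∑ y : Fin n → Fin k → Bool,
      (∏ i, ∑ x, p x * kRappor k ε x (y i)) *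
      (((E + 1) / (E - 1)) * ((∑ i, if y i j then (1 : ℝ) else 0) / n) - 1 / (E - 1)
        - p j) ^ 2 = (p j - p j ^ 2 + E / (E - 1) ^ 2)/n := by
    intro j
    rw [aux_risk_s14 (fun y => ∑ x, p x * kRappor k ε x y)
      (fun y => if y j then (1 : ℝ) else 0) ((E + 1) / (E - 1)) (1 / (E - 1))
      ((p j * (E - 1) + 1) / (E + 1)) (p j) hPs (by intro x; split_ifs <;> simp)
      (hq j) (by field_simp; ring) n hn]
    field_simp
    ring
  simp_rw [hi]
  rw [← Finset.sum_div, Finset.sum_add_distrib, Finset.sum_sub_distrib, hp]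
  simp
  field_simp

lemma aux_ineq (k : ℕ) (hk : 2 ≤ k) (ε : ℝ) (hε : Real.log k ≤ ε) :
    1 < Real.exp ε ∧ 1 < Real.exp (ε / 2) ∧
    ((k : ℝ) - 1) * (2 / (Real.exp ε - 1) + (k : ℝ) / (Real.exp ε - 1) ^ 2) ≤
      (k : ℝ) * Real.exp (ε / 2) / (Real.exp (ε / 2) - 1) ^ 2 := by
  have hk' : (2 : ℝ) ≤ k := by exact_mod_cast hk
  have h1 : (k : ℝ) ≤ Real.exp ε := (Real.log_le_iff_le_exp (by linarith)).1 hε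
  have h2 : Real.exp ε = Real.exp (ε / 2) ^ 2 := by
    rw [← Real.exp_nat_mul]; congr 1; push_cast; ring
  have h3 := Real.exp_pos (ε / 2)
  generalize Real.exp (ε / 2) = s at *
  rw [h2] at h1 ⊢
  have hs : 1 < s := by nlinarith
  refine ⟨by nlinarith, hs, ?_⟩
  have hs1 : 0 < s - 1 := by linarith
  have hs2 : 0 < s ^ 2 - 1 := by nlinarith
  have e1 : ((k : ℝ) - 1) * (2 / (s ^ 2 - 1) + (k : ℝ) / (s ^ 2 - 1) ^ 2) =
     (((k : ℝ) - 1) * (2 * s ^ 2 - 2 + k)) / (s ^ 2 - 1) ^ 2 := by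
    field_simp
  have e2 : (k : ℝ) * s / (s - 1) ^ 2 = (k * s * (s + 1) ^ 2) / (s ^ 2 - 1) ^ 2 := by
    rw [show s ^ 2 - 1 = (s - 1) * (s + 1) by ring]
    field_simp
  rw [e1, e2]
  refine div_le_div_of_nonneg_right ?_ (by positivity)
  have a1 : ((k : ℝ) - 1) * (2 * s ^ 2 - 2 + k) ≤ k * (2 * s ^ 2 - 2 + k) := by nlinarith
  have a2 : s ^ 2 ≤ s ^ 3 := by nlinarith [sq_nonneg s]
  have a3 : (k : ℝ) * (2 * s ^ 2 - 2 + k) ≤ k * (s * (s + 1) ^ 2) := by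
    apply mul_le_mul_of_nonneg_left _ (by linarith)
    nlinarith
  linarith

/-- For `ε ≥ ln k`, the empirical estimator under `k`-RR has squared `ℓ2` risk at most
that of the empirical estimator under `k`-RAPPOR, for every `p ∈ S^k`; equivalently,
`(k−1)(2/(e^ε−1) + k/(e^ε−1)²) ≤ k e^{ε/2}/(e^{ε/2}−1)²`. -/
theorem kRR_l2_risk_le_kRappor_l2_risk (k n : ℕ) (hk : 2 ≤ k) (hn : 1 ≤ n)
    (ε : ℝ) (hε : Real.log k ≤ ε) :
    (∀ p : Fin k → ℝ, (∀ i, 0 ≤ p i) → ∑ i, p i = 1 →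
      ∑ y : Fin n → Fin k,
          kRRJointProb k n ε p y * ∑ i, (kRREmpEst k n ε y i - p i) ^ 2 ≤
        ∑ y : Fin n → Fin k → Bool,
          kRapporJointProb k n ε p y * ∑ j, (kRapporEmpEst k n ε y j - p j) ^ 2) ∧
    ((k : ℝ) - 1) * (2 / (Real.exp ε - 1) + (k : ℝ) / (Real.exp ε - 1) ^ 2) ≤
      (k : ℝ) * Real.exp (ε / 2) / (Real.exp (ε / 2) - 1) ^ 2 := by
  obtain ⟨hE, hs, hineq⟩ := aux_ineq k hk ε hε
  refine ⟨fun p _ hp => ?_, hineq⟩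
  rw [aux_kRR k n hk hn ε hE p hp, aux_rappor k n hn ε hs p hp]
  gcongr
end

section
/- For every fixed integer k ≥ 2, the function ε ↦ f(ε, k) = (k/(k−1)) · ((e^ε − 1)/(e^{ε/2} − 1))² · e^{ε/2}/(2e^ε + k − 2) is increasing in ε on (0, ∞). -/
/-- `f(ε, k) = (k/(k−1)) · ((e^ε − 1)/(e^{ε/2} − 1))² · e^{ε/2}/(2e^ε + k − 2)`. -/
noncomputable def fRisk (k : ℕ) (ε : ℝ) : ℝ :=
  ((k : ℝ) / ((k : ℝ) - 1)) *
    ((Real.exp ε - 1) / (Real.exp (ε / 2) - 1)) ^ 2 *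
    (Real.exp (ε / 2) / (2 * Real.exp ε + (k : ℝ) - 2))

/-- For every fixed integer `k ≥ 2`, the function `ε ↦ f(ε, k)` is increasing in `ε`
on `(0, ∞)`. -/
theorem fRisk_strictMonoOn (k : ℕ) (hk : 2 ≤ k) :
    StrictMonoOn (fRisk k) (Set.Ioi (0 : ℝ)) := by
  intro a ha b hb hab
  simp only [Set.mem_Ioi] at ha hb
  have hk' : (2 : ℝ) ≤ (k : ℝ) := by exact_mod_cast hk
  have key : ∀ t : ℝ, 0 < t → fRisk k t = ((k : ℝ) / ((k : ℝ) - 1)) *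
      ((Real.exp (t / 2) + 1) ^ 2 * Real.exp (t / 2) /
        (2 * Real.exp (t / 2) ^ 2 + ((k : ℝ) - 2))) := by
    intro t ht
    have h1 : 1 < Real.exp (t / 2) := Real.one_lt_exp_iff.mpr (by linarith)
    have h2 : Real.exp t = Real.exp (t / 2) ^ 2 := by
      rw [← Real.exp_nat_mul]; congr 1; push_cast; ring
    unfold fRisk
    rw [h2]
    have h3 : (Real.exp (t / 2) ^ 2 - 1) / (Real.exp (t / 2) - 1) = Real.exp (t / 2) + 1 := by
      rw [div_eq_iff (by linarith)]; ring
    rw [h3, mul_assoc, mul_div_assoc, add_sub_assoc]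
  rw [key a ha, key b hb]
  have hx : 1 < Real.exp (a / 2) := Real.one_lt_exp_iff.mpr (by linarith)
  have hxy : Real.exp (a / 2) < Real.exp (b / 2) := Real.exp_lt_exp.mpr (by linarith)
  generalize Real.exp (a / 2) = x at *
  generalize Real.exp (b / 2) = y at *
  have hc : 0 < (k : ℝ) / ((k : ℝ) - 1) := div_pos (by linarith) (by linarith)
  apply mul_lt_mul_of_pos_left _ hc
  obtain ⟨m, hm⟩ : ∃ m : ℝ, m = (k : ℝ) - 2 := ⟨_, rfl⟩
  have hm0 : 0 ≤ m := by linarith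
  have hx0 : 0 < x := by linarith
  have hy0 : 0 < y := by linarith
  rw [← hm, div_lt_div_iff₀ (by positivity) (by positivity)]
  have e1 : 0 < 2 * (x * y) * ((y - x) * (x * y - 1)) := by
    have : 0 < y - x := by linarith
    have : 0 < x * y - 1 := by nlinarith
    have : 0 < x * y := by linarith
    positivity
  have e2 : (x + 1) ^ 2 * x ≤ (y + 1) ^ 2 * y := by gcongr
  have e3 := mul_le_mul_of_nonneg_right e2 hm0
  nlinarith [e1, e3]
end

section
/- Fix an integer k ≥ 2, ε > 0, and nonnegative integer counts T_1,…,T_k with Σ_i T_i = n ≥ 1. Suppose λ > 0 satisfies Σ_{i=1}^k max(T_i/λ − 1/(e^ε − 1), 0) = 1, and define p̂_i = max(T_i/λ − 1/(e^ε − 1), 0). Then p̂ ∈ S^k and p̂ maximizes the k-RR log-likelihood Σ_{i=1}^k T_i · log((e^ε − 1) p_i + 1) over all p ∈ S^k; consequently p̂ is the maximum likelihood estimate of p under the k-RR mechanism when T_i is the number of occurrences of symbol i among the privatized observations Y_1,…,Y_n. -/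
lemma kRR_term (t c lam p : ℝ) (ht : 0 ≤ t) (hc : 0 < c) (hl : 0 < lam) (hp : 0 ≤ p) :
    t * Real.log (c * p + 1) ≤
      t * Real.log (c * max (t / lam - 1 / c) 0 + 1) + lam * (p - max (t / lam - 1 / c) 0) := by
  have ha : 0 < c * p + 1 := by positivity
  rcases le_total (t / lam - 1 / c) 0 with h | h
  · rw [max_eq_right h]
    have h1 : t * c ≤ lam := by
      have : t / lam ≤ 1 / c := by linarith
      rw [div_le_div_iff₀ hl hc] at this
      linarith
    have h2 := mul_le_mul_of_nonneg_left (Real.log_le_sub_one_of_pos ha) ht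
    have h3 := mul_le_mul_of_nonneg_right h1 hp
    simp only [mul_zero, zero_add, Real.log_one, sub_zero]
    linarith
  · rw [max_eq_left h]
    have hb : c * (t / lam - 1 / c) + 1 = c * t / lam := by field_simp; ring
    have htl : 0 < t := by
      have h4 : 0 < 1 / c := by positivity
      have h5 : 0 < t / lam := by linarith
      exact (div_pos_iff_of_pos_right hl).1 h5
    rw [hb]
    have hb' : 0 < c * t / lam := by positivity
    have h2 := mul_le_mul_of_nonneg_left (Real.log_le_sub_one_of_pos (div_pos ha hb')) ht
    rw [Real.log_div ha.ne' hb'.ne'] at h2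
    have h3 : t * ((c * p + 1) / (c * t / lam) - 1) = lam * (p - (t / lam - 1 / c)) := by
      field_simp
      ring
    linarith

/-- Water-filling characterization of the maximum likelihood estimator under `k`-RR.
Given nonnegative integer counts `T_1, …, T_k` of the privatized observations with
`Σ_i T_i = n ≥ 1` and `λ > 0` satisfying `Σ_i max(T_i/λ − 1/(e^ε − 1), 0) = 1`, the
vector `p̂_i = max(T_i/λ − 1/(e^ε − 1), 0)` lies in the simplex `S^k` and maximizes
the `k`-RR log-likelihood `Σ_i T_i log((e^ε − 1) p_i + 1)` over all `p ∈ S^k`. -/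
theorem kRR_mle_waterfilling (k n : ℕ) (hk : 2 ≤ k) (hn : 1 ≤ n)
    (ε : ℝ) (hε : 0 < ε) (T : Fin k → ℕ) (hT : ∑ i, T i = n)
    (lam : ℝ) (hlam : 0 < lam)
    (hsum : ∑ i, max ((T i : ℝ) / lam - 1 / (Real.exp ε - 1)) 0 = 1) :
    ((∀ i, 0 ≤ max ((T i : ℝ) / lam - 1 / (Real.exp ε - 1)) 0) ∧
      ∑ i, max ((T i : ℝ) / lam - 1 / (Real.exp ε - 1)) 0 = 1) ∧
    ∀ p : Fin k → ℝ, (∀ i, 0 ≤ p i) → ∑ i, p i = 1 →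
      ∑ i, (T i : ℝ) * Real.log ((Real.exp ε - 1) * p i + 1) ≤
        ∑ i, (T i : ℝ) *
          Real.log ((Real.exp ε - 1) * max ((T i : ℝ) / lam - 1 / (Real.exp ε - 1)) 0 + 1) := by
  refine ⟨⟨fun i => le_max_right _ _, hsum⟩, fun p hp hp1 => ?_⟩
  have hc : 0 < Real.exp ε - 1 := by
    have := Real.add_one_lt_exp hε.ne'
    linarith
  have key := Finset.sum_le_sum (s := Finset.univ) fun i _ =>
    kRR_term (T i : ℝ) (Real.exp ε - 1) lam (p i) (Nat.cast_nonneg _) hc hlam (hp i)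
  rw [Finset.sum_add_distrib, ← Finset.mul_sum, Finset.sum_sub_distrib, hp1, hsum] at key
  linarith
end
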